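/- For every even n ≥ 2 there exists a McNaughton homeomorphism S of [0,1]^n that is topologically transitive: for all nonempty open subsets U, V of [0,1]^n there exists k ∈ ℕ with S^k(U) ∩ V ≠ ∅. -/

import Mathlib

/-- The unit cube `[0,1]^n` inside `Fin n → ℝ`. -/
def unitCube (n : ℕ) : Set (Fin n → ℝ) := Set.univ.pi fun _ => Set.Icc (0:ℝ) 1

/-- A McNaughton function in `n` variables: a continuous function
`[0,1]^n → [0,1]` which, at every point of the cube, agrees with one of
finitely many affine polynomials with integer coefficients. -/
def IsMcNaughtonFn {n : ℕ} (f : (Fin n → ℝ) → ℝ) : Prop :=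
  ContinuousOn f (unitCube n) ∧
  Set.MapsTo f (unitCube n) (Set.Icc (0:ℝ) 1) ∧
  ∃ (m : ℕ) (a : Fin m → Fin n → ℤ) (b : Fin m → ℤ),
    ∀ x ∈ unitCube n, ∃ j : Fin m,
      f x = (∑ i : Fin n, (a j i : ℝ) * x i) + (b j : ℝ)

/-- A McNaughton mapping of `[0,1]^n`: each coordinate is a McNaughton
function. -/
def IsMcNaughtonMap {n : ℕ} (S : (Fin n → ℝ) → (Fin n → ℝ)) : Prop :=
  ∀ i : Fin n, IsMcNaughtonFn (fun x => S x i)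

/-- A McNaughton homeomorphism of `[0,1]^n`: a McNaughton mapping which is a
bijection of the cube onto itself whose inverse is also a McNaughton mapping. -/
def IsMcNaughtonHomeo {n : ℕ} (S : (Fin n → ℝ) → (Fin n → ℝ)) : Prop :=
  IsMcNaughtonMap S ∧ ∃ T : (Fin n → ℝ) → (Fin n → ℝ), IsMcNaughtonMap T ∧
    (∀ x ∈ unitCube n, T (S x) = x) ∧ (∀ x ∈ unitCube n, S (T x) = x)

/-- `p ∈ [0,1]^n` has `d` as a denominator: `d > 0` and `d • p ∈ ℤ^n`. -/
def IsDenom {n : ℕ} (p : Fin n → ℝ) (d : ℕ) : Prop :=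
  0 < d ∧ ∀ i : Fin n, ∃ z : ℤ, (d : ℝ) * p i = (z : ℝ)

/-- The denominator of a point: the least positive integer `d` with
`d • p ∈ ℤ^n` (junk value `0` if there is none). -/
noncomputable def den {n : ℕ} (p : Fin n → ℝ) : ℕ := sInf {d | IsDenom p d}

namespace SheetModel

open Set

/-- Two sheets `Ap`, `Am` glued along slits, with two handles `T`, `T'`, and the two
leaf functions `d`, `e`. -/
structure Regions {X : Type*} [TopologicalSpace X] (Ap Am T T' : Set X) (d e : X → ℝ) : Prop where
  isClosed_Ap : IsClosed Ap
  isClosed_Am : IsClosed Am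
  isClosed_T : IsClosed T
  isClosed_T' : IsClosed T'
  cover : ∀ z, z ∈ Ap ∨ z ∈ Am ∨ z ∈ T ∨ z ∈ T'
  continuous_d : Continuous d
  continuous_e : Continuous e
  d_nonneg : ∀ z, 0 ≤ d z
  d_le : ∀ z, d z ≤ 1 / 2
  e_nonneg : ∀ z, 0 ≤ e z
  e_le : ∀ z, e z ≤ 1 / 2
  e_of_T : ∀ z ∈ T, e z = 0
  d_of_T' : ∀ z ∈ T', d z = 0
  slit : ∀ z ∈ Ap, z ∈ Am → d z = 1 / 2 ∨ e z = 1 / 2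

/-- Coordinates on the annulus `Ap ∪ Am ∪ T` foliated by the level sets of `d`: `psi t δ` is
the point at position `t ∈ [0, 2 L δ]` on the leaf `d = δ`. -/
structure Chart {X : Type*} [TopologicalSpace X] (Ap Am T : Set X) (d e : X → ℝ) where
  L : ℝ → ℝ
  psi : ℝ → ℝ → X
  th : X → ℝ
  continuous_L : Continuous L
  antitone_L : Antitone L
  L_half : L (1 / 2) = 1 / 2
  continuousOn_psi : ContinuousOn (fun p : ℝ × ℝ => psi p.1 p.2)
    {p | 0 ≤ p.2 ∧ p.2 ≤ 1 / 2 ∧ 0 ≤ p.1 ∧ p.1 ≤ 2 * L p.2}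
  continuous_th : Continuous th
  psi_Ap : ∀ t δ, 0 ≤ δ → δ ≤ 1 / 2 → 0 ≤ t → t ≤ 1 / 2 →
    psi t δ ∈ Ap ∧ d (psi t δ) = δ ∧ e (psi t δ) = t
  psi_Am : ∀ t δ, 0 ≤ δ → δ ≤ 1 / 2 → 1 / 2 ≤ t → t ≤ 1 →
    psi t δ ∈ Am ∧ d (psi t δ) = δ ∧ e (psi t δ) = 1 - t
  psi_T : ∀ t δ, 0 ≤ δ → δ ≤ 1 / 2 → 1 ≤ t → t ≤ 2 * L δ →
    psi t δ ∈ T ∧ d (psi t δ) = δ ∧ th (psi t δ) = t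
  psi_wrap : ∀ δ, 0 ≤ δ → δ ≤ 1 / 2 → psi (2 * L δ) δ = psi 0 δ
  of_Ap : ∀ z ∈ Ap, psi (e z) (d z) = z
  of_Am : ∀ z ∈ Am, psi (1 - e z) (d z) = z
  of_T : ∀ z ∈ T, psi (th z) (d z) = z ∧ 1 ≤ th z ∧ th z ≤ 2 * L (d z)

variable {X : Type*} [TopologicalSpace X] {Ap Am T T' : Set X} {d e : X → ℝ}

theorem Regions.swap (r : Regions Ap Am T T' d e) : Regions Ap Am T' T e d where
  isClosed_Ap := r.isClosed_Ap
  isClosed_Am := r.isClosed_Am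
  isClosed_T := r.isClosed_T'
  isClosed_T' := r.isClosed_T
  cover z := by rcases r.cover z with h | h | h | h <;> simp [h]
  continuous_d := r.continuous_e
  continuous_e := r.continuous_d
  d_nonneg := r.e_nonneg
  d_le := r.e_le
  e_nonneg := r.d_nonneg
  e_le := r.d_le
  e_of_T := r.d_of_T'
  d_of_T' := r.e_of_T
  slit z h h' := (r.slit z h h').symm

theorem Regions.rev (r : Regions Ap Am T T' d e) : Regions Am Ap T T' d e where
  isClosed_Ap := r.isClosed_Am
  isClosed_Am := r.isClosed_Ap
  isClosed_T := r.isClosed_T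
  isClosed_T' := r.isClosed_T'
  cover z := by rcases r.cover z with h | h | h | h <;> simp [h]
  continuous_d := r.continuous_d
  continuous_e := r.continuous_e
  d_nonneg := r.d_nonneg
  d_le := r.d_le
  e_nonneg := r.e_nonneg
  e_le := r.e_le
  e_of_T := r.e_of_T
  d_of_T' := r.d_of_T'
  slit z h h' := r.slit z h' h

namespace Chart

theorem one_le (P : Chart Ap Am T d e) {δ : ℝ} (h : δ ≤ 1 / 2) : 1 ≤ 2 * P.L δ := by
  have := P.antitone_L h
  rw [P.L_half] at this
  linarith

theorem d_psi (P : Chart Ap Am T d e) {t δ : ℝ} (h0 : 0 ≤ δ) (h1 : δ ≤ 1 / 2) (h2 : 0 ≤ t)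
    (h3 : t ≤ 2 * P.L δ) : d (P.psi t δ) = δ := by
  rcases le_total t (1 / 2) with h | h
  · exact (P.psi_Ap t δ h0 h1 h2 h).2.1
  rcases le_total t 1 with h' | h'
  · exact (P.psi_Am t δ h0 h1 h h').2.1
  · exact (P.psi_T t δ h0 h1 h' h3).2.1

theorem psi_inj (r : Regions Ap Am T T' d e) (P : Chart Ap Am T d e) {t t' δ : ℝ} (h0 : 0 ≤ δ)
    (h1 : δ < 1 / 2) (h2 : 0 ≤ t) (h3 : t ≤ 2 * P.L δ) (h2' : 0 ≤ t') (h3' : t' ≤ 2 * P.L δ)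
    (h : P.psi t δ = P.psi t' δ) (htt : t ≤ t') : t = t' ∨ (t = 0 ∧ t' = 2 * P.L δ) := by
  have h1' := h1.le
  have hL := P.one_le h1'
  rcases le_total t (1 / 2) with a | a
  · obtain ⟨m, -, k⟩ := P.psi_Ap t δ h0 h1' h2 a
    rcases le_total t' (1 / 2) with b | b
    · obtain ⟨m', -, k'⟩ := P.psi_Ap t' δ h0 h1' h2' b
      left; rw [← k, ← k', h]
    rcases le_total t' 1 with c | c
    · obtain ⟨m', k2, k'⟩ := P.psi_Am t' δ h0 h1' b c
      rw [h] at m k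
      rcases r.slit _ m m' with q | q
      · linarith
      · left; linarith
    · obtain ⟨m', k2, k'⟩ := P.psi_T t' δ h0 h1' c h3'
      have := r.e_of_T _ m'
      rw [h] at k
      have ht : t = 0 := by linarith
      refine Or.inr ⟨ht, ?_⟩
      subst ht
      rw [← k', ← h, ← P.psi_wrap δ h0 h1']
      exact (P.psi_T _ δ h0 h1' hL le_rfl).2.2
  rcases le_total t 1 with b | b
  · obtain ⟨m, -, k⟩ := P.psi_Am t δ h0 h1' a b
    rcases le_total t' 1 with c | c
    · obtain ⟨m', k2, k'⟩ := P.psi_Am t' δ h0 h1' (a.trans htt) c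
      rw [h] at k
      left; linarith
    · obtain ⟨m', k2, k'⟩ := P.psi_T t' δ h0 h1' c h3'
      have := r.e_of_T _ m'
      rw [h] at k
      have ht : t = 1 := by linarith
      left
      subst ht
      rw [← k', ← h]
      exact (P.psi_T _ δ h0 h1' le_rfl hL).2.2.symm
  · left
    rw [← (P.psi_T t δ h0 h1' b h3).2.2, ← (P.psi_T t' δ h0 h1' (b.trans htt) h3').2.2, h]

open Classical in
/-- The coordinate of a point along its leaf. -/
noncomputable def lift (P : Chart Ap Am T d e) (z : X) : ℝ :=
  if z ∈ Ap then e z else if z ∈ Am then 1 - e z else P.th z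

/-- The position reached from position `t` of leaf `δ` by the flow. -/
noncomputable def step (P : Chart Ap Am T d e) (t δ : ℝ) : ℝ :=
  if t + 2 * δ ≤ 2 * P.L δ then t + 2 * δ else t + 2 * δ - 2 * P.L δ

theorem step_mem (P : Chart Ap Am T d e) {t δ : ℝ} (h0 : 0 ≤ δ) (h1 : δ ≤ 1 / 2) (h2 : 0 ≤ t)
    (h3 : t ≤ 2 * P.L δ) : 0 ≤ P.step t δ ∧ P.step t δ ≤ 2 * P.L δ := by
  have hL := P.one_le h1
  unfold step
  split_ifs <;> constructor <;> linarith

/-- Every point of the annulus is `psi (lift z) (d z)`. -/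
theorem psi_lift (r : Regions Ap Am T T' d e) (P : Chart Ap Am T d e) {z : X}
    (hz : z ∈ Ap ∨ z ∈ Am ∨ z ∈ T) :
    P.psi (P.lift z) (d z) = z ∧ 0 ≤ P.lift z ∧ P.lift z ≤ 2 * P.L (d z) := by
  have hL := P.one_le (r.d_le z)
  have h0 := r.e_nonneg z
  have h1 := r.e_le z
  unfold lift
  split_ifs with a b
  · exact ⟨P.of_Ap z a, h0, by linarith⟩
  · exact ⟨P.of_Am z b, by linarith, by linarith⟩
  · obtain ⟨p, q, s⟩ := P.of_T z (by tauto)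
    exact ⟨p, by linarith, s⟩

open Classical in
/-- The twist along the leaves of `d`. -/
noncomputable def twist (_ : Regions Ap Am T T' d e) (P : Chart Ap Am T d e) (z : X) : X :=
  if z ∈ T' then z else P.psi (P.step (P.lift z) (d z)) (d z)

theorem psi_step_half (P : Chart Ap Am T d e) {t : ℝ} (h2 : 0 ≤ t)
    (h3 : t ≤ 1) : P.psi (P.step t (1 / 2)) (1 / 2) = P.psi t (1 / 2) := by
  unfold step
  have hw := P.psi_wrap (1 / 2) (by norm_num) le_rfl
  rw [P.L_half] at *
  split_ifs with h
  · have : t = 0 := by linarith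
    subst this
    norm_num at hw ⊢
    exact hw
  · congr 1; ring

theorem psi_step_zero (P : Chart Ap Am T d e) {t : ℝ} (h3 : t ≤ 2 * P.L 0) :
    P.psi (P.step t 0) 0 = P.psi t 0 := by
  unfold step
  rw [if_pos (by linarith)]
  congr 1; ring

theorem twist_psi (r : Regions Ap Am T T' d e) (P : Chart Ap Am T d e) {t δ : ℝ} (h0 : 0 ≤ δ)
    (h1 : δ ≤ 1 / 2) (h2 : 0 ≤ t) (h3 : t ≤ 2 * P.L δ) :
    P.twist r (P.psi t δ) = P.psi (P.step t δ) δ := by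
  have hd := P.d_psi h0 h1 h2 h3
  unfold twist
  rw [hd]
  split_ifs with h
  · have : δ = 0 := by rw [← hd, r.d_of_T' _ h]
    subst this
    exact (P.psi_step_zero h3).symm
  · have hP : P.psi t δ ∈ Ap ∨ P.psi t δ ∈ Am ∨ P.psi t δ ∈ T := by
      have := r.cover (P.psi t δ)
      tauto
    obtain ⟨k1, k2, k3⟩ := P.psi_lift r hP
    rw [hd] at k1 k3
    set t' := P.lift (P.psi t δ)
    rcases eq_or_lt_of_le h1 with rfl | h1'
    · have hL := P.L_half
      rw [P.psi_step_half h2 (by linarith), P.psi_step_half k2 (by linarith), k1]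
    have key : P.step t δ = P.step t' δ ∨
        (P.step t δ = 0 ∧ P.step t' δ = 2 * P.L δ) ∨ (P.step t' δ = 0 ∧ P.step t δ = 2 * P.L δ) := by
      have h01 : P.step 0 δ = P.step (2 * P.L δ) δ ∨
          (P.step 0 δ = 0 ∧ P.step (2 * P.L δ) δ = 2 * P.L δ) := by
        have hL := P.one_le h1
        unfold step
        rw [if_pos (by linarith)]
        split_ifs with q
        · right; constructor <;> linarith
        · left; ring
      rcases le_total t t' with hh | hh
      · rcases P.psi_inj r h0 h1' h2 h3 k2 k3 k1.symm hh with q | ⟨q, q'⟩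
        · rw [q]; simp
        · rw [q, q']; tauto
      · rcases P.psi_inj r h0 h1' k2 k3 h2 h3 k1 hh with q | ⟨q, q'⟩
        · rw [q]; simp
        · rw [q, q']
          rcases h01 with h | h
          · exact Or.inl h.symm
          · tauto
    have hw := P.psi_wrap δ h0 h1
    rcases key with q | ⟨q, q'⟩ | ⟨q, q'⟩
    · rw [q]
    · rw [q, q', hw]
    · rw [q, q', hw]

theorem twist_of_T' (r : Regions Ap Am T T' d e) (P : Chart Ap Am T d e) {z : X} (h : z ∈ T') :
    P.twist r z = z := by simp [twist, h]

theorem d_twist (r : Regions Ap Am T T' d e) (P : Chart Ap Am T d e) (z : X) :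
    d (P.twist r z) = d z := by
  by_cases h : z ∈ T'
  · rw [P.twist_of_T' r h]
  · have hP : z ∈ Ap ∨ z ∈ Am ∨ z ∈ T := by
      have := r.cover z
      tauto
    obtain ⟨k1, k2, k3⟩ := P.psi_lift r hP
    obtain ⟨m1, m2⟩ := P.step_mem (r.d_nonneg z) (r.d_le z) k2 k3
    conv_lhs => rw [← k1, P.twist_psi r (r.d_nonneg z) (r.d_le z) k2 k3]
    exact P.d_psi (r.d_nonneg z) (r.d_le z) m1 m2

theorem twist_eq_self (r : Regions Ap Am T T' d e) (P : Chart Ap Am T d e) {z : X}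
    (h : d z = 0 ∨ d z = 1 / 2) : P.twist r z = z := by
  by_cases h' : z ∈ T'
  · rw [P.twist_of_T' r h']
  · have hP : z ∈ Ap ∨ z ∈ Am ∨ z ∈ T := by
      have := r.cover z
      tauto
    obtain ⟨k1, k2, k3⟩ := P.psi_lift r hP
    conv_lhs => rw [← k1, P.twist_psi r (r.d_nonneg z) (r.d_le z) k2 k3]
    rcases h with h | h
    · rw [h] at k1 k3 ⊢
      rw [P.psi_step_zero k3, k1]
    · rw [h] at k1 k3 ⊢
      have hL := P.L_half
      rw [P.psi_step_half k2 (by linarith), k1]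

theorem continuous_twist (r : Regions Ap Am T T' d e) (P : Chart Ap Am T d e) :
    Continuous (P.twist r) := by
  have key : ∀ (K : Set X) (τ : X → ℝ), IsClosed K → Continuous τ →
      (∀ z ∈ K, P.psi (τ z) (d z) = z ∧ 0 ≤ τ z ∧ τ z ≤ 2 * P.L (d z)) →
      ContinuousOn (P.twist r) K := by
    intro K τ hK hτ hz
    have hdc := r.continuous_d
    have hLc : Continuous fun z => P.L (d z) := P.continuous_L.comp hdc
    have c1 : IsClosed (K ∩ {z | τ z + 2 * d z ≤ 2 * P.L (d z)}) :=
      hK.inter (isClosed_le (by fun_prop) (by fun_prop))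
    have c2 : IsClosed (K ∩ {z | 2 * P.L (d z) ≤ τ z + 2 * d z}) :=
      hK.inter (isClosed_le (by fun_prop) (by fun_prop))
    have e1 : ContinuousOn (P.twist r) (K ∩ {z | τ z + 2 * d z ≤ 2 * P.L (d z)}) := by
      have : ContinuousOn (fun z => P.psi (τ z + 2 * d z) (d z))
          (K ∩ {z | τ z + 2 * d z ≤ 2 * P.L (d z)}) :=
        P.continuousOn_psi.comp (f := fun z => (τ z + 2 * d z, d z))
          (Continuous.continuousOn (by fun_prop)) fun z h => by
            have := hz z h.1
            have h0 := r.d_nonneg z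
            exact ⟨h0, r.d_le z, by simp only; linarith, h.2⟩
      refine this.congr fun z h => ?_
      obtain ⟨k1, k2, k3⟩ := hz z h.1
      conv_lhs => rw [← k1]
      rw [P.twist_psi r (r.d_nonneg z) (r.d_le z) k2 k3, step, if_pos (show _ ≤ _ from h.2)]
    have e2 : ContinuousOn (P.twist r) (K ∩ {z | 2 * P.L (d z) ≤ τ z + 2 * d z}) := by
      have : ContinuousOn (fun z => P.psi (τ z + 2 * d z - 2 * P.L (d z)) (d z))
          (K ∩ {z | 2 * P.L (d z) ≤ τ z + 2 * d z}) :=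
        P.continuousOn_psi.comp (f := fun z => (τ z + 2 * d z - 2 * P.L (d z), d z))
          (Continuous.continuousOn (by fun_prop)) fun z h => by
            have := hz z h.1
            have h0 := r.d_nonneg z
            have h1 := r.d_le z
            have h2 := P.one_le h1
            have h3 : 2 * P.L (d z) ≤ τ z + 2 * d z := h.2
            exact ⟨h0, h1, by simp only; linarith, by simp only; linarith⟩
      refine this.congr fun z h => ?_
      obtain ⟨k1, k2, k3⟩ := hz z h.1
      have h3 : 2 * P.L (d z) ≤ τ z + 2 * d z := h.2
      conv_lhs => rw [← k1]
      rw [P.twist_psi r (r.d_nonneg z) (r.d_le z) k2 k3, step]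
      split_ifs with hh
      · simp only
        rw [le_antisymm hh h3, sub_self, P.psi_wrap _ (r.d_nonneg z) (r.d_le z)]
      · rfl
    refine (e1.union_of_isClosed e2 c1 c2).mono fun z h => ?_
    rcases le_total (τ z + 2 * d z) (2 * P.L (d z)) with h' | h'
    · exact Or.inl ⟨h, h'⟩
    · exact Or.inr ⟨h, h'⟩
  have hec := r.continuous_e
  have k1 := key Ap e r.isClosed_Ap hec fun z h =>
    ⟨P.of_Ap z h, r.e_nonneg z, by have := P.one_le (r.d_le z); have := r.e_le z; linarith⟩
  have k2 := key Am (fun z => 1 - e z) r.isClosed_Am (by fun_prop) fun z h =>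
    ⟨P.of_Am z h, by have := r.e_le z; linarith,
      by have := P.one_le (r.d_le z); have := r.e_nonneg z; linarith⟩
  have k3 := key T P.th r.isClosed_T P.continuous_th fun z h =>
    ⟨(P.of_T z h).1, by have := (P.of_T z h).2.1; linarith, (P.of_T z h).2.2⟩
  have k4 : ContinuousOn (P.twist r) T' := continuousOn_id.congr fun z h => P.twist_of_T' r h
  rw [← continuousOn_univ]
  refine (((k1.union_of_isClosed k2 r.isClosed_Ap r.isClosed_Am).union_of_isClosed k3
    (r.isClosed_Ap.union r.isClosed_Am) r.isClosed_T).union_of_isClosed k4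
    ((r.isClosed_Ap.union r.isClosed_Am).union r.isClosed_T) r.isClosed_T').mono fun z _ => ?_
  have := r.cover z
  simp only [mem_union]
  tauto

/-- The same annulus with the leaves traversed backwards. -/
noncomputable def rev (r : Regions Ap Am T T' d e) (P : Chart Ap Am T d e) :
    Chart Am Ap T d e where
  L := P.L
  psi t δ := if t ≤ 1 then P.psi (1 - t) δ else P.psi (1 - t + 2 * P.L δ) δ
  th z := 1 - P.th z + 2 * P.L (d z)
  continuous_L := P.continuous_L
  antitone_L := P.antitone_L
  L_half := P.L_half
  continuousOn_psi := by
    have hLc := P.continuous_L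
    have e1 : ContinuousOn (fun p : ℝ × ℝ =>
        if p.1 ≤ 1 then P.psi (1 - p.1) p.2 else P.psi (1 - p.1 + 2 * P.L p.2) p.2)
        {p | 0 ≤ p.2 ∧ p.2 ≤ 1 / 2 ∧ 0 ≤ p.1 ∧ p.1 ≤ 1} := by
      refine (P.continuousOn_psi.comp (f := fun p : ℝ × ℝ => (1 - p.1, p.2))
        (Continuous.continuousOn (by fun_prop)) fun p h => ?_).congr fun p h => ?_
      · obtain ⟨a, b, c, c'⟩ := h
        have := P.one_le b
        exact ⟨a, b, by simp only; linarith, by simp only; linarith⟩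
      · exact if_pos h.2.2.2
    have e2 : ContinuousOn (fun p : ℝ × ℝ =>
        if p.1 ≤ 1 then P.psi (1 - p.1) p.2 else P.psi (1 - p.1 + 2 * P.L p.2) p.2)
        {p | 0 ≤ p.2 ∧ p.2 ≤ 1 / 2 ∧ 1 ≤ p.1 ∧ p.1 ≤ 2 * P.L p.2} := by
      refine (P.continuousOn_psi.comp (f := fun p : ℝ × ℝ => (1 - p.1 + 2 * P.L p.2, p.2))
        (Continuous.continuousOn (by fun_prop)) fun p h => ?_).congr fun p h => ?_
      · obtain ⟨a, b, c, c'⟩ := h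
        exact ⟨a, b, by simp only; linarith, by simp only; linarith⟩
      · obtain ⟨a, b, c, c'⟩ := h
        simp only [Function.comp]
        split_ifs with h'
        · rw [le_antisymm h' c, sub_self, zero_add]
          exact (P.psi_wrap _ a b).symm
        · rfl
    have i1 : IsClosed {p : ℝ × ℝ | 0 ≤ p.2 ∧ p.2 ≤ 1 / 2 ∧ 0 ≤ p.1 ∧ p.1 ≤ 1} := by
      simp only [ofPred_and]
      refine (isClosed_le ?_ ?_).inter ((isClosed_le ?_ ?_).inter
        ((isClosed_le ?_ ?_).inter (isClosed_le ?_ ?_))) <;> fun_prop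
    have i2 : IsClosed {p : ℝ × ℝ | 0 ≤ p.2 ∧ p.2 ≤ 1 / 2 ∧ 1 ≤ p.1 ∧ p.1 ≤ 2 * P.L p.2} := by
      simp only [ofPred_and]
      refine (isClosed_le ?_ ?_).inter ((isClosed_le ?_ ?_).inter
        ((isClosed_le ?_ ?_).inter (isClosed_le ?_ ?_))) <;> fun_prop
    refine (e1.union_of_isClosed e2 i1 i2).mono fun p h => ?_
    obtain ⟨a, b, c, c'⟩ := h
    rcases le_total p.1 1 with h' | h'
    · exact Or.inl ⟨a, b, c, h'⟩
    · exact Or.inr ⟨a, b, h', c'⟩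
  continuous_th := by
    have := P.continuous_th
    have h2 : Continuous fun z => P.L (d z) := P.continuous_L.comp r.continuous_d
    fun_prop
  psi_Ap t δ h0 h1 h2 h3 := by
    rw [if_pos (by linarith)]
    obtain ⟨a, b, c⟩ := P.psi_Am (1 - t) δ h0 h1 (by linarith) (by linarith)
    exact ⟨a, b, by rw [c]; ring⟩
  psi_Am t δ h0 h1 h2 h3 := by
    rw [if_pos (by linarith)]
    exact P.psi_Ap (1 - t) δ h0 h1 (by linarith) (by linarith)
  psi_T t δ h0 h1 h2 h3 := by
    have key : (if t ≤ 1 then P.psi (1 - t) δ else P.psi (1 - t + 2 * P.L δ) δ)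
        = P.psi (1 - t + 2 * P.L δ) δ := by
      split_ifs with h
      · rw [le_antisymm h h2, sub_self, zero_add, P.psi_wrap _ h0 h1]
      · rfl
    rw [key]
    obtain ⟨a, b, c⟩ := P.psi_T (1 - t + 2 * P.L δ) δ h0 h1 (by linarith) (by linarith)
    exact ⟨a, b, by rw [c, b]; ring⟩
  psi_wrap δ h0 h1 := by
    have hL := P.one_le h1
    rw [if_pos zero_le_one]
    split_ifs with h
    · have h2 : 2 * P.L δ = 1 := le_antisymm h hL
      have := P.psi_wrap δ h0 h1
      rw [h2] at this ⊢
      simp [this]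
    · congr 1; ring
  of_Ap z h := by
    rw [if_pos (by have := r.e_le z; linarith)]
    exact P.of_Am z h
  of_Am z h := by
    rw [if_pos (by have := r.e_nonneg z; linarith)]
    simpa using P.of_Ap z h
  of_T z h := by
    obtain ⟨a, b, c⟩ := P.of_T z h
    refine ⟨?_, by linarith, by linarith⟩
    split_ifs with h'
    · have : P.th z = 2 * P.L (d z) := by linarith
      have h3 := P.psi_wrap (d z) (r.d_nonneg z) (r.d_le z)
      rw [← this] at h3 ⊢
      simp only [sub_add_cancel, sub_self]
      rw [← h3, a]
    · ring_nf
      exact a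

theorem twist_rev_twist (r : Regions Ap Am T T' d e) (P : Chart Ap Am T d e) (z : X) :
    (P.rev r).twist r.rev (P.twist r z) = z := by
  by_cases h' : z ∈ T'
  · rw [P.twist_of_T' r h', twist_of_T' _ _ h']
  by_cases hh : d z = 0 ∨ d z = 1 / 2
  · rw [P.twist_eq_self r hh, twist_eq_self _ _ hh]
  · have hP : z ∈ Ap ∨ z ∈ Am ∨ z ∈ T := by
      have := r.cover z
      tauto
    have h0 := r.d_nonneg z
    have h1 := r.d_le z
    have hL := P.one_le h1
    obtain ⟨k1, k2, k3⟩ := P.psi_lift r hP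
    obtain ⟨m1, m2⟩ := P.step_mem h0 h1 k2 k3
    have hw := P.psi_wrap _ h0 h1
    have hb : P.twist r z = P.psi (P.step (P.lift z) (d z)) (d z) := by
      conv_lhs => rw [← k1]
      exact P.twist_psi r h0 h1 k2 k3
    -- position of a point of the leaf for the reversed chart
    have hr : ∀ t, 0 ≤ t → t ≤ 2 * P.L (d z) → ∃ t', 0 ≤ t' ∧ t' ≤ 2 * P.L (d z) ∧
        (P.rev r).psi t' (d z) = P.psi t (d z) ∧ (t' = 1 - t ∨ t' = 1 - t + 2 * P.L (d z)) := by
      intro t a b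
      by_cases c : t ≤ 1
      · refine ⟨1 - t, by linarith, by linarith, ?_, Or.inl rfl⟩
        simp only [rev]
        rw [if_pos (by linarith)]
        congr 1; ring
      · refine ⟨1 - t + 2 * P.L (d z), by linarith, by linarith, ?_, Or.inr rfl⟩
        simp only [rev]
        split_ifs with q
        · have : t = 2 * P.L (d z) := by linarith
          rw [this, hw]; congr 1; ring
        · congr 1; ring
    obtain ⟨t', a, b, c, h⟩ := hr _ m1 m2
    rw [hb, ← c, (P.rev r).twist_psi r.rev h0 h1 a b]
    conv_rhs => rw [← k1]
    have hs : P.step (P.lift z) (d z) = P.lift z + 2 * d z ∨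
        P.step (P.lift z) (d z) = P.lift z + 2 * d z - 2 * P.L (d z) := by
      unfold step; split_ifs <;> simp
    obtain ⟨n1, n2⟩ := (P.rev r).step_mem h0 h1 a b
    have hs' : (P.rev r).step t' (d z) = t' + 2 * d z ∨
        (P.rev r).step t' (d z) = t' + 2 * d z - 2 * P.L (d z) := by
      unfold step; split_ifs <;> simp [rev]
    set s' := (P.rev r).step t' (d z)
    set s := P.step (P.lift z) (d z)
    have n2' : s' ≤ 2 * P.L (d z) := n2
    -- the final position differs from `lift z` by a multiple of the period
    have fin : ∀ s t, 0 ≤ s → s ≤ 2 * P.L (d z) → 0 ≤ t → t ≤ 2 * P.L (d z) →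
        (∃ k : ℤ, s = 1 - t + k * (2 * P.L (d z))) → (P.rev r).psi s (d z) = P.psi t (d z) := by
      rintro s t a b a' b' ⟨k, hk⟩
      have hk0 : (-2 : ℝ) < k := by
        by_contra hc
        push Not at hc
        nlinarith
      have hk1 : (k : ℝ) < 3 := by
        by_contra hc
        push Not at hc
        nlinarith
      have hk0' : -2 < k := by exact_mod_cast hk0
      have hk1' : k < 3 := by exact_mod_cast hk1
      simp only [rev]
      interval_cases k
      · norm_num at hk
        have e1 : 2 * P.L (d z) = 1 := by linarith
        have e2 : t = 0 := by linarith
        have e3 : s = 0 := by linarith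
        rw [e1] at hw
        rw [e2, e3, if_pos (by norm_num), ← hw]
        congr 1; ring
      · rw [if_pos (by norm_num at hk; linarith)]
        congr 1; rw [hk]; push_cast; ring
      · norm_num at hk
        split_ifs with q
        · have : t = 2 * P.L (d z) := by linarith
          rw [this, hw]; congr 1; rw [hk, this]; ring
        · congr 1; rw [hk]; ring
      · norm_num at hk
        have e1 : 2 * P.L (d z) = 1 := by linarith
        have e2 : t = 1 := by linarith
        have e3 : s = 2 := by linarith
        linarith
    refine fin s' (P.lift z) n1 n2' k2 k3 ?_
    rcases hs with hs | hs <;> rcases hs' with hs' | hs' <;> rcases h with h | h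
    · exact ⟨0, by push_cast; linarith⟩
    · exact ⟨1, by push_cast; linarith⟩
    · exact ⟨-1, by push_cast; linarith⟩
    · exact ⟨0, by push_cast; linarith⟩
    · exact ⟨1, by push_cast; linarith⟩
    · exact ⟨2, by push_cast; linarith⟩
    · exact ⟨0, by push_cast; linarith⟩
    · exact ⟨1, by push_cast; linarith⟩

theorem twist_twist_rev (r : Regions Ap Am T T' d e) (P : Chart Ap Am T d e) (z : X) :
    P.twist r ((P.rev r).twist r.rev z) = z := by
  conv_rhs => rw [← (P.rev r).twist_rev_twist r.rev z]
  generalize (P.rev r).twist r.rev z = w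
  by_cases h' : w ∈ T'
  · rw [P.twist_of_T' r h', twist_of_T' _ _ h']
  · have hP : w ∈ Ap ∨ w ∈ Am ∨ w ∈ T := by
      have := r.cover w
      tauto
    have h0 := r.d_nonneg w
    have h1 := r.d_le w
    have hw := P.psi_wrap _ h0 h1
    obtain ⟨k1, k2, k3⟩ := P.psi_lift r hP
    obtain ⟨m1, m2⟩ := P.step_mem h0 h1 k2 k3
    have hpsi : ∀ t, 0 ≤ t → t ≤ 2 * P.L (d w) →
        ((P.rev r).rev r.rev).psi t (d w) = P.psi t (d w) := by
      intro t a b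
      simp only [rev]
      split_ifs with q1 q2 q2
      · congr 1; ring
      · exact absurd (by linarith) q2
      · have : t = 2 * P.L (d w) := by linarith
        rw [this, hw]; congr 1; ring
      · congr 1; ring
    have hs : ((P.rev r).rev r.rev).step (P.lift w) (d w) = P.step (P.lift w) (d w) := rfl
    conv_lhs => rw [← k1, P.twist_psi r h0 h1 k2 k3]
    conv_rhs => rw [← k1, ← hpsi _ k2 k3]
    rw [((P.rev r).rev r.rev).twist_psi r.rev.rev h0 h1 k2 k3, hs, hpsi _ m1 m2]

end Chart

end SheetModel

namespace SheetModel

open Set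

/-- `f` and `g` move in the direction `σ` on `[a, b]` with speed at least `ε`, with total speed
at least `R`, and `g` moves at least `κ` times as fast as `f`. -/
def Moves (σ ε R κ : ℝ) (f g : ℝ → ℝ) (a b : ℝ) : Prop :=
  ∀ s t, a ≤ s → s ≤ t → t ≤ b → ε * (t - s) ≤ σ * (f t - f s) ∧ ε * (t - s) ≤ σ * (g t - g s) ∧
    R * (t - s) ≤ σ * (f t - f s) + σ * (g t - g s) ∧ κ * (σ * (f t - f s)) ≤ σ * (g t - g s)

theorem Moves.mono {σ ε R κ : ℝ} {f g : ℝ → ℝ} {a b a' b' : ℝ} (h : Moves σ ε R κ f g a b)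
    (ha : a ≤ a') (hb : b' ≤ b) : Moves σ ε R κ f g a' b' :=
  fun s t h1 h2 h3 => h s t (ha.trans h1) h2 (h3.trans hb)

theorem Moves.glue {σ ε R κ : ℝ} {f g : ℝ → ℝ} {a b c : ℝ} (h : Moves σ ε R κ f g a b)
    (h' : Moves σ ε R κ f g b c) : Moves σ ε R κ f g a c := by
  intro s t h1 h2 h3
  rcases le_total t b with hb | hb
  · exact h s t h1 h2 hb
  rcases le_total b s with hs | hs
  · exact h' s t hs h2 h3
  · obtain ⟨x1, x2, x3, x4⟩ := h s b h1 hs le_rfl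
    obtain ⟨y1, y2, y3, y4⟩ := h' b t le_rfl hb h3
    refine ⟨?_, ?_, ?_, ?_⟩ <;> linarith

theorem Moves.neg {σ ε R κ : ℝ} {f g : ℝ → ℝ} {a b : ℝ} (h : Moves σ ε R κ f g a b) :
    Moves (-σ) ε R κ (fun t => f (-t)) (fun t => g (-t)) (-b) (-a) := by
  intro s t h1 h2 h3
  obtain ⟨x1, x2, x3, x4⟩ := h (-t) (-s) (by linarith) (by linarith) (by linarith)
  refine ⟨?_, ?_, ?_, ?_⟩ <;> linarith

theorem Moves.weaken {σ ε R κ R' κ' : ℝ} {f g : ℝ → ℝ} {a b : ℝ} (h : Moves σ ε R κ f g a b)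
    (hε : 0 ≤ ε) (hR : R' ≤ R) (hκ : κ' ≤ κ) : Moves σ ε R' κ' f g a b := by
  intro s t h1 h2 h3
  obtain ⟨x1, x2, x3, x4⟩ := h s t h1 h2 h3
  have : 0 ≤ ε * (t - s) := mul_nonneg hε (by linarith)
  exact ⟨x1, x2, le_trans (mul_le_mul_of_nonneg_right hR (by linarith)) x3,
    le_trans (mul_le_mul_of_nonneg_right hκ (this.trans x1)) x4⟩

/-- Near the right of `s`, `f` is strictly monotone in the direction `σ`. -/
def RDir (f : ℝ → ℝ) (s σ : ℝ) : Prop :=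
  ∃ b, s < b ∧ ∀ s' t', s ≤ s' → s' < t' → t' ≤ b → 0 < σ * (f t' - f s')

/-- Near `s`, `f` is strictly monotone in some direction. -/
def Dir (f : ℝ → ℝ) (s : ℝ) : Prop :=
  ∃ σ : ℝ, (σ = 1 ∨ σ = -1) ∧ RDir f s σ ∧ RDir (fun t => f (-t)) (-s) (-σ)

theorem Dir.neg {f : ℝ → ℝ} {s : ℝ} (h : Dir f s) : Dir (fun t => f (-t)) (-s) := by
  obtain ⟨σ, h1, h2, h3⟩ := h
  refine ⟨-σ, by rcases h1 with rfl | rfl <;> simp, h3, by simpa using h2⟩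

theorem RDir.eq {f : ℝ → ℝ} {s σ σ' : ℝ} (h : RDir f s σ) (h' : RDir f s σ')
    (hσ : σ = 1 ∨ σ = -1) (hσ' : σ' = 1 ∨ σ' = -1) : σ = σ' := by
  obtain ⟨b, hb, h⟩ := h
  obtain ⟨b', hb', h'⟩ := h'
  have hm : s < min b b' := lt_min hb hb'
  have x := h s _ le_rfl hm (min_le_left _ _)
  have y := h' s _ le_rfl hm (min_le_right _ _)
  rcases hσ with rfl | rfl <;> rcases hσ' with rfl | rfl <;> first | rfl | linarith

theorem Moves.rdir_left {σ ε R κ : ℝ} {f g : ℝ → ℝ} {a b : ℝ} (h : Moves σ ε R κ f g a b)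
    (hε : 0 < ε) (hab : a < b) : RDir f a σ := by
  refine ⟨b, hab, fun s t h1 h2 h3 => ?_⟩
  have := (h s t h1 h2.le h3).1
  have : 0 < ε * (t - s) := mul_pos hε (by linarith)
  linarith

theorem Moves.rdir_right {σ ε R κ : ℝ} {f g : ℝ → ℝ} {a b : ℝ} (h : Moves σ ε R κ f g a b)
    (hε : 0 < ε) (hab : a < b) : RDir g a σ := by
  refine ⟨b, hab, fun s t h1 h2 h3 => ?_⟩
  have := (h s t h1 h2.le h3).2.1
  have : 0 < ε * (t - s) := mul_pos hε (by linarith)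
  linarith

/-- A continuous function stays below a strict bound for some time. -/
theorem exists_right_lt {f g : ℝ → ℝ} (hf : Continuous f) (hg : Continuous g) {s : ℝ}
    (h : f s < g s) : ∃ b, s < b ∧ ∀ t, s ≤ t → t ≤ b → f t < g t := by
  have h1 : {t | f t < g t} ∈ nhdsWithin s (Ici s) :=
    mem_nhdsWithin_of_mem_nhds ((isOpen_lt hf hg).mem_nhds h)
  obtain ⟨u, hu, hsub⟩ := mem_nhdsGE_iff_exists_Icc_subset.1 h1
  exact ⟨u, hu, fun t h2 h3 => hsub ⟨h2, h3⟩⟩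

/-- A function that is monotone in direction `σ` stays on one side of a level for some time. -/
theorem exists_right_side {f : ℝ → ℝ} (hf : Continuous f) {σ s b c : ℝ} (hσ : σ = 1 ∨ σ = -1)
    (hb : s < b) (h : ∀ t, s ≤ t → t ≤ b → 0 ≤ σ * (f t - f s)) :
    ∃ b', s < b' ∧ b' ≤ b ∧
      ((∀ t, s ≤ t → t ≤ b' → f t ≤ c) ∨ (∀ t, s ≤ t → t ≤ b' → c ≤ f t)) := by
  rcases lt_trichotomy (f s) c with hc | hc | hc
  · obtain ⟨u, hu, k⟩ := exists_right_lt hf continuous_const hc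
    exact ⟨min u b, lt_min hu hb, min_le_right _ _,
      Or.inl fun t h1 h2 => (k t h1 (h2.trans (min_le_left _ _))).le⟩
  · refine ⟨b, hb, le_rfl, ?_⟩
    rcases hσ with rfl | rfl
    · right; intro t h1 h2; have := h t h1 h2; linarith
    · left; intro t h1 h2; have := h t h1 h2; linarith
  · obtain ⟨u, hu, k⟩ := exists_right_lt continuous_const hf hc
    exact ⟨min u b, lt_min hu hb, min_le_right _ _,
      Or.inr fun t h1 h2 => (k t h1 (h2.trans (min_le_left _ _))).le⟩

variable {X : Type*}

/-- On `[a, b]` the path `β` lies in `K` and moves as prescribed there. -/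
def Seg (K : Set X) (f g : X → ℝ) (σ ε R κ : ℝ) (β : ℝ → X) (a b : ℝ) : Prop :=
  (∀ t, a ≤ t → t ≤ b → β t ∈ K) ∧ Moves σ ε R κ (fun t => f (β t)) (fun t => g (β t)) a b

theorem Seg.mono {K : Set X} {f g : X → ℝ} {σ ε R κ : ℝ} {β : ℝ → X} {a b a' b' : ℝ}
    (h : Seg K f g σ ε R κ β a b) (ha : a ≤ a') (hb : b' ≤ b) : Seg K f g σ ε R κ β a' b' :=
  ⟨fun t h1 h2 => h.1 t (ha.trans h1) (h2.trans hb), h.2.mono ha hb⟩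

theorem Seg.glue {K : Set X} {f g : X → ℝ} {σ ε R κ : ℝ} {β : ℝ → X} {a b c : ℝ}
    (h : Seg K f g σ ε R κ β a b) (h' : Seg K f g σ ε R κ β b c) : Seg K f g σ ε R κ β a c := by
  refine ⟨fun t h1 h2 => ?_, h.2.glue h'.2⟩
  rcases le_total t b with hb | hb
  · exact h.1 t h1 hb
  · exact h'.1 t hb h2

theorem Seg.neg {K : Set X} {f g : X → ℝ} {σ ε R κ : ℝ} {β : ℝ → X} {a b : ℝ}
    (h : Seg K f g σ ε R κ β a b) : Seg K f g (-σ) ε R κ (fun t => β (-t)) (-b) (-a) :=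
  ⟨fun t h1 h2 => h.1 (-t) (by linarith) (by linarith), h.2.neg⟩

theorem Seg.weaken {K : Set X} {f g : X → ℝ} {σ ε R κ R' κ' : ℝ} {β : ℝ → X} {a b : ℝ}
    (h : Seg K f g σ ε R κ β a b) (hε : 0 ≤ ε) (hR : R' ≤ R) (hκ : κ' ≤ κ) :
    Seg K f g σ ε R' κ' β a b := ⟨h.1, h.2.weaken hε hR hκ⟩

/-- A fast segment that can be continued as long as it avoids `E` must reach `E`. -/
theorem Seg.exists_exit [TopologicalSpace X] {K E : Set X} {f g : X → ℝ} {σ ε R κ C : ℝ} {β : ℝ → X} {a b T : ℝ}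
    (hβ : Continuous β) (hK : IsClosed K) (hf : Continuous f) (hg : Continuous g)
    (hσ : σ = 1 ∨ σ = -1) (hR : 0 < R) (hab : a < b) (h : Seg K f g σ ε R κ β a b)
    (hC : ∀ z ∈ K, 0 ≤ f z + g z ∧ f z + g z ≤ C) (hT : C < R * (T - a))
    (ext : ∀ s, a < s → s < T → Seg K f g σ ε R κ β a s → β s ∉ E →
      ∃ b, s < b ∧ Seg K f g σ ε R κ β s b) :
    ∃ t, a < t ∧ t < T ∧ Seg K f g σ ε R κ β a t ∧ β t ∈ E := by
  set B : Set ℝ := {t | a < t ∧ Seg K f g σ ε R κ β a t}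
  have hbd : ∀ t ∈ B, R * (t - a) ≤ C := by
    rintro t ⟨h1, h2⟩
    have x := (h2.2 a t le_rfl h1.le le_rfl).2.2.1
    have y := hC _ (h2.1 a le_rfl h1.le)
    have z := hC _ (h2.1 t h1.le le_rfl)
    rcases hσ with rfl | rfl <;> linarith
  have hlt : ∀ t, R * (t - a) ≤ C → t < T := by
    intro t h1
    by_contra h2
    push Not at h2
    nlinarith
  have hne : B.Nonempty := ⟨b, hab, h⟩
  have hba : BddAbove B := ⟨T, fun t ht => (hlt t (hbd t ht)).le⟩
  set c := sSup B
  have hbc : b ≤ c := le_csSup hba ⟨hab, h⟩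
  have hac : a < c := hab.trans_le hbc
  have hin : ∀ t, t < c → ∀ s, s ≤ t → Seg K f g σ ε R κ β a s := by
    intro t ht s hs
    obtain ⟨u, hu, htu⟩ := exists_lt_of_lt_csSup hne ht
    exact hu.2.mono le_rfl (hs.trans htu.le)
  have hc1 : ∀ t, a ≤ t → t ≤ c → β t ∈ K := by
    have : IsClosed (β ⁻¹' K) := hK.preimage hβ
    have h2 : Icc a c ⊆ β ⁻¹' K := by
      rw [← closure_Ico hac.ne]
      exact closure_minimal (fun t ht => (hin t ht.2 t le_rfl).1 t ht.1 le_rfl) this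
    exact fun t h3 h4 => h2 ⟨h3, h4⟩
  have hc2 : Seg K f g σ ε R κ β a c := by
    refine ⟨hc1, fun s t h1 h2 h3 => ?_⟩
    rcases eq_or_lt_of_le h2 with rfl | h2'
    · simp
    set f' := fun t => f (β t)
    set g' := fun t => g (β t)
    have hf' : Continuous f' := hf.comp hβ
    have hg' : Continuous g' := hg.comp hβ
    have hcl : IsClosed {t | ε * (t - s) ≤ σ * (f' t - f' s) ∧ ε * (t - s) ≤ σ * (g' t - g' s) ∧
      R * (t - s) ≤ σ * (f' t - f' s) + σ * (g' t - g' s) ∧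
        κ * (σ * (f' t - f' s)) ≤ σ * (g' t - g' s)} := by
      simp only [ofPred_and]
      refine (isClosed_le ?_ ?_).inter ((isClosed_le ?_ ?_).inter
        ((isClosed_le ?_ ?_).inter (isClosed_le ?_ ?_))) <;> fun_prop
    have hsub : Icc s c ⊆ {t | ε * (t - s) ≤ σ * (f' t - f' s) ∧ ε * (t - s) ≤ σ * (g' t - g' s) ∧
      R * (t - s) ≤ σ * (f' t - f' s) + σ * (g' t - g' s) ∧
        κ * (σ * (f' t - f' s)) ≤ σ * (g' t - g' s)} := by
      rw [← closure_Ico (h2'.trans_le h3).ne]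
      exact closure_minimal (fun t ht => (hin t ht.2 t le_rfl).2 s t h1 ht.1 le_rfl) hcl
    exact hsub ⟨h2, h3⟩
  have hcT : c < T := hlt c (hbd c ⟨hac, hc2⟩)
  refine ⟨c, hac, hcT, hc2, ?_⟩
  by_contra hE
  obtain ⟨b', hb', hs⟩ := ext c hac hcT hc2 hE
  have : b' ≤ c := le_csSup hba ⟨hac.trans hb', hc2.glue hs⟩
  linarith

end SheetModel

namespace SheetModel

open Set

variable {X : Type*} [TopologicalSpace X]

theorem Moves.congr {σ ε R κ : ℝ} {f g f' g' : ℝ → ℝ} {a b : ℝ} (h : Moves σ ε R κ f g a b)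
    (hf : ∀ t, a ≤ t → t ≤ b → f' t = f t) (hg : ∀ t, a ≤ t → t ≤ b → g' t = g t) :
    Moves σ ε R κ f' g' a b := by
  intro s t h1 h2 h3
  rw [hf s h1 (h2.trans h3), hf t (h1.trans h2) h3, hg s h1 (h2.trans h3), hg t (h1.trans h2) h3]
  exact h s t h1 h2 h3

theorem Chart.psi_step_eq {Ap Am T : Set X} {d e : X → ℝ} (P : Chart Ap Am T d e) {t t' δ : ℝ}
    (h0 : 0 ≤ δ) (h1 : δ ≤ 1 / 2) (ht : t' = t + 2 * δ ∨ t' = t + 2 * δ - 2 * P.L δ)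
    (h2 : 0 ≤ t') (h3 : t' ≤ 2 * P.L δ) : P.psi (P.step t δ) δ = P.psi t' δ := by
  have hw := P.psi_wrap δ h0 h1
  unfold Chart.step
  rcases ht with rfl | rfl
  · rw [if_pos h3]
  · split_ifs with h
    · have : t + 2 * δ = 2 * P.L δ := by linarith
      rw [this, hw, sub_self]
    · rfl

theorem Chart.exists_twist_lift {Ap Am T T' : Set X} {d e : X → ℝ} (r : Regions Ap Am T T' d e)
    (P : Chart Ap Am T d e) {K : Set X} {τ : X → ℝ} (hτ : Continuous τ)
    (hz : ∀ z ∈ K, P.psi (τ z) (d z) = z ∧ 0 ≤ τ z ∧ τ z ≤ 2 * P.L (d z))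
    {β : ℝ → X} (hβ : Continuous β) {σ ε R κ s b : ℝ} (hσ : σ = 1 ∨ σ = -1) (hε : 0 < ε)
    (hs : s < b) (h : Seg K d τ σ ε R κ β s b) :
    ∃ (τ' : ℝ → ℝ) (b' : ℝ), Continuous τ' ∧ s < b' ∧ b' ≤ b ∧
      (∀ t, s ≤ t → t ≤ b' → P.twist r (β t) = P.psi (τ' t) (d (β t)) ∧ 0 ≤ τ' t ∧
        τ' t ≤ 2 * P.L (d (β t))) ∧
      Moves σ ε (R + 2 * ε) (κ + 2) (fun t => d (β t)) τ' s b' := by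
  have hd := r.continuous_d
  have hLc := P.continuous_L
  set w : ℝ → ℝ := fun t => τ (β t) + 2 * d (β t) - 2 * P.L (d (β t)) with hw
  have hwc : Continuous w := by fun_prop
  have hmono : ∀ s' t, s ≤ s' → s' ≤ t → t ≤ b →
      0 ≤ σ * (d (β t) - d (β s')) ∧ 0 ≤ σ * (P.L (d (β s')) - P.L (d (β t))) := by
    intro s' t h1 h2 h3
    have x := (h.2 s' t h1 h2 h3).1
    have : 0 ≤ ε * (t - s') := mul_nonneg hε.le (by linarith)
    have y : 0 ≤ σ * (d (β t) - d (β s')) := this.trans x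
    refine ⟨y, ?_⟩
    rcases hσ with rfl | rfl
    · have := P.antitone_L (show d (β s') ≤ d (β t) by linarith)
      linarith
    · have := P.antitone_L (show d (β t) ≤ d (β s') by linarith)
      linarith
  have hw0 : ∀ t, s ≤ t → t ≤ b → 0 ≤ σ * (w t - w s) := by
    intro t h1 h2
    obtain ⟨x1, x2⟩ := hmono s t le_rfl h1 h2
    have x3 := (h.2 s t le_rfl h1 h2).2.1
    have : 0 ≤ ε * (t - s) := mul_nonneg hε.le (by linarith)
    simp only [hw]
    linarith
  have hstep : ∀ t τ', s ≤ t → t ≤ b → (τ' = τ (β t) + 2 * d (β t) ∨ τ' = w t) → 0 ≤ τ' →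
      τ' ≤ 2 * P.L (d (β t)) → P.twist r (β t) = P.psi τ' (d (β t)) := by
    intro t τ' h1 h2 h3 h4 h5
    obtain ⟨k1, k2, k3⟩ := hz _ (h.1 t h1 h2)
    conv_lhs => rw [← k1]
    rw [P.twist_psi r (r.d_nonneg _) (r.d_le _) k2 k3]
    exact P.psi_step_eq (r.d_nonneg _) (r.d_le _) h3 h4 h5
  obtain ⟨b', hb', hbb, hside⟩ := exists_right_side hwc hσ hs hw0 (c := 0)
  rcases hside with hside | hside
  · refine ⟨fun t => τ (β t) + 2 * d (β t), b', by fun_prop, hb', hbb, ?_, ?_⟩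
    · intro t h1 h2
      obtain ⟨k1, k2, k3⟩ := hz _ (h.1 t h1 (h2.trans hbb))
      have k4 := hside t h1 h2
      have k5 := r.d_nonneg (β t)
      have k6 : 0 ≤ τ (β t) + 2 * d (β t) := by linarith
      have k7 : τ (β t) + 2 * d (β t) ≤ 2 * P.L (d (β t)) := by simp only [hw] at k4; linarith
      exact ⟨hstep t _ h1 (h2.trans hbb) (Or.inl rfl) k6 k7, k6, k7⟩
    · intro s' t h1 h2 h3
      obtain ⟨x1, x2⟩ := hmono s' t h1 h2 (h3.trans hbb)
      obtain ⟨y1, y2, y3, y4⟩ := h.2 s' t h1 h2 (h3.trans hbb)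
      simp only at y1 y2 y3 y4 ⊢
      refine ⟨?_, ?_, ?_, ?_⟩ <;> linarith
  · refine ⟨w, b', hwc, hb', hbb, ?_, ?_⟩
    · intro t h1 h2
      obtain ⟨k1, k2, k3⟩ := hz _ (h.1 t h1 (h2.trans hbb))
      have k4 := hside t h1 h2
      have k5 := r.d_le (β t)
      have k8 := P.one_le k5
      have k7 : w t ≤ 2 * P.L (d (β t)) := by simp only [hw] at k4 ⊢; linarith
      exact ⟨hstep t _ h1 (h2.trans hbb) (Or.inr rfl) k4 k7, k4, k7⟩
    · intro s' t h1 h2 h3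
      obtain ⟨x1, x2⟩ := hmono s' t h1 h2 (h3.trans hbb)
      obtain ⟨y1, y2, y3, y4⟩ := h.2 s' t h1 h2 (h3.trans hbb)
      simp only [hw] at y1 y2 y3 y4 ⊢
      refine ⟨?_, ?_, ?_, ?_⟩ <;> linarith

theorem Chart.exists_seg_of_lift {Ap Am T T' : Set X} {d e : X → ℝ} (r : Regions Ap Am T T' d e)
    (P : Chart Ap Am T d e) {β : ℝ → X} {τ : ℝ → ℝ} (hτ : Continuous τ)
    {σ ε R κ s b : ℝ} (hσ : σ = 1 ∨ σ = -1) (hε : 0 < ε) (hs : s < b)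
    (h : ∀ t, s ≤ t → t ≤ b → β t = P.psi (τ t) (d (β t)) ∧ 0 ≤ τ t ∧ τ t ≤ 2 * P.L (d (β t)))
    (hm : Moves σ ε R κ (fun t => d (β t)) τ s b) :
    ∃ b', s < b' ∧ (Seg Ap d e σ ε R κ β s b' ∨ Seg Am d (fun z => 1 - e z) σ ε R κ β s b' ∨
      Seg T d P.th σ ε R κ β s b') := by
  have hd0 := r.d_nonneg
  have hd1 := r.d_le
  have hw0 : ∀ t, s ≤ t → t ≤ b → 0 ≤ σ * (τ t - τ s) := by
    intro t h1 h2
    exact (mul_nonneg hε.le (by linarith)).trans (hm s t le_rfl h1 h2).2.1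
  obtain ⟨b1, hb1, hbb1, side1⟩ := exists_right_side hτ hσ hs hw0 (c := 1 / 2)
  obtain ⟨b2, hb2, hbb2, side2⟩ := exists_right_side hτ hσ hs hw0 (c := 1)
  rcases side1 with side1 | side1
  · refine ⟨b1, hb1, Or.inl ?_⟩
    have key : ∀ t, s ≤ t → t ≤ b1 → β t ∈ Ap ∧ e (β t) = τ t := by
      intro t h1 h2
      obtain ⟨k1, k2, k3⟩ := h t h1 (h2.trans hbb1)
      have := P.psi_Ap (τ t) (d (β t)) (hd0 _) (hd1 _) k2 (side1 t h1 h2)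
      rw [← k1] at this
      exact ⟨this.1, this.2.2⟩
    exact ⟨fun t h1 h2 => (key t h1 h2).1,
      (hm.mono le_rfl hbb1).congr (fun _ _ _ => rfl) fun t h1 h2 => (key t h1 h2).2⟩
  rcases side2 with side2 | side2
  · have hm12 : s < min b1 b2 := lt_min hb1 hb2
    refine ⟨min b1 b2, hm12, Or.inr (Or.inl ?_)⟩
    have key : ∀ t, s ≤ t → t ≤ min b1 b2 → β t ∈ Am ∧ 1 - e (β t) = τ t := by
      intro t h1 h2
      have h2a := h2.trans (min_le_left _ _)
      have h2b := h2.trans (min_le_right _ _)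
      obtain ⟨k1, k2, k3⟩ := h t h1 (h2a.trans hbb1)
      have := P.psi_Am (τ t) (d (β t)) (hd0 _) (hd1 _) (side1 t h1 h2a) (side2 t h1 h2b)
      rw [← k1] at this
      exact ⟨this.1, by rw [this.2.2]; ring⟩
    exact ⟨fun t h1 h2 => (key t h1 h2).1, (hm.mono le_rfl ((min_le_left _ _).trans hbb1)).congr
      (fun _ _ _ => rfl) fun t h1 h2 => (key t h1 h2).2⟩
  · refine ⟨b2, hb2, Or.inr (Or.inr ?_)⟩
    have key : ∀ t, s ≤ t → t ≤ b2 → β t ∈ T ∧ P.th (β t) = τ t := by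
      intro t h1 h2
      obtain ⟨k1, k2, k3⟩ := h t h1 (h2.trans hbb2)
      have := P.psi_T (τ t) (d (β t)) (hd0 _) (hd1 _) (side2 t h1 h2) k3
      rw [← k1] at this
      exact ⟨this.1, this.2.2⟩
    exact ⟨fun t h1 h2 => (key t h1 h2).1,
      (hm.mono le_rfl hbb2).congr (fun _ _ _ => rfl) fun t h1 h2 => (key t h1 h2).2⟩

/-- Regions together with charts for both foliations. -/
structure Sys (X : Type*) [TopologicalSpace X] where
  Ap : Set X
  Am : Set X
  T : Set X
  T' : Set X
  d : X → ℝ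
  e : X → ℝ
  reg : Regions Ap Am T T' d e
  P : Chart Ap Am T d e
  Q : Chart Ap Am T' e d

namespace Sys

/-- Exchange the two foliations. -/
def swap (S : Sys X) : Sys X := ⟨S.Ap, S.Am, S.T', S.T, S.e, S.d, S.reg.swap, S.Q, S.P⟩

/-- Reverse the leaves of both foliations. -/
noncomputable def rev (S : Sys X) : Sys X :=
  ⟨S.Am, S.Ap, S.T, S.T', S.d, S.e, S.reg.rev, S.P.rev S.reg, S.Q.rev S.reg.swap⟩

/-- The twist along the first foliation. -/
noncomputable def h (S : Sys X) : X → X := S.P.twist S.reg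

/-- `β` moves steadily through one of the regions during `[a, b]`. -/
def Good (S : Sys X) (ε RS RT RT' κ : ℝ) (β : ℝ → X) (a b : ℝ) : Prop :=
  ∃ σ : ℝ, (σ = 1 ∨ σ = -1) ∧ (Seg S.Ap S.d S.e σ ε RS κ β a b ∨
    Seg S.Am S.d (fun z => 1 - S.e z) σ ε RS κ β a b ∨ Seg S.T S.d S.P.th σ ε RT κ β a b ∨
    Seg S.T' S.e S.Q.th σ ε RT' 0 β a b)

variable (S : Sys X) {ε RS RT RT' R κ : ℝ} {β : ℝ → X} {a b : ℝ}

theorem Good.weaken {S : Sys X} {RS' RT2 RT2' κ' : ℝ} (hε : 0 ≤ ε) (h : S.Good ε RS RT RT' κ β a b)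
    (h1 : RS' ≤ RS) (h2 : RT2 ≤ RT) (h3 : RT2' ≤ RT') (h4 : κ' ≤ κ) :
    S.Good ε RS' RT2 RT2' κ' β a b := by
  obtain ⟨σ, hσ, h | h | h | h⟩ := h
  · exact ⟨σ, hσ, Or.inl (h.weaken hε h1 h4)⟩
  · exact ⟨σ, hσ, Or.inr (Or.inl (h.weaken hε h1 h4))⟩
  · exact ⟨σ, hσ, Or.inr (Or.inr (Or.inl (h.weaken hε h2 h4)))⟩
  · exact ⟨σ, hσ, Or.inr (Or.inr (Or.inr (h.weaken hε h3 le_rfl)))⟩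

theorem Good.swap {S : Sys X} (hε : 0 ≤ ε) (h : S.Good ε RS RT RT' 0 β a b) :
    S.swap.Good ε RS RT' RT 0 β a b := by
  obtain ⟨σ, hσ, h | h | h | h⟩ := h
  · refine ⟨σ, hσ, Or.inl ⟨h.1, fun s t h1 h2 h3 => ?_⟩⟩
    obtain ⟨x1, x2, x3, x4⟩ := h.2 s t h1 h2 h3
    have : 0 ≤ ε * (t - s) := mul_nonneg hε (by linarith)
    refine ⟨x2, x1, by simp only [Sys.swap]; linarith, ?_⟩
    rw [zero_mul]; exact this.trans x1
  · refine ⟨-σ, by rcases hσ with rfl | rfl <;> simp, Or.inr (Or.inl ⟨h.1, fun s t h1 h2 h3 => ?_⟩)⟩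
    obtain ⟨x1, x2, x3, x4⟩ := h.2 s t h1 h2 h3
    have : 0 ≤ ε * (t - s) := mul_nonneg hε (by linarith)
    simp only [Sys.swap] at *
    refine ⟨?_, ?_, ?_, ?_⟩ <;> linarith
  · exact ⟨σ, hσ, Or.inr (Or.inr (Or.inr h))⟩
  · exact ⟨σ, hσ, Or.inr (Or.inr (Or.inl h))⟩

theorem continuous_h : Continuous S.h := S.P.continuous_twist S.reg

theorem h_of_T' {z : X} (hz : z ∈ S.T') : S.h z = z := S.P.twist_of_T' S.reg hz

theorem d_h (z : X) : S.d (S.h z) = S.d z := S.P.d_twist S.reg z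

theorem h_eq_self {z : X} (hz : S.d z = 0 ∨ S.d z = 1 / 2) : S.h z = z :=
  S.P.twist_eq_self S.reg hz

theorem lift_Ap (z : X) (hz : z ∈ S.Ap) : S.P.psi (S.e z) (S.d z) = z ∧ 0 ≤ S.e z ∧
    S.e z ≤ 2 * S.P.L (S.d z) :=
  ⟨S.P.of_Ap z hz, S.reg.e_nonneg z, by
    have := S.P.one_le (S.reg.d_le z); have := S.reg.e_le z; linarith⟩

theorem lift_Am (z : X) (hz : z ∈ S.Am) : S.P.psi (1 - S.e z) (S.d z) = z ∧ 0 ≤ 1 - S.e z ∧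
    1 - S.e z ≤ 2 * S.P.L (S.d z) :=
  ⟨S.P.of_Am z hz, by have := S.reg.e_le z; linarith, by
    have := S.P.one_le (S.reg.d_le z); have := S.reg.e_nonneg z; linarith⟩

theorem lift_T (z : X) (hz : z ∈ S.T) : S.P.psi (S.P.th z) (S.d z) = z ∧ 0 ≤ S.P.th z ∧
    S.P.th z ≤ 2 * S.P.L (S.d z) :=
  ⟨(S.P.of_T z hz).1, by have := (S.P.of_T z hz).2.1; linarith, (S.P.of_T z hz).2.2⟩

theorem Good.step {S : Sys X} (hε : 0 < ε) (hβ : Continuous β) (hab : a < b)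
    (h : S.Good ε R R RT' κ β a b) :
    ∃ b', a < b' ∧ S.Good ε (R + 2 * ε) (R + 2 * ε) RT' (κ + 2) (fun t => S.h (β t)) a b' := by
  obtain ⟨σ, hσ, h⟩ := h
  have hec := S.reg.continuous_e
  have main : (∃ (τ' : ℝ → ℝ) (b' : ℝ), Continuous τ' ∧ a < b' ∧ b' ≤ b ∧
      (∀ t, a ≤ t → t ≤ b' → S.P.twist S.reg (β t) = S.P.psi (τ' t) (S.d (β t)) ∧ 0 ≤ τ' t ∧
        τ' t ≤ 2 * S.P.L (S.d (β t))) ∧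
      Moves σ ε (R + 2 * ε) (κ + 2) (fun t => S.d (β t)) τ' a b') →
      ∃ b', a < b' ∧ S.Good ε (R + 2 * ε) (R + 2 * ε) RT' (κ + 2) (fun t => S.h (β t)) a b' := by
    rintro ⟨τ', b', hc, hb', -, k1, k2⟩
    obtain ⟨b'', hb'', h⟩ := S.P.exists_seg_of_lift S.reg (β := fun t => S.h (β t)) hc hσ hε hb'
      (by simp only [d_h]; exact k1) (by simp only [d_h]; exact k2)
    exact ⟨b'', hb'', σ, hσ, by tauto⟩
  rcases h with h | h | h | h
  · exact main (S.P.exists_twist_lift S.reg hec S.lift_Ap hβ hσ hε hab h)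
  · exact main (S.P.exists_twist_lift S.reg (by fun_prop) S.lift_Am hβ hσ hε hab h)
  · exact main (S.P.exists_twist_lift S.reg S.P.continuous_th S.lift_T hβ hσ hε hab h)
  · refine ⟨b, hab, σ, hσ, Or.inr (Or.inr (Or.inr ⟨fun t h1 h2 => ?_, ?_⟩))⟩
    · simp only [S.h_of_T' (h.1 t h1 h2)]
      exact h.1 t h1 h2
    · refine h.2.congr ?_ ?_ <;>
      · intro t h1 h2
        simp only [S.h_of_T' (h.1 t h1 h2)]

end Sys

end SheetModel

namespace SheetModel

open Set

variable {X : Type*} [TopologicalSpace X]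

theorem RDir.congr {f g : ℝ → ℝ} {s σ b : ℝ} (h : RDir f s σ) (hb : s < b)
    (hfg : ∀ t, s ≤ t → t ≤ b → g t = f t) : RDir g s σ := by
  obtain ⟨c, hc, h⟩ := h
  refine ⟨min b c, lt_min hb hc, fun s' t' h1 h2 h3 => ?_⟩
  have h4 := h3.trans (min_le_left b c)
  rw [hfg s' h1 (h2.le.trans h4), hfg t' (h1.trans h2.le) h4]
  exact h s' t' h1 h2 (h3.trans (min_le_right b c))

namespace Sys

/-- A path that moves steadily near every interior time, on both sides, and crosses the critical
leaves transversally. -/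
structure Nice (S : Sys X) (ε RS RT RT' κ : ℝ) (β : ℝ → X) : Prop where
  cont : Continuous β
  germ : ∀ s ∈ Ioo (-1 : ℝ) 1, ∃ b, s < b ∧ S.Good ε RS RT RT' κ β s b
  germ_neg : ∀ s ∈ Ioo (-1 : ℝ) 1, ∃ b, s < b ∧ S.Good ε RS RT RT' κ (fun t => β (-t)) s b
  dir_d : ∀ s ∈ Ioo (-1 : ℝ) 1, 0 < S.d (β s) → S.d (β s) < 1 / 2 → Dir (fun t => S.d (β t)) s
  dir_e : ∀ s ∈ Ioo (-1 : ℝ) 1, 0 < S.e (β s) → S.e (β s) < 1 / 2 → Dir (fun t => S.e (β t)) s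
  ne_corner : ∀ s ∈ Ioo (-1 : ℝ) 1, ¬ (S.d (β s) = 1 / 2 ∧ S.e (β s) = 1 / 2) ∧
    ¬ (S.d (β s) = 1 / 2 ∧ S.e (β s) = 0) ∧ ¬ (S.d (β s) = 0 ∧ S.e (β s) = 1 / 2)

variable {S : Sys X} {ε RS RT RT' R κ : ℝ} {β : ℝ → X} {a b : ℝ}

theorem neg_mem_Ioo {s : ℝ} (h : s ∈ Ioo (-1 : ℝ) 1) : -s ∈ Ioo (-1 : ℝ) 1 :=
  ⟨by linarith [h.2], by linarith [h.1]⟩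

theorem Nice.neg (h : S.Nice ε RS RT RT' κ β) : S.Nice ε RS RT RT' κ (fun t => β (-t)) where
  cont := h.cont.comp continuous_neg
  germ := h.germ_neg
  germ_neg := by simpa using h.germ
  dir_d s hs h1 h2 := by simpa using (h.dir_d (-s) (neg_mem_Ioo hs) h1 h2).neg
  dir_e s hs h1 h2 := by simpa using (h.dir_e (-s) (neg_mem_Ioo hs) h1 h2).neg
  ne_corner s hs := h.ne_corner (-s) (neg_mem_Ioo hs)

theorem Nice.weaken {RS' RT2 RT2' κ' : ℝ} (hε : 0 ≤ ε) (h : S.Nice ε RS RT RT' κ β)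
    (h1 : RS' ≤ RS) (h2 : RT2 ≤ RT) (h3 : RT2' ≤ RT') (h4 : κ' ≤ κ) :
    S.Nice ε RS' RT2 RT2' κ' β :=
  { h with
    germ := fun s hs => (h.germ s hs).imp fun _ h' => ⟨h'.1, h'.2.weaken hε h1 h2 h3 h4⟩
    germ_neg := fun s hs => (h.germ_neg s hs).imp fun _ h' => ⟨h'.1, h'.2.weaken hε h1 h2 h3 h4⟩ }

theorem Nice.swap (hε : 0 ≤ ε) (h : S.Nice ε RS RT RT' 0 β) : S.swap.Nice ε RS RT' RT 0 β where
  cont := h.cont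
  germ s hs := (h.germ s hs).imp fun _ h' => ⟨h'.1, h'.2.swap hε⟩
  germ_neg s hs := (h.germ_neg s hs).imp fun _ h' => ⟨h'.1, h'.2.swap hε⟩
  dir_d := h.dir_e
  dir_e := h.dir_d
  ne_corner s hs := by
    have := h.ne_corner s hs
    simp only [Sys.swap]
    tauto

/-- Away from the critical leaves the direction in which `e` moves is determined by `d`. -/
theorem Good.rdir_e (hε : 0 < ε) (hab : a < b) (h : S.Good ε RS RT RT' κ β a b)
    (hd0 : 0 < S.d (β a)) (he0 : 0 < S.e (β a)) {σ : ℝ} (hσ : σ = 1 ∨ σ = -1)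
    (hdir : RDir (fun t => S.d (β t)) a σ) :
    (β a ∈ S.Ap ∧ RDir (fun t => S.e (β t)) a σ) ∨
      (β a ∈ S.Am ∧ RDir (fun t => S.e (β t)) a (-σ)) := by
  obtain ⟨σ', hσ', h | h | h | h⟩ := h
  · have := (h.2.rdir_left hε hab).eq hdir hσ' hσ
    subst this
    exact Or.inl ⟨h.1 a le_rfl hab.le, h.2.rdir_right hε hab⟩
  · have := (h.2.rdir_left hε hab).eq hdir hσ' hσ
    subst this
    refine Or.inr ⟨h.1 a le_rfl hab.le, ?_⟩
    obtain ⟨c, hc, k⟩ := h.2.rdir_right hε hab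
    refine ⟨c, hc, fun s t h1 h2 h3 => ?_⟩
    have := k s t h1 h2 h3
    linarith
  · have := S.reg.e_of_T _ (h.1 a le_rfl hab.le)
    linarith
  · have := S.reg.d_of_T' _ (h.1 a le_rfl hab.le)
    linarith

/-- At a fixed point of the twist the direction in which `e` moves is preserved. -/
theorem Good.rdir_e_h (hβ : Continuous β) (hε : 0 < ε) (hab : a < b)
    (h : S.Good ε RS RT RT' κ β a b)
    (hd : S.d (β a) = 0 ∨ S.d (β a) = 1 / 2) (he0 : 0 < S.e (β a))
    (he1 : S.e (β a) < 1 / 2) {σ : ℝ} (hσ : σ = 1 ∨ σ = -1)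
    (hdir : RDir (fun t => S.e (β t)) a σ) : RDir (fun t => S.e (S.h (β t))) a σ := by
  have hdc := S.reg.continuous_d
  have hec := S.reg.continuous_e
  have hLc := S.P.continuous_L
  obtain ⟨w, hwc, hw, hwa, hw2, hwm⟩ : ∃ w : X → ℝ, Continuous w ∧
      (∀ z, w z = 2 * S.d z ∨ w z = 2 * S.d z - 2 * S.P.L (S.d z)) ∧ w (β a) = 0 ∧
      (∀ z, |w z| ≤ 2 * S.P.L (S.d z)) ∧ (∀ z z', S.d z ≤ S.d z' → w z ≤ w z') := by
    rcases hd with hd | hd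
    · refine ⟨fun z => 2 * S.d z, by fun_prop, fun z => Or.inl rfl, by simp [hd], fun z => ?_,
        fun z z' h => by simp only; linarith⟩
      have := S.reg.d_nonneg z
      have := S.reg.d_le z
      have := S.P.one_le (S.reg.d_le z)
      rw [abs_le]; constructor <;> linarith
    · refine ⟨fun z => 2 * S.d z - 2 * S.P.L (S.d z), by fun_prop, fun z => Or.inr rfl,
        by simp only [hd, S.P.L_half]; norm_num, fun z => ?_, fun z z' h => ?_⟩
      · have := S.reg.d_nonneg z
        have := S.reg.d_le z
        have := S.P.one_le (S.reg.d_le z)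
        rw [abs_le]; constructor <;> linarith
      · have := S.P.antitone_L h
        simp only; linarith
  have hwmono : ∀ {σ' : ℝ} {f : ℝ → ℝ} {RS κ}, (σ' = 1 ∨ σ' = -1) →
      Moves σ' ε RS κ (fun t => S.d (β t)) f a b → ∀ s t, a ≤ s → s ≤ t → t ≤ b →
      0 ≤ σ' * (w (β t) - w (β s)) := by
    intro σ' f RS κ hσ' hm s t h1 h2 h3
    have x := (hm s t h1 h2 h3).1
    have : 0 ≤ ε * (t - s) := mul_nonneg hε.le (by linarith)
    rcases hσ' with rfl | rfl
    · have := hwm (β s) (β t) (by linarith)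
      linarith
    · have := hwm (β t) (β s) (by linarith)
      linarith
  obtain ⟨σ', hσ', h | h | h | h⟩ := h
  · obtain ⟨b1, hb1, k1⟩ := exists_right_lt (f := fun _ => 0) (g := fun t => S.e (β t) + w (β t))
      (s := a) continuous_const (by fun_prop) (by simpa [hwa] using he0)
    obtain ⟨b2, hb2, k2⟩ := exists_right_lt (f := fun t => S.e (β t) + w (β t))
      (g := fun _ => 1 / 2) (s := a) (by fun_prop) continuous_const
      (by simp only [hwa]; linarith)
    have hσσ : σ' = σ := (h.2.rdir_right hε hab).eq hdir hσ' hσ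
    subst hσσ
    refine RDir.congr (f := fun t => S.e (β t) + w (β t)) (b := min b (min b1 b2)) ?_
      (lt_min hab (lt_min hb1 hb2)) fun t h1 h2 => ?_
    · refine ⟨b, hab, fun s t h1 h2 h3 => ?_⟩
      have x := (h.2 s t h1 h2.le h3).2.1
      have y := hwmono hσ' h.2 s t h1 h2.le h3
      have : 0 < ε * (t - s) := mul_pos hε (by linarith)
      linarith
    · have z1 := k1 t h1 ((h2.trans (min_le_right _ _)).trans (min_le_left _ _))
      have z2 := k2 t h1 ((h2.trans (min_le_right _ _)).trans (min_le_right _ _))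
      have hm := h.1 t h1 (h2.trans (min_le_left _ _))
      obtain ⟨l1, l2, l3⟩ := S.lift_Ap _ hm
      have d0 := S.reg.d_nonneg (β t)
      have d1 := S.reg.d_le (β t)
      have hL := S.P.one_le d1
      have e1 : S.h (β t) = S.P.psi (S.e (β t) + w (β t)) (S.d (β t)) := by
        unfold Sys.h
        conv_lhs => rw [← l1]
        rw [S.P.twist_psi S.reg d0 d1 l2 l3]
        refine S.P.psi_step_eq d0 d1 ?_ z1.le (by linarith)
        rcases hw (β t) with q | q <;> rw [q]
        · exact Or.inl rfl
        · right; ring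
      rw [e1]
      exact (S.P.psi_Ap _ _ d0 d1 z1.le z2.le).2.2
  · obtain ⟨b1, hb1, k1⟩ := exists_right_lt (f := fun _ => 1 / 2)
      (g := fun t => 1 - S.e (β t) + w (β t))
      (s := a) continuous_const (by fun_prop) (by simp only [hwa]; linarith)
    obtain ⟨b2, hb2, k2⟩ := exists_right_lt (f := fun t => 1 - S.e (β t) + w (β t))
      (g := fun _ => 1) (s := a) (by fun_prop) continuous_const
      (by simp only [hwa]; linarith)
    have hσσ : σ' = -σ := by
      have : RDir (fun t => S.e (β t)) a (-σ') := by
        obtain ⟨c, hc, k⟩ := h.2.rdir_right hε hab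
        refine ⟨c, hc, fun s t h1 h2 h3 => ?_⟩
        have := k s t h1 h2 h3
        linarith
      have := this.eq hdir (by rcases hσ' with rfl | rfl <;> simp) hσ
      linarith
    subst hσσ
    refine RDir.congr (f := fun t => S.e (β t) - w (β t)) (b := min b (min b1 b2)) ?_
      (lt_min hab (lt_min hb1 hb2)) fun t h1 h2 => ?_
    · refine ⟨b, hab, fun s t h1 h2 h3 => ?_⟩
      have x := (h.2 s t h1 h2.le h3).2.1
      have y := hwmono hσ' h.2 s t h1 h2.le h3
      have : 0 < ε * (t - s) := mul_pos hε (by linarith)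
      linarith
    · have z1 := k1 t h1 ((h2.trans (min_le_right _ _)).trans (min_le_left _ _))
      have z2 := k2 t h1 ((h2.trans (min_le_right _ _)).trans (min_le_right _ _))
      have hm := h.1 t h1 (h2.trans (min_le_left _ _))
      obtain ⟨l1, l2, l3⟩ := S.lift_Am _ hm
      have d0 := S.reg.d_nonneg (β t)
      have d1 := S.reg.d_le (β t)
      have hL := S.P.one_le d1
      have e1 : S.h (β t) = S.P.psi (1 - S.e (β t) + w (β t)) (S.d (β t)) := by
        unfold Sys.h
        conv_lhs => rw [← l1]
        rw [S.P.twist_psi S.reg d0 d1 l2 l3]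
        refine S.P.psi_step_eq d0 d1 ?_ (by linarith) (by linarith)
        rcases hw (β t) with q | q <;> rw [q]
        · exact Or.inl rfl
        · right; ring
      rw [e1, (S.P.psi_Am _ _ d0 d1 z1.le z2.le).2.2]
      ring
  · have := S.reg.e_of_T _ (h.1 a le_rfl hab.le)
    linarith
  · exact hdir.congr hab fun t h1 h2 => by simp only [S.h_of_T' (h.1 t h1 h2)]

theorem Nice.step (hε : 0 < ε) (h : S.Nice ε R R RT' κ β) :
    S.Nice ε (R + 2 * ε) (R + 2 * ε) RT' (κ + 2) (fun t => S.h (β t)) where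
  cont := S.continuous_h.comp h.cont
  germ s hs := by
    obtain ⟨b, hb, g⟩ := h.germ s hs
    exact g.step hε h.cont hb
  germ_neg s hs := by
    obtain ⟨b, hb, g⟩ := h.germ_neg s hs
    exact g.step hε h.neg.cont hb
  dir_d s hs := by
    simp only [d_h]
    exact h.dir_d s hs
  dir_e s hs he0 he1 := by
    have hs' := neg_mem_Ioo hs
    by_cases hd : S.d (β s) = 0 ∨ S.d (β s) = 1 / 2
    · rw [S.h_eq_self hd] at he0 he1
      obtain ⟨σ, hσ, k1, k2⟩ := h.dir_e s hs he0 he1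
      obtain ⟨b, hb, g⟩ := h.germ s hs
      obtain ⟨b', hb', g'⟩ := h.germ_neg (-s) hs'
      refine ⟨σ, hσ, g.rdir_e_h h.cont hε hb hd he0 he1 hσ k1, ?_⟩
      refine g'.rdir_e_h h.neg.cont hε hb' ?_ ?_ ?_ ?_ k2
      · simpa using hd
      · simpa using he0
      · simpa using he1
      · rcases hσ with rfl | rfl <;> simp
    · have hd0 : 0 < S.d (β s) := lt_of_le_of_ne (S.reg.d_nonneg _) fun q => hd (Or.inl q.symm)
      have hd1 : S.d (β s) < 1 / 2 := lt_of_le_of_ne (S.reg.d_le _) fun q => hd (Or.inr q)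
      obtain ⟨σ, hσ, k1, k2⟩ := h.dir_d s hs hd0 hd1
      obtain ⟨b, hb, g⟩ := h.germ s hs
      obtain ⟨b', hb', g'⟩ := h.germ_neg (-s) hs'
      obtain ⟨c, hc, g⟩ := g.step hε h.cont hb
      obtain ⟨c', hc', g'⟩ := g'.step hε h.neg.cont hb'
      have x := g.rdir_e hε hc (by rwa [d_h]) he0 hσ
        (by simpa only [d_h] using k1)
      have y := g'.rdir_e hε hc' (by simpa [d_h] using hd0)
        (by simpa using he0) (σ := -σ) (by rcases hσ with rfl | rfl <;> simp)
        (by simpa only [d_h] using k2)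
      simp only [neg_neg] at y
      have hno : ¬ (S.h (β s) ∈ S.Ap ∧ S.h (β s) ∈ S.Am) := by
        rintro ⟨q1, q2⟩
        have := S.reg.slit _ q1 q2
        rw [d_h] at this
        rcases this with q | q <;> linarith
      rcases x with ⟨x1, x2⟩ | ⟨x1, x2⟩ <;> rcases y with ⟨y1, y2⟩ | ⟨y1, y2⟩
      · exact ⟨σ, hσ, x2, y2⟩
      · exact absurd ⟨x1, y1⟩ hno
      · exact absurd ⟨y1, x1⟩ hno
      · exact ⟨-σ, by rcases hσ with rfl | rfl <;> simp, x2, by simpa using y2⟩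
  ne_corner s hs := by
    have := h.ne_corner s hs
    rw [d_h]
    by_cases hd : S.d (β s) = 0 ∨ S.d (β s) = 1 / 2
    · rwa [S.h_eq_self hd]
    · tauto

end Sys

end SheetModel

namespace SheetModel

open Set

variable {X : Type*} [TopologicalSpace X]

theorem Dir.rdir {f : ℝ → ℝ} {s σ : ℝ} (h : Dir f s) (hσ : σ = 1 ∨ σ = -1)
    (hl : RDir (fun t => f (-t)) (-s) (-σ)) : RDir f s σ := by
  obtain ⟨σ', hσ', h1, h2⟩ := h
  have : -σ' = -σ := h2.eq hl (by rcases hσ' with rfl | rfl <;> simp)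
    (by rcases hσ with rfl | rfl <;> simp)
  rwa [← neg_injective this]

theorem RDir.const_sub {f : ℝ → ℝ} {s σ c : ℝ} (h : RDir (fun t => c - f t) s σ) :
    RDir f s (-σ) := by
  obtain ⟨b, hb, k⟩ := h
  refine ⟨b, hb, fun s t h1 h2 h3 => ?_⟩
  have := k s t h1 h2 h3
  linarith

theorem RDir.nonneg_of_le {f : ℝ → ℝ} {s σ : ℝ} (h : RDir f s σ) (hσ : σ = 1 ∨ σ = -1)
    (hf : ∀ t, f t ≤ f s) : σ = -1 := by
  obtain ⟨b, hb, k⟩ := h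
  have := k s b le_rfl hb le_rfl
  have := hf b
  rcases hσ with rfl | rfl
  · linarith
  · rfl

theorem RDir.nonneg_of_ge {f : ℝ → ℝ} {s σ : ℝ} (h : RDir f s σ) (hσ : σ = 1 ∨ σ = -1)
    (hf : ∀ t, f s ≤ f t) : σ = 1 := by
  obtain ⟨b, hb, k⟩ := h
  have := k s b le_rfl hb le_rfl
  have := hf b
  rcases hσ with rfl | rfl
  · rfl
  · linarith

omit [TopologicalSpace X] in
theorem Seg.ends {K : Set X} {f g : X → ℝ} {σ ε R κ : ℝ} {β : ℝ → X} {a b : ℝ}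
    (h : Seg K f g σ ε R κ β a b) (hε : 0 < ε) (hab : a < b) :
    0 < σ * (f (β b) - f (β a)) ∧ 0 < σ * (g (β b) - g (β a)) ∧
      κ * (σ * (f (β b) - f (β a))) ≤ σ * (g (β b) - g (β a)) := by
  obtain ⟨x1, x2, -, x4⟩ := h.2 a b le_rfl hab.le le_rfl
  have : 0 < ε * (b - a) := mul_pos hε (by linarith)
  exact ⟨this.trans_le x1, this.trans_le x2, x4⟩

namespace Sys

variable {S : Sys X} {ε RS RT RT' R R' κ : ℝ} {β : ℝ → X} {a b c σ : ℝ}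

theorem Nice.sheet_germ (h : S.Nice ε RS RT RT' κ β) {s : ℝ} (hs : s ∈ Ioo (-1 : ℝ) 1)
    (hd : 0 < S.d (β s)) (he : 0 < S.e (β s)) :
    ∃ σ b, (σ = 1 ∨ σ = -1) ∧ s < b ∧ (Seg S.Ap S.d S.e σ ε RS κ β s b ∨
      Seg S.Am S.d (fun z => 1 - S.e z) σ ε RS κ β s b) := by
  obtain ⟨b, hb, σ, hσ, g | g | g | g⟩ := h.germ s hs
  · exact ⟨σ, b, hσ, hb, Or.inl g⟩
  · exact ⟨σ, b, hσ, hb, Or.inr g⟩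
  · have := S.reg.e_of_T _ (g.1 s le_rfl hb.le)
    linarith
  · have := S.reg.d_of_T' _ (g.1 s le_rfl hb.le)
    linarith

/-- The direction of `d` persists through an interior time. -/
theorem Nice.rdir_d {K : Set X} {g : X → ℝ} (h : S.Nice ε RS RT RT' κ β) (hε : 0 < ε)
    (hσ : σ = 1 ∨ σ = -1) (hb : b ∈ Ioo (-1 : ℝ) 1) (hab : a < b) {R κ : ℝ}
    (hs : Seg K S.d g σ ε R κ β a b) (hd0 : 0 < S.d (β b)) (hd1 : S.d (β b) < 1 / 2) :
    RDir (fun t => S.d (β t)) b σ :=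
  (h.dir_d b hb hd0 hd1).rdir hσ (hs.2.neg.rdir_left hε (neg_lt_neg hab))

theorem Nice.rdir_e_Ap {K : Set X} {f : X → ℝ} (h : S.Nice ε RS RT RT' κ β) (hε : 0 < ε)
    (hσ : σ = 1 ∨ σ = -1) (hb : b ∈ Ioo (-1 : ℝ) 1) (hab : a < b) {R κ : ℝ}
    (hs : Seg K f S.e σ ε R κ β a b) (hd0 : 0 < S.e (β b)) (hd1 : S.e (β b) < 1 / 2) :
    RDir (fun t => S.e (β t)) b σ :=
  (h.dir_e b hb hd0 hd1).rdir hσ (hs.2.neg.rdir_right hε (neg_lt_neg hab))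

theorem Nice.rdir_e_Am {K : Set X} {f : X → ℝ} (h : S.Nice ε RS RT RT' κ β) (hε : 0 < ε)
    (hσ : σ = 1 ∨ σ = -1) (hb : b ∈ Ioo (-1 : ℝ) 1) (hab : a < b) {R κ : ℝ}
    (hs : Seg K f (fun z => 1 - S.e z) σ ε R κ β a b) (hd0 : 0 < S.e (β b))
    (hd1 : S.e (β b) < 1 / 2) : RDir (fun t => S.e (β t)) b (-σ) :=
  (h.dir_e b hb hd0 hd1).rdir (by rcases hσ with rfl | rfl <;> simp)
    (hs.2.neg.rdir_right hε (neg_lt_neg hab)).const_sub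

theorem Nice.exit_Ap (h : S.Nice ε R RT RT' κ β) (hε : 0 < ε) (hR : 20 ≤ R)
    (hσ : σ = 1 ∨ σ = -1) (ha : -1 < a) (ha' : a + 1 / 10 < 1) (hab : a < b)
    (hs : Seg S.Ap S.d S.e σ ε R κ β a b) :
    ∃ t, a < t ∧ t < a + 1 / 10 ∧ Seg S.Ap S.d S.e σ ε R κ β a t ∧
      ¬ (0 < S.d (β t) ∧ S.d (β t) < 1 / 2 ∧ 0 < S.e (β t) ∧ S.e (β t) < 1 / 2) := by
  refine hs.exists_exit (E := {z | ¬ (0 < S.d z ∧ S.d z < 1 / 2 ∧ 0 < S.e z ∧ S.e z < 1 / 2)})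
    (C := 1) h.cont S.reg.isClosed_Ap S.reg.continuous_d S.reg.continuous_e hσ (by linarith) hab
    (fun z _ => ?_) (by linarith) fun s h1 h2 h3 h4 => ?_
  · have := S.reg.d_nonneg z
    have := S.reg.d_le z
    have := S.reg.e_nonneg z
    have := S.reg.e_le z
    constructor <;> linarith
  · simp only [mem_ofPred_eq, not_not] at h4
    obtain ⟨d0, d1, e0, e1⟩ := h4
    have hsI : s ∈ Ioo (-1 : ℝ) 1 := ⟨by linarith, by linarith⟩
    obtain ⟨σ', b', hσ', hb', g | g⟩ := h.sheet_germ hsI d0 e0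
    · have := (g.2.rdir_left hε hb').eq (h.rdir_d hε hσ hsI h1 h3 d0 d1) hσ' hσ
      subst this
      exact ⟨b', hb', g⟩
    · rcases S.reg.slit _ (h3.1 s h1.le le_rfl) (g.1 s le_rfl hb'.le) with q | q <;> linarith

theorem Nice.exit_Am (h : S.Nice ε R RT RT' κ β) (hε : 0 < ε) (hR : 20 ≤ R)
    (hσ : σ = 1 ∨ σ = -1) (ha : -1 < a) (ha' : a + 1 / 10 < 1) (hab : a < b)
    (hs : Seg S.Am S.d (fun z => 1 - S.e z) σ ε R κ β a b) :
    ∃ t, a < t ∧ t < a + 1 / 10 ∧ Seg S.Am S.d (fun z => 1 - S.e z) σ ε R κ β a t ∧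
      ¬ (0 < S.d (β t) ∧ S.d (β t) < 1 / 2 ∧ 0 < S.e (β t) ∧ S.e (β t) < 1 / 2) := by
  have hec := S.reg.continuous_e
  refine hs.exists_exit (E := {z | ¬ (0 < S.d z ∧ S.d z < 1 / 2 ∧ 0 < S.e z ∧ S.e z < 1 / 2)})
    (C := 3 / 2) h.cont S.reg.isClosed_Am S.reg.continuous_d (by fun_prop) hσ (by linarith) hab
    (fun z _ => ?_) (by linarith) fun s h1 h2 h3 h4 => ?_
  · have := S.reg.d_nonneg z
    have := S.reg.d_le z
    have := S.reg.e_nonneg z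
    have := S.reg.e_le z
    constructor <;> linarith
  · simp only [mem_ofPred_eq, not_not] at h4
    obtain ⟨d0, d1, e0, e1⟩ := h4
    have hsI : s ∈ Ioo (-1 : ℝ) 1 := ⟨by linarith, by linarith⟩
    obtain ⟨σ', b', hσ', hb', g | g⟩ := h.sheet_germ hsI d0 e0
    · rcases S.reg.slit _ (g.1 s le_rfl hb'.le) (h3.1 s h1.le le_rfl) with q | q <;> linarith
    · have := (g.2.rdir_left hε hb').eq (h.rdir_d hε hσ hsI h1 h3 d0 d1) hσ' hσ
      subst this
      exact ⟨b', hb', g⟩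

/-- `β` crosses half of the annulus of the second foliation, from the core leaf to the outer
leaf, while moving backwards along the leaves. -/
def HalfCross (S : Sys X) (β : ℝ → X) : Prop :=
  ∃ (a b : ℝ) (φ : ℝ → ℝ), a < b ∧ Continuous φ ∧
    (∀ s t, a ≤ s → s < t → t ≤ b → φ t ≤ φ s ∧ S.e (β t) < S.e (β s)) ∧
    (∀ t, a ≤ t → t ≤ b → 0 ≤ φ t ∧ φ t ≤ 1 ∧ S.Q.psi (φ t) (S.e (β t)) = β t) ∧
    S.e (β a) = 1 / 2 ∧ S.e (β b) = 0

theorem halfCross_Ap (hβ : Continuous β) (hε : 0 < ε) (hab : a < b)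
    (hs : Seg S.Ap S.d S.e (-1) ε R κ β a b) (ha : S.e (β a) = 1 / 2) (hb : S.e (β b) = 0) :
    S.HalfCross β := by
  refine ⟨a, b, fun t => S.d (β t), hab, S.reg.continuous_d.comp hβ, fun s t h1 h2 h3 => ?_,
    fun t h1 h2 => ?_, ha, hb⟩
  · obtain ⟨x, y, -⟩ := (hs.mono h1 h3).ends hε h2
    simp only
    constructor <;> linarith
  · have h3 := S.reg.d_nonneg (β t)
    have h4 := S.reg.d_le (β t)
    exact ⟨h3, by linarith, S.Q.of_Ap _ (hs.1 t h1 h2)⟩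

theorem halfCross_Am (hβ : Continuous β) (hε : 0 < ε) (hab : a < b)
    (hs : Seg S.Am S.d (fun z => 1 - S.e z) 1 ε R κ β a b) (ha : S.e (β a) = 1 / 2)
    (hb : S.e (β b) = 0) : S.HalfCross β := by
  have hdc := S.reg.continuous_d
  refine ⟨a, b, fun t => 1 - S.d (β t), hab, by fun_prop, fun s t h1 h2 h3 => ?_,
    fun t h1 h2 => ?_, ha, hb⟩
  · obtain ⟨x, y, -⟩ := (hs.mono h1 h3).ends hε h2
    simp only
    constructor <;> linarith
  · have h3 := S.reg.d_nonneg (β t)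
    have h4 := S.reg.d_le (β t)
    exact ⟨by linarith, by linarith, S.Q.of_Am _ (hs.1 t h1 h2)⟩

theorem halfCross_Am_Ap (hβ : Continuous β) (hε : 0 < ε) (hab : a < b) (hbc : b < c)
    (hs : Seg S.Am S.d (fun z => 1 - S.e z) 1 ε R κ β a b)
    (hs' : Seg S.Ap S.d S.e (-1) ε R κ β b c) (hd : S.d (β b) = 1 / 2)
    (ha : S.e (β a) = 1 / 2) (hc : S.e (β c) = 0) : S.HalfCross β := by
  have hdc := S.reg.continuous_d
  have mono1 : ∀ s t, a ≤ s → s ≤ t → t ≤ b →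
      S.d (β s) ≤ S.d (β t) ∧ (s < t → S.e (β t) < S.e (β s)) := by
    intro s t h1 h2 h3
    rcases eq_or_lt_of_le h2 with rfl | h2
    · exact ⟨le_rfl, fun h => absurd h (lt_irrefl _)⟩
    obtain ⟨x, y, -⟩ := (hs.mono h1 h3).ends hε h2
    exact ⟨by linarith, fun _ => by linarith⟩
  have mono2 : ∀ s t, b ≤ s → s ≤ t → t ≤ c →
      S.d (β t) ≤ S.d (β s) ∧ (s < t → S.e (β t) < S.e (β s)) := by
    intro s t h1 h2 h3
    rcases eq_or_lt_of_le h2 with rfl | h2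
    · exact ⟨le_rfl, fun h => absurd h (lt_irrefl _)⟩
    obtain ⟨x, y, -⟩ := (hs'.mono h1 h3).ends hε h2
    exact ⟨by linarith, fun _ => by linarith⟩
  refine ⟨a, c, fun t => if t ≤ b then 1 - S.d (β t) else S.d (β t), hab.trans hbc,
    Continuous.if_le (by fun_prop) (by fun_prop) continuous_id continuous_const ?_,
    fun s t h1 h2 h3 => ?_, fun t h1 h2 => ?_, ha, hc⟩
  · intro t ht
    rw [ht, hd]; norm_num
  · have := S.reg.d_le (β s)
    have := S.reg.d_le (β t)
    simp only
    split_ifs with q1 q2 q2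
    · have := mono1 s t h1 h2.le q1
      exact ⟨by linarith, this.2 h2⟩
    · linarith
    · push Not at q1
      refine ⟨by linarith, ?_⟩
      have x := (mono2 b t le_rfl q1.le h3).2 q1
      rcases eq_or_lt_of_le q2 with rfl | q2
      · exact x
      · exact x.trans ((mono1 s b h1 q2.le le_rfl).2 q2)
    · push Not at q1 q2
      have := mono2 s t q2.le h2.le h3
      exact ⟨by linarith, this.2 h2⟩
  · have h3 := S.reg.d_nonneg (β t)
    have h4 := S.reg.d_le (β t)
    simp only
    split_ifs with q
    · exact ⟨by linarith, by linarith, S.Q.of_Am _ (hs.1 t h1 q)⟩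
    · exact ⟨by linarith, by linarith, S.Q.of_Ap _ (hs'.1 t (not_le.1 q).le h2)⟩

theorem Nice.halfCross_of_Ap_pos (h : S.Nice ε R RT RT' 4 β) (hε : 0 < ε) (hR : 20 ≤ R)
    (ha : -1 < a) (ha' : a < 1 / 2) (hab : a < b) (hs : Seg S.Ap S.d S.e 1 ε R 4 β a b) :
    S.HalfCross β := by
  have D0 := fun t => S.reg.d_nonneg (β t)
  have D1 := fun t => S.reg.d_le (β t)
  have E0 := fun t => S.reg.e_nonneg (β t)
  have E1 := fun t => S.reg.e_le (β t)
  have one : (1 : ℝ) = 1 ∨ (1 : ℝ) = -1 := Or.inl rfl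
  have mone : (-1 : ℝ) = 1 ∨ (-1 : ℝ) = -1 := Or.inr rfl
  obtain ⟨t1, l1, u1, s1, x1⟩ := h.exit_Ap hε hR one ha (by linarith) hab hs
  obtain ⟨y1, y2, y3⟩ := s1.ends hε l1
  have hI1 : t1 ∈ Ioo (-1 : ℝ) 1 := ⟨by linarith, by linarith⟩
  obtain ⟨c1, c2, c3⟩ := h.ne_corner t1 hI1
  have hd1 : 0 < S.d (β t1) := by linarith [D0 a]
  have he1 : 0 < S.e (β t1) := by linarith [E0 a]
  obtain ⟨σ, b1, hσ, hb1, g⟩ := h.sheet_germ hI1 hd1 he1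
  rcases eq_or_lt_of_le (D1 t1) with hd | hd
  · have he : S.e (β t1) < 1 / 2 := lt_of_le_of_ne (E1 t1) fun q => c1 ⟨hd, q⟩
    have hdir := h.rdir_e_Ap hε one hI1 l1 s1 he1 he
    rcases g with g | g
    · have q1 := (g.2.rdir_left hε hb1).nonneg_of_le hσ (by simpa [hd] using D1)
      have q2 := (g.2.rdir_right hε hb1).eq hdir hσ one
      linarith
    · have q1 := (g.2.rdir_left hε hb1).nonneg_of_le hσ (by simpa [hd] using D1)
      subst q1
      obtain ⟨t2, l2, u2, s2, x2⟩ := h.exit_Am hε hR mone hI1.1 (by linarith) hb1 g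
      obtain ⟨z1, z2, z3⟩ := s2.ends hε l2
      have hI2 : t2 ∈ Ioo (-1 : ℝ) 1 := ⟨by linarith, by linarith⟩
      obtain ⟨c1', c2', c3'⟩ := h.ne_corner t2 hI2
      have hd2 : 0 < S.d (β t2) := by linarith [E0 t1, E1 t2]
      have hd2' : S.d (β t2) < 1 / 2 := by linarith
      have he2 : 0 < S.e (β t2) := by linarith
      have he2' : S.e (β t2) = 1 / 2 := by
        by_contra hne
        exact x2 ⟨hd2, hd2', he2, lt_of_le_of_ne (E1 t2) hne⟩
      have hdir2 := h.rdir_d hε mone hI2 l2 s2 hd2 hd2'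
      obtain ⟨σ, b2, hσ, hb2, g⟩ := h.sheet_germ hI2 hd2 he2
      rcases g with g | g
      · have := (g.2.rdir_left hε hb2).eq hdir2 hσ mone
        subst this
        obtain ⟨t3, l3, u3, s3, x3⟩ := h.exit_Ap hε hR mone hI2.1 (by linarith) hb2 g
        obtain ⟨w1, w2, w3⟩ := s3.ends hε l3
        refine halfCross_Ap h.cont hε l3 s3 he2' ?_
        by_contra hne
        refine x3 ⟨?_, by linarith, lt_of_le_of_ne (E0 t3) (Ne.symm hne), by linarith⟩
        linarith [E0 t3, E1 t2, E0 t1, E1 t1]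
      · have q1 := (g.2.rdir_left hε hb2).eq hdir2 hσ mone
        have q2 := (g.2.rdir_right hε hb2).nonneg_of_ge hσ (fun t => by
          have := E1 t
          simp only [he2']
          linarith)
        linarith
  · have he : S.e (β t1) = 1 / 2 := by
      by_contra hne
      exact x1 ⟨hd1, hd, he1, lt_of_le_of_ne (E1 t1) hne⟩
    have hdir := h.rdir_d hε one hI1 l1 s1 hd1 hd
    rcases g with g | g
    · have q1 := (g.2.rdir_left hε hb1).eq hdir hσ one
      have q2 := (g.2.rdir_right hε hb1).nonneg_of_le hσ (by simpa [he] using E1)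
      linarith
    · have q1 := (g.2.rdir_left hε hb1).eq hdir hσ one
      subst q1
      obtain ⟨t2, l2, u2, s2, x2⟩ := h.exit_Am hε hR one hI1.1 (by linarith) hb1 g
      obtain ⟨z1, z2, z3⟩ := s2.ends hε l2
      have hI2 : t2 ∈ Ioo (-1 : ℝ) 1 := ⟨by linarith, by linarith⟩
      obtain ⟨c1', c2', c3'⟩ := h.ne_corner t2 hI2
      rcases eq_or_lt_of_le (E0 t2) with he2 | he2
      · exact halfCross_Am h.cont hε l2 s2 he he2.symm
      have hd2 : 0 < S.d (β t2) := by linarith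
      have he2' : S.e (β t2) < 1 / 2 := by linarith
      have hd2' : S.d (β t2) = 1 / 2 := by
        by_contra hne
        exact x2 ⟨hd2, lt_of_le_of_ne (D1 t2) hne, he2, he2'⟩
      have hdir2 := h.rdir_e_Am hε one hI2 l2 s2 he2 he2'
      obtain ⟨σ, b2, hσ, hb2, g⟩ := h.sheet_germ hI2 hd2 he2
      have hn : ∀ t, S.d (β t) ≤ S.d (β t2) := by simpa [hd2'] using D1
      rcases g with g | g
      · have := (g.2.rdir_left hε hb2).nonneg_of_le hσ hn
        subst this
        obtain ⟨t3, l3, u3, s3, x3⟩ := h.exit_Ap hε hR mone hI2.1 (by linarith) hb2 g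
        obtain ⟨w1, w2, w3⟩ := s3.ends hε l3
        refine halfCross_Am_Ap h.cont hε l2 l3 s2 s3 hd2' he ?_
        by_contra hne
        refine x3 ⟨?_, by linarith, lt_of_le_of_ne (E0 t3) (Ne.symm hne), by linarith⟩
        linarith [E0 t3, E1 t2]
      · have q1 := (g.2.rdir_left hε hb2).nonneg_of_le hσ hn
        have q2 := (g.2.rdir_right hε hb2).const_sub.eq hdir2
          (by rcases hσ with rfl | rfl <;> simp) mone
        linarith

end Sys

end SheetModel

namespace SheetModel

open Set

variable {X : Type*} [TopologicalSpace X]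

namespace Sys

variable {S : Sys X} {ε RS RT RT' R R' κ : ℝ} {β : ℝ → X} {a b c σ : ℝ}

theorem Nice.exit_T (h : S.Nice ε RS RT RT' κ β) (hε : 0 < ε)
    (hR : 10 * (1 / 2 + 2 * S.P.L 0) < RT) (ha : -1 < a) (ha' : a + 1 / 10 < 1) (hab : a < b)
    (hs : Seg S.T S.d S.P.th 1 ε RT κ β a b) :
    ∃ t, a < t ∧ t < a + 1 / 10 ∧ β t ∈ S.Ap ∧ S.e (β t) = 0 ∧ 0 < S.d (β t) ∧
      S.d (β t) < 1 / 2 ∧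
      ∀ σ b, (σ = 1 ∨ σ = -1) → t < b → ¬ Seg S.T S.d S.P.th σ ε RT κ β t b := by
  have D0 := S.reg.d_nonneg
  have D1 := S.reg.d_le
  have one : (1 : ℝ) = 1 ∨ (1 : ℝ) = -1 := Or.inl rfl
  have hL0 : ∀ z, S.P.L (S.d z) ≤ S.P.L 0 := fun z => S.P.antitone_L (D0 z)
  obtain ⟨t, l, u, s, x⟩ := hs.exists_exit
    (E := {z | z ∈ S.Ap ∨ z ∈ S.Am ∨ S.d z = 1 / 2}) (C := 1 / 2 + 2 * S.P.L 0) (T := a + 1 / 10)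
    h.cont S.reg.isClosed_T S.reg.continuous_d S.P.continuous_th one
    (by linarith [S.P.one_le (by norm_num : (0 : ℝ) ≤ 1 / 2)]) hab
    (fun z hz => by
      obtain ⟨-, h1, h2⟩ := S.P.of_T z hz
      constructor <;> linarith [D0 z, D1 z, hL0 z])
    (by linarith)
    (fun s h1 h2 h3 h4 => by
      simp only [mem_ofPred_eq, not_or] at h4
      obtain ⟨n1, n2, n3⟩ := h4
      have hsI : s ∈ Ioo (-1 : ℝ) 1 := ⟨by linarith, by linarith⟩
      have hd : 0 < S.d (β s) := by linarith [D0 (β a), (h3.ends hε h1).1]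
      obtain ⟨b', hb', σ', hσ', g | g | g | g⟩ := h.germ s hsI
      · exact absurd (g.1 s le_rfl hb'.le) n1
      · exact absurd (g.1 s le_rfl hb'.le) n2
      · have := (g.2.rdir_left hε hb').eq
          (h.rdir_d hε one hsI h1 h3 hd (lt_of_le_of_ne (D1 _) n3)) hσ' one
        subst this
        exact ⟨b', hb', g⟩
      · have := S.reg.d_of_T' _ (g.1 s le_rfl hb'.le)
        linarith)
  obtain ⟨y1, y2, -⟩ := s.ends hε l
  have hI : t ∈ Ioo (-1 : ℝ) 1 := ⟨by linarith, by linarith⟩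
  obtain ⟨c1, c2, c3⟩ := h.ne_corner t hI
  have hT := s.1 t l.le le_rfl
  have he := S.reg.e_of_T _ hT
  have hd0 : 0 < S.d (β t) := by linarith [D0 (β a)]
  have hd1 : S.d (β t) < 1 / 2 := lt_of_le_of_ne (D1 _) fun q => c2 ⟨q, he⟩
  have hAm : β t ∉ S.Am := fun q => by
    have h1 := S.P.of_Am _ q
    have h2 := (S.P.psi_T 1 (S.d (β t)) hd0.le hd1.le le_rfl (S.P.one_le hd1.le)).2.2
    rw [he, sub_zero] at h1
    rw [h1] at h2
    linarith [(S.P.of_T _ (hs.1 a le_rfl hab.le)).2.1]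
  have hAp : β t ∈ S.Ap := by
    rcases x with x | x | x
    · exact x
    · exact absurd x hAm
    · linarith
  refine ⟨t, l, u, hAp, he, hd0, hd1, fun σ b' hσ hb' g => ?_⟩
  have := (g.2.rdir_left hε hb').eq (h.rdir_d hε one hI l s hd0 hd1) hσ one
  subst this
  obtain ⟨z1, z2, -⟩ := g.ends hε hb'
  have h1 := S.P.of_Ap _ hAp
  have h2 := (S.P.psi_T _ (S.d (β t)) hd0.le hd1.le (S.P.one_le hd1.le) le_rfl).2.2
  rw [S.P.psi_wrap _ hd0.le hd1.le, ← he, h1] at h2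
  have h3 := (S.P.of_T _ (g.1 b' hb'.le le_rfl)).2.2
  have h4 : S.P.L (S.d (β b')) ≤ S.P.L (S.d (β t)) := S.P.antitone_L (by linarith)
  linarith

/-- `β` or its reverse crosses half of the annulus of the second foliation. -/
def Cross (S : Sys X) (β : ℝ → X) : Prop := S.HalfCross β ∨ S.HalfCross (fun t => β (-t))

theorem Cross.of_neg (h : S.Cross (fun t => β (-t))) : S.Cross β := by
  unfold Cross at *
  simpa [or_comm] using h

theorem cross_of_seg {K : Set X} {f g : X → ℝ} {r r' R0 κ0 : ℝ} (hr : r < r')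
    (H : ∀ β a b, S.Nice ε RS RT RT' κ β → -r' < a → a < r' → a < b →
      Seg K f g 1 ε R0 κ0 β a b → S.Cross β)
    (h : S.Nice ε RS RT RT' κ β) (hσ : σ = 1 ∨ σ = -1) (ha : -r < a) (ha' : a < r) (hab : a < b)
    (hs : Seg K f g σ ε R0 κ0 β a b) : S.Cross β := by
  rcases hσ with rfl | rfl
  · exact H β a b h (by linarith) (by linarith) hab hs
  · refine Cross.of_neg (H _ (-min b r) (-a) h.neg ?_ ?_ ?_ ?_)
    · linarith [min_le_right b r]
    · linarith [lt_min hab ha']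
    · linarith [lt_min hab ha']
    · have := (hs.mono le_rfl (min_le_left b r)).neg
      rwa [neg_neg] at this

theorem Nice.cross_of_Ap (h : S.Nice ε R RT RT' 4 β) (hε : 0 < ε) (hR : 20 ≤ R)
    (hσ : σ = 1 ∨ σ = -1) (ha : -(45 / 100) < a) (ha' : a < 45 / 100) (hab : a < b)
    (hs : Seg S.Ap S.d S.e σ ε R 4 β a b) : S.Cross β :=
  cross_of_seg (r' := 1 / 2) (by norm_num)
    (fun _ _ _ h ha ha' hab hs =>
      Or.inl (h.halfCross_of_Ap_pos hε hR (by linarith) (by linarith) hab hs)) h hσ ha ha' hab hs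

theorem Nice.cross_of_T_pos (h : S.Nice ε R RT RT' 4 β) (hε : 0 < ε) (hR : 20 ≤ R)
    (hRT : 10 * (1 / 2 + 2 * S.P.L 0) < RT) (ha : -(35 / 100) < a) (ha' : a < 35 / 100)
    (hab : a < b) (hs : Seg S.T S.d S.P.th 1 ε RT 4 β a b) : S.Cross β := by
  obtain ⟨t, l, u, hA, he, hd0, hd1, hT⟩ := h.exit_T hε hRT (by linarith) (by linarith) hab hs
  obtain ⟨b', hb', σ, hσ, g | g | g | g⟩ := h.germ t ⟨by linarith, by linarith⟩
  · exact h.cross_of_Ap hε hR hσ (by linarith) (by linarith) hb' g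
  · rcases S.reg.slit _ hA (g.1 t le_rfl hb'.le) with q | q <;> linarith
  · exact absurd g (hT σ b' hσ hb')
  · linarith [S.reg.d_of_T' _ (g.1 t le_rfl hb'.le)]

theorem Nice.cross_of_T'_pos (h : S.Nice ε R RT RT' 4 β) (hε : 0 < ε) (hR : 20 ≤ R)
    (hRT : 10 * (1 / 2 + 2 * S.Q.L 0) < RT') (ha : -(35 / 100) < a) (ha' : a < 35 / 100)
    (hab : a < b) (hs : Seg S.T' S.e S.Q.th 1 ε RT' 0 β a b) : S.Cross β := by
  have h' := (h.weaken hε.le le_rfl le_rfl le_rfl (by norm_num : (0 : ℝ) ≤ 4)).swap hε.le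
  obtain ⟨t, l, u, hA, he, hd0, hd1, hT⟩ := h'.exit_T hε hRT (by linarith) (by linarith) hab hs
  simp only [Sys.swap] at hA he hd0 hd1 hT
  obtain ⟨b', hb', σ, hσ, g | g | g | g⟩ := h.germ t ⟨by linarith, by linarith⟩
  · exact h.cross_of_Ap hε hR hσ (by linarith) (by linarith) hb' g
  · rcases S.reg.slit _ hA (g.1 t le_rfl hb'.le) with q | q <;> linarith
  · linarith [S.reg.e_of_T _ (g.1 t le_rfl hb'.le)]
  · exact absurd g (hT σ b' hσ hb')

theorem Nice.cross_of_Am_pos (h : S.Nice ε R R RT' 4 β) (hε : 0 < ε) (hR : 20 ≤ R)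
    (hRT : 10 * (1 / 2 + 2 * S.P.L 0) < R) (ha : -(25 / 100) < a) (ha' : a < 25 / 100)
    (hab : a < b) (hs : Seg S.Am S.d (fun z => 1 - S.e z) 1 ε R 4 β a b) : S.Cross β := by
  have D0 := fun t => S.reg.d_nonneg (β t)
  have D1 := fun t => S.reg.d_le (β t)
  have E0 := fun t => S.reg.e_nonneg (β t)
  have E1 := fun t => S.reg.e_le (β t)
  have one : (1 : ℝ) = 1 ∨ (1 : ℝ) = -1 := Or.inl rfl
  obtain ⟨t, l, u, s, x⟩ := h.exit_Am hε hR one (by linarith) (by linarith) hab hs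
  obtain ⟨y1, y2, y3⟩ := s.ends hε l
  have hI : t ∈ Ioo (-1 : ℝ) 1 := ⟨by linarith, by linarith⟩
  obtain ⟨c1, c2, c3⟩ := h.ne_corner t hI
  have hd : 0 < S.d (β t) := by linarith [D0 a]
  obtain ⟨b1, hb1, σ, hσ, g | g | g | g⟩ := h.germ t hI
  · exact h.cross_of_Ap hε hR hσ (by linarith) (by linarith) hb1 g
  · exfalso
    rcases eq_or_lt_of_le (D1 t) with hd' | hd'
    · have he : 0 < S.e (β t) := lt_of_le_of_ne (E0 t) fun q => c2 ⟨hd', q.symm⟩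
      have q1 := (g.2.rdir_left hε hb1).nonneg_of_le hσ (by simpa [hd'] using D1)
      subst q1
      have hdir := h.rdir_e_Am hε one hI l s he (by linarith [E1 a])
      have q2 := (g.2.rdir_right hε hb1).const_sub.eq hdir (Or.inl (by norm_num)) (Or.inr rfl)
      linarith
    · have he : S.e (β t) = 0 := by
        by_contra q
        exact x ⟨hd, hd', lt_of_le_of_ne (E0 t) (Ne.symm q), by linarith [E1 a]⟩
      have hdir := h.rdir_d hε one hI l s hd hd'
      have q1 := (g.2.rdir_left hε hb1).eq hdir hσ one
      have q2 := (g.2.rdir_right hε hb1).nonneg_of_le hσ (by simpa [he] using E0)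
      linarith
  · have he := S.reg.e_of_T _ (g.1 t le_rfl hb1.le)
    have hd' : S.d (β t) < 1 / 2 := lt_of_le_of_ne (D1 t) fun q => c2 ⟨q, he⟩
    have := (g.2.rdir_left hε hb1).eq (h.rdir_d hε one hI l s hd hd') hσ one
    subst this
    exact h.cross_of_T_pos hε hR hRT (by linarith) (by linarith) hb1 g
  · linarith [S.reg.d_of_T' _ (g.1 t le_rfl hb1.le)]

/-- A sufficiently fast path crosses the annulus of the second foliation. -/
theorem Nice.cross (h : S.Nice ε R R RT' 4 β) (hε : 0 < ε) (hR : 20 ≤ R)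
    (hRT : 10 * (1 / 2 + 2 * S.P.L 0) < R) (hRT' : 10 * (1 / 2 + 2 * S.Q.L 0) < RT') :
    S.Cross β := by
  obtain ⟨b, hb, σ, hσ, g | g | g | g⟩ := h.germ 0 ⟨by norm_num, by norm_num⟩
  · exact h.cross_of_Ap hε hR hσ (by norm_num) (by norm_num) hb g
  · exact cross_of_seg (r := 20 / 100) (by norm_num)
      (fun _ _ _ h ha ha' hab hs => h.cross_of_Am_pos hε hR hRT ha ha' hab hs) h hσ (by norm_num)
      (by norm_num) hb g
  · exact cross_of_seg (r := 30 / 100) (by norm_num)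
      (fun _ _ _ h ha ha' hab hs => h.cross_of_T_pos hε hR hRT ha ha' hab hs) h hσ (by norm_num)
      (by norm_num) hb g
  · exact cross_of_seg (r := 30 / 100) (by norm_num)
      (fun _ _ _ h ha ha' hab hs => h.cross_of_T'_pos hε hR hRT' ha ha' hab hs) h hσ (by norm_num)
      (by norm_num) hb g

end Sys

end SheetModel

namespace SheetModel

open Set

variable {X : Type*} [TopologicalSpace X]

theorem Chart.twist_twist_psi {Ap Am T T' : Set X} {d e : X → ℝ} (r : Regions Ap Am T T' d e)
    (P : Chart Ap Am T d e) {t δ : ℝ} (h0 : 0 ≤ δ) (h1 : δ ≤ 1 / 2) (h2 : 0 ≤ t) (h3 : t ≤ 1)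
    (hm0 : 0 ≤ t + 4 * δ - 2 * P.L δ) (hm1 : t + 4 * δ - 2 * P.L δ ≤ 1) :
    P.twist r (P.twist r (P.psi t δ)) = P.psi (t + 4 * δ - 2 * P.L δ) δ := by
  have hL := P.one_le h1
  have h3' := h3.trans hL
  obtain ⟨k1, k2⟩ := P.step_mem h0 h1 h2 h3'
  rw [P.twist_psi r h0 h1 h2 h3', P.twist_psi r h0 h1 k1 k2]
  unfold Chart.step at *
  split_ifs with q1 q2 q3
  · have e1 : t + 4 * δ - 2 * P.L δ = 0 := by linarith
    have e2 : t + 2 * δ + 2 * δ = 2 * P.L δ := by linarith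
    rw [e1, e2, P.psi_wrap δ h0 h1]
  · congr 1; ring
  · congr 1; ring
  · linarith

namespace Sys

variable {S : Sys X} {ε RS RT RT' R R' κ : ℝ} {β γ : ℝ → X} {a b c σ : ℝ}

/-- `γ` crosses the sheet `Ap` from the core leaf `d = 1/2` to the outer leaf `d = 0`. -/
def CrossAp (S : Sys X) (γ : ℝ → X) : Prop :=
  ∃ a b, a < b ∧ (∀ t, a ≤ t → t ≤ b → γ t ∈ S.Ap) ∧
    (∀ s t, a ≤ s → s < t → t ≤ b → S.d (γ t) < S.d (γ s)) ∧
    S.d (γ a) = 1 / 2 ∧ S.d (γ b) = 0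

/-- `γ` crosses the sheet `Am` from the outer leaf `d = 0` to the core leaf `d = 1/2`. -/
def CrossAm (S : Sys X) (γ : ℝ → X) : Prop :=
  ∃ a b, a < b ∧ (∀ t, a ≤ t → t ≤ b → γ t ∈ S.Am) ∧ S.d (γ a) = 0 ∧ S.d (γ b) = 1 / 2

theorem HalfCross.twice (hβ : Continuous β) (h : S.HalfCross β) :
    S.CrossAp (fun t => S.swap.h (S.swap.h (β t))) ∧
      S.CrossAm (fun t => S.swap.h (S.swap.h (β t))) := by
  obtain ⟨a, b, φ, hab, hφ, hanti, hpos, ha, hb⟩ := h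
  have E0 := fun t => S.reg.e_nonneg (β t)
  have E1 := fun t => S.reg.e_le (β t)
  have hec := S.reg.continuous_e
  have hMc := S.Q.continuous_L
  set m : ℝ → ℝ := fun t => φ t + 4 * S.e (β t) - 2 * S.Q.L (S.e (β t)) with hm
  have hmc : Continuous m := by fun_prop
  have m_anti : ∀ s t, a ≤ s → s < t → t ≤ b → m t < m s := by
    intro s t h1 h2 h3
    obtain ⟨x, y⟩ := hanti s t h1 h2 h3
    have := S.Q.antitone_L y.le
    simp only [hm]
    linarith
  have m_anti' : ∀ s t, a ≤ s → s ≤ t → t ≤ b → m t ≤ m s := by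
    intro s t h1 h2 h3
    rcases eq_or_lt_of_le h2 with rfl | h2
    · exact le_rfl
    · exact (m_anti s t h1 h2 h3).le
  have hma : 1 ≤ m a := by
    simp only [hm, ha, S.Q.L_half]
    linarith [(hpos a le_rfl hab.le).1]
  have hmb : m b ≤ 0 := by
    simp only [hm, hb]
    linarith [(hpos b hab.le le_rfl).2.1, S.Q.one_le (by norm_num : (0 : ℝ) ≤ 1 / 2)]
  have ivt : ∀ y : ℝ, 0 ≤ y → y ≤ 1 → ∃ t, a ≤ t ∧ t ≤ b ∧ m t = y := by
    intro y h0 h1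
    obtain ⟨t, ht, rfl⟩ := intermediate_value_Icc' hab.le hmc.continuousOn
      (show y ∈ Icc (m b) (m a) from ⟨hmb.trans h0, h1.trans hma⟩)
    exact ⟨t, ht.1, ht.2, rfl⟩
  obtain ⟨t1, a1, b1, m1⟩ := ivt 1 (by norm_num) le_rfl
  obtain ⟨t2, a2, b2, m2⟩ := ivt (1 / 2) (by norm_num) (by norm_num)
  obtain ⟨t3, a3, b3, m3⟩ := ivt 0 le_rfl (by norm_num)
  have h12 : t1 < t2 := by
    by_contra q
    have := m_anti' t2 t1 a2 (not_lt.1 q) b1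
    linarith
  have h23 : t2 < t3 := by
    by_contra q
    have := m_anti' t3 t2 a3 (not_lt.1 q) b2
    linarith
  have hv : ∀ t, t1 ≤ t → t ≤ t3 → S.swap.h (S.swap.h (β t)) = S.Q.psi (m t) (S.e (β t)) := by
    intro t h1 h2
    obtain ⟨p1, p2, p3⟩ := hpos t (a1.trans h1) (h2.trans b3)
    have q1 : 0 ≤ m t := m3 ▸ m_anti' t t3 (a1.trans h1) h2 b3
    have q2 : m t ≤ 1 := m1 ▸ m_anti' t1 t a1 h1 (h2.trans b3)
    conv_lhs => rw [← p3]
    exact S.Q.twist_twist_psi S.swap.reg (E0 t) (E1 t) p1 p2 q1 q2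
  have hAp : ∀ t, t2 ≤ t → t ≤ t3 → S.swap.h (S.swap.h (β t)) ∈ S.Ap ∧
      S.d (S.swap.h (S.swap.h (β t))) = m t := by
    intro t h1 h2
    rw [hv t (h12.le.trans h1) h2]
    have q1 : 0 ≤ m t := m3 ▸ m_anti' t t3 (a2.trans h1) h2 b3
    have q2 : m t ≤ 1 / 2 := m2 ▸ m_anti' t2 t a2 h1 (h2.trans b3)
    obtain ⟨k1, -, k3⟩ := S.Q.psi_Ap (m t) _ (E0 t) (E1 t) q1 q2
    exact ⟨k1, k3⟩
  have hAm : ∀ t, t1 ≤ t → t ≤ t2 → S.swap.h (S.swap.h (β t)) ∈ S.Am ∧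
      S.d (S.swap.h (S.swap.h (β t))) = 1 - m t := by
    intro t h1 h2
    rw [hv t h1 (h2.trans h23.le)]
    have q1 : 1 / 2 ≤ m t := m2 ▸ m_anti' t t2 (a1.trans h1) h2 b2
    have q2 : m t ≤ 1 := m1 ▸ m_anti' t1 t a1 h1 (h2.trans b2)
    obtain ⟨k1, -, k3⟩ := S.Q.psi_Am (m t) _ (E0 t) (E1 t) q1 q2
    exact ⟨k1, k3⟩
  refine ⟨⟨t2, t3, h23, fun t h1 h2 => (hAp t h1 h2).1, fun s t h1 h2 h3 => ?_, ?_, ?_⟩,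
    ⟨t1, t2, h12, fun t h1 h2 => (hAm t h1 h2).1, ?_, ?_⟩⟩
  · rw [(hAp s h1 (h2.le.trans h3)).2, (hAp t (h1.trans h2.le) h3).2]
    exact m_anti s t (a2.trans h1) h2 (h3.trans b3)
  · rw [(hAp t2 le_rfl h23.le).2, m2]
  · rw [(hAp t3 h23.le le_rfl).2, m3]
  · rw [(hAm t1 le_rfl h12.le).2, m1]; norm_num
  · rw [(hAm t2 h12.le le_rfl).2, m2]; norm_num

/-- A crossing of `Ap` by `d` and a crossing of `Ap` by `e` meet. -/
theorem CrossAp.inter (hγ : Continuous γ) (hβ : Continuous β) (h : S.CrossAp γ)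
    (h' : S.rev.swap.CrossAm β) : ∃ t s, γ t = β s := by
  obtain ⟨a, b, hab, hin, hanti, ha, hb⟩ := h
  obtain ⟨a', b', hab', hin', ha', hb'⟩ := h'
  simp only [Sys.rev, Sys.swap] at hin' ha' hb'
  have hdc := S.reg.continuous_d
  have hec := S.reg.continuous_e
  have ivt : ∀ s, ∃ t ∈ Icc a b, S.d (γ t) = S.d (β s) := fun s =>
    intermediate_value_Icc' hab.le (hdc.comp hγ).continuousOn
      (show S.d (β s) ∈ Icc (S.d (γ b)) (S.d (γ a)) from
        ⟨hb ▸ S.reg.d_nonneg _, ha ▸ S.reg.d_le _⟩)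
  have closed : ∀ C : Set (ℝ × ℝ), IsClosed C → IsClosed (Prod.fst '' ((Icc a' b' ×ˢ Icc a b) ∩ C)) :=
    fun C hC => (((isCompact_Icc.prod isCompact_Icc).inter_right hC).image
      continuous_fst).isClosed
  set C1 : Set (ℝ × ℝ) := {p | S.d (γ p.2) = S.d (β p.1) ∧ S.e (β p.1) ≤ S.e (γ p.2)} with hC1
  set C2 : Set (ℝ × ℝ) := {p | S.d (γ p.2) = S.d (β p.1) ∧ S.e (γ p.2) ≤ S.e (β p.1)} with hC2
  have cl1 : IsClosed C1 := by
    simp only [hC1, ofPred_and]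
    exact (isClosed_eq (by fun_prop) (by fun_prop)).inter (isClosed_le (by fun_prop) (by fun_prop))
  have cl2 : IsClosed C2 := by
    simp only [hC2, ofPred_and]
    exact (isClosed_eq (by fun_prop) (by fun_prop)).inter (isClosed_le (by fun_prop) (by fun_prop))
  obtain ⟨s, hs, ⟨⟨s1, t⟩, ⟨ht, hd, he⟩, rfl⟩, ⟨⟨s2, t'⟩, ⟨ht', hd', he'⟩, hss⟩⟩ :=
    isPreconnected_closed_iff.1 (isPreconnected_Icc (a := a') (b := b')) _ _
      (closed C1 cl1) (closed C2 cl2)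
      (fun s hs => by
        obtain ⟨t, ht, h⟩ := ivt s
        rcases le_total (S.e (β s)) (S.e (γ t)) with q | q
        · exact Or.inl ⟨(s, t), ⟨⟨hs, ht⟩, h, q⟩, rfl⟩
        · exact Or.inr ⟨(s, t), ⟨⟨hs, ht⟩, h, q⟩, rfl⟩)
      (by
        obtain ⟨t, ht, h⟩ := ivt a'
        exact ⟨a', left_mem_Icc.2 hab'.le, (a', t),
          ⟨⟨left_mem_Icc.2 hab'.le, ht⟩, h, ha'.le.trans (S.reg.e_nonneg _)⟩, rfl⟩)
      (by
        obtain ⟨t, ht, h⟩ := ivt b'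
        exact ⟨b', right_mem_Icc.2 hab'.le, (b', t),
          ⟨⟨right_mem_Icc.2 hab'.le, ht⟩, h, (S.reg.e_le _).trans hb'.ge⟩, rfl⟩)
  simp only at hss hs hd he hd' he'
  subst hss
  simp only [mem_prod, mem_Icc] at ht ht'
  have htt : t = t' := by
    rcases lt_trichotomy t t' with q | q | q
    · have := hanti t t' ht.2.1 q ht'.2.2
      linarith
    · exact q
    · have := hanti t' t ht'.2.1 q ht.2.2
      linarith
  subst htt
  refine ⟨t, s2, ?_⟩
  rw [← S.P.of_Ap _ (hin t ht.2.1 ht.2.2), ← S.P.of_Ap _ (hin' s2 hs.1 hs.2), hd,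
    le_antisymm he' he]

/-- Two twists along the first foliation followed by two along the second. -/
noncomputable def F (S : Sys X) (z : X) : X := S.swap.h (S.swap.h (S.h (S.h z)))

theorem continuous_F (S : Sys X) : Continuous S.F :=
  S.swap.continuous_h.comp (S.swap.continuous_h.comp (S.continuous_h.comp S.continuous_h))

theorem F_rev_F (S : Sys X) (z : X) : S.rev.swap.F (S.F z) = z := by
  have h1 : ∀ z, S.rev.h (S.h z) = z := S.P.twist_rev_twist S.reg
  have h2 : ∀ z, S.rev.swap.h (S.swap.h z) = z := S.Q.twist_rev_twist S.reg.swap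
  change S.rev.h (S.rev.h (S.rev.swap.h (S.rev.swap.h (S.swap.h (S.swap.h (S.h (S.h z))))))) = z
  rw [h2, h2, h1, h1]

theorem F_F_rev (S : Sys X) (z : X) : S.F (S.rev.swap.F z) = z := by
  have h1 : ∀ z, S.h (S.rev.h z) = z := S.P.twist_twist_rev S.reg
  have h2 : ∀ z, S.swap.h (S.rev.swap.h z) = z := S.Q.twist_twist_rev S.reg.swap
  change S.swap.h (S.swap.h (S.h (S.h (S.rev.h (S.rev.h (S.rev.swap.h (S.rev.swap.h z))))))) = z
  rw [h1, h1, h2, h2]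

theorem Nice.h_h (hε : 0 < ε) (h : S.Nice ε R R R' 0 β) :
    S.Nice ε (R + 4 * ε) (R + 4 * ε) R' 4 (fun t => S.h (S.h (β t))) :=
  ((h.step hε).step hε).weaken hε.le (by linarith) (by linarith) le_rfl (by norm_num)

theorem Nice.F (hε : 0 < ε) (h : S.Nice ε R R R 0 β) :
    S.Nice ε (R + 4 * ε) (R + 4 * ε) (R + 4 * ε) 0 (fun t => S.F (β t)) := by
  have h1 := ((h.h_h hε).weaken hε.le (by linarith : R ≤ _) le_rfl le_rfl
    (by norm_num : (0 : ℝ) ≤ 4)).swap hε.le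
  have h2 := ((h1.h_h hε).weaken hε.le le_rfl le_rfl le_rfl (by norm_num : (0 : ℝ) ≤ 4)).swap hε.le
  exact h2

theorem Nice.F_iterate (hε : 0 < ε) (h : S.Nice ε R R R 0 β) (n : ℕ) :
    S.Nice ε (R + 4 * ε * n) (R + 4 * ε * n) (R + 4 * ε * n) 0 (fun t => S.F^[n] (β t)) := by
  induction n with
  | zero => simpa using h
  | succ n ih =>
    have := ih.F hε
    simp only [Function.iterate_succ_apply']
    convert this using 1 <;> (push_cast; ring)

theorem Nice.exists_cross (hε : 0 < ε) (h : S.Nice ε R R R 0 β) :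
    ∃ N : ℕ, ∀ n ≥ N, ∃ γ : ℝ → X, Continuous γ ∧ (∀ t, ∃ s, γ t = S.F^[n] (β s)) ∧
      S.CrossAp γ ∧ S.CrossAm γ := by
  set C := max 20 (max (10 * (1 / 2 + 2 * S.P.L 0)) (10 * (1 / 2 + 2 * S.Q.L 0))) with hC
  obtain ⟨N, hN⟩ := exists_nat_gt ((C - R) / (4 * ε))
  rw [div_lt_iff₀ (by positivity)] at hN
  refine ⟨N + 1, fun n hn => ?_⟩
  obtain ⟨n, rfl⟩ : ∃ k, n = k + 1 := ⟨n - 1, by omega⟩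
  have hn' : (N : ℝ) ≤ n := by exact_mod_cast (by omega : N ≤ n)
  have h1 := h.F_iterate hε n
  have hR : C < R + 4 * ε * n := by nlinarith
  have hC1 : 20 ≤ C := le_max_left _ _
  have hC2 : 10 * (1 / 2 + 2 * S.P.L 0) ≤ C := (le_max_left _ _).trans (le_max_right _ _)
  have hC3 : 10 * (1 / 2 + 2 * S.Q.L 0) ≤ C := (le_max_right _ _).trans (le_max_right _ _)
  have h2 := h1.h_h hε
  have hF : ∀ s, S.swap.h (S.swap.h (S.h (S.h (S.F^[n] (β s))))) = S.F^[n + 1] (β s) := fun s => by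
    rw [Function.iterate_succ_apply']
    rfl
  rcases h2.cross hε (by linarith) (by linarith) (by linarith) with q | q
  · exact ⟨_, S.swap.continuous_h.comp (S.swap.continuous_h.comp h2.cont),
      fun t => ⟨t, hF t⟩, q.twice h2.cont⟩
  · exact ⟨_, S.swap.continuous_h.comp (S.swap.continuous_h.comp h2.neg.cont),
      fun t => ⟨-t, hF (-t)⟩, q.twice h2.neg.cont⟩

theorem exists_path_psi {K : Set X} {g : X → ℝ} {O : Set (ℝ × ℝ)} {U : Set X} (hO : IsOpen O)
    {p0 : ℝ × ℝ} (hp : p0 ∈ O) (hpsi : ContinuousOn (fun p : ℝ × ℝ => S.P.psi p.1 p.2) O)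
    (hK : ∀ p ∈ O, S.P.psi p.1 p.2 ∈ K ∧ S.d (S.P.psi p.1 p.2) = p.2 ∧
      g (S.P.psi p.1 p.2) = p.1 ∧ 0 < p.2 ∧ p.2 < 1 / 2 ∧ S.P.psi p.1 p.2 ∈ U)
    (hgood : ∀ ε β a b, Seg K S.d g 1 ε 0 0 β a b → S.Good ε 0 0 0 0 β a b)
    (hgood' : ∀ ε β a b, Seg K S.d g (-1) ε 0 0 β a b → S.Good ε 0 0 0 0 β a b)
    (he : (∀ p ∈ O, S.e (S.P.psi p.1 p.2) = p.1) ∨ (∀ p ∈ O, S.e (S.P.psi p.1 p.2) = 1 - p.1) ∨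
      (∀ p ∈ O, S.e (S.P.psi p.1 p.2) = 0)) :
    ∃ ε β, 0 < ε ∧ S.Nice ε 0 0 0 0 β ∧ ∀ t, β t ∈ U := by
  obtain ⟨δ, hδ, hball⟩ := Metric.isOpen_iff.1 hO p0 hp
  set ε := δ / 2 with hε
  have hε0 : 0 < ε := by positivity
  set c : ℝ → ℝ := fun s => max (-1) (min s 1) with hc
  have cc : Continuous c := by fun_prop
  have cid : ∀ s, -1 ≤ s → s ≤ 1 → c s = s := fun s h1 h2 => by simp [hc, h1, h2]
  have cle : ∀ s, |c s| ≤ 1 := fun s => abs_le.2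
    ⟨le_max_left _ _, max_le (by norm_num) (min_le_right _ _)⟩
  set q : ℝ → ℝ × ℝ := fun s => (p0.1 + ε * c s, p0.2 + ε * c s) with hq
  have qO : ∀ s, q s ∈ O := fun s => hball <| by
    have : |ε * c s| < δ := by
      rw [abs_mul, abs_of_pos hε0]
      nlinarith [cle s]
    simpa [hq, Prod.dist_eq, Real.dist_eq] using this
  have qc : Continuous q := by fun_prop
  have seg : Seg K S.d g 1 ε 0 0 (fun s => S.P.psi (q s).1 (q s).2) (-1) 1 := by
    refine ⟨fun t _ _ => (hK _ (qO t)).1, fun s t h1 h2 h3 => ?_⟩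
    have ks := hK _ (qO s)
    have kt := hK _ (qO t)
    have : 0 ≤ ε * (t - s) := mul_nonneg hε0.le (by linarith)
    simp only [ks.2.1, ks.2.2.1, kt.2.1, kt.2.2.1]
    simp only [hq, cid s h1 (h2.trans h3), cid t (h1.trans h2) h3]
    refine ⟨?_, ?_, ?_, ?_⟩ <;> linarith
  have segn := seg.neg
  rw [neg_neg] at segn
  have hdd : ∀ s ∈ Ioo (-1 : ℝ) 1, Dir (fun t => S.d (S.P.psi (q t).1 (q t).2)) s := fun s hs =>
    ⟨1, Or.inl rfl, (seg.mono hs.1.le le_rfl).2.rdir_left hε0 hs.2,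
      (segn.mono (neg_mem_Ioo hs).1.le le_rfl).2.rdir_left hε0 (neg_mem_Ioo hs).2⟩
  have hdg : ∀ s ∈ Ioo (-1 : ℝ) 1, Dir (fun t => g (S.P.psi (q t).1 (q t).2)) s := fun s hs =>
    ⟨1, Or.inl rfl, (seg.mono hs.1.le le_rfl).2.rdir_right hε0 hs.2,
      (segn.mono (neg_mem_Ioo hs).1.le le_rfl).2.rdir_right hε0 (neg_mem_Ioo hs).2⟩
  have hg : ∀ t, g (S.P.psi (q t).1 (q t).2) = (q t).1 := fun t => (hK _ (qO t)).2.2.1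
  simp only [hg] at hdg
  refine ⟨ε, fun s => S.P.psi (q s).1 (q s).2, hε0, ⟨?_, fun s hs => ⟨1, hs.2, hgood _ _ _ _
    (seg.mono hs.1.le le_rfl)⟩, fun s hs => ⟨1, hs.2, hgood' _ _ _ _ (segn.mono hs.1.le le_rfl)⟩,
    fun s hs _ _ => hdd s hs, fun s hs h0 _ => ?_, fun s _ => ?_⟩, fun t => (hK _ (qO t)).2.2.2.2.2⟩
  · exact hpsi.comp_continuous qc qO
  · rcases he with he | he | he
    · simp only [he _ (qO _)]
      exact hdg s hs
    · simp only [he _ (qO _)]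
      obtain ⟨σ, hσ, ⟨b1, k1, k2⟩, ⟨b2, l1, l2⟩⟩ := hdg s hs
      refine ⟨-σ, by rcases hσ with rfl | rfl <;> simp, ⟨b1, k1, fun s t m1 m2 m3 => ?_⟩,
        ⟨b2, l1, fun s t m1 m2 m3 => ?_⟩⟩
      · have := k2 s t m1 m2 m3
        linarith
      · have := l2 s t m1 m2 m3
        linarith
    · rw [he _ (qO _)] at h0
      exact absurd h0 (lt_irrefl _)
  · obtain ⟨-, k, -, k0, k1, -⟩ := hK _ (qO s)
    simp only [k]
    refine ⟨fun h => ?_, fun h => ?_, fun h => ?_⟩ <;> linarith [h.1]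

theorem exists_path_of_P (S : Sys X) {U : Set X} (hU : IsOpen U) {z : X} (hz : z ∈ U)
    (hz' : z ∈ S.Ap ∨ z ∈ S.Am ∨ z ∈ S.T) :
    ∃ ε β, 0 < ε ∧ S.Nice ε 0 0 0 0 β ∧ ∀ t, β t ∈ U := by
  obtain ⟨k1, k2, k3⟩ := S.P.psi_lift S.reg hz'
  set t := S.P.lift z
  set δ := S.d z
  have hδ0 : 0 ≤ δ := S.reg.d_nonneg z
  have hδ1 : δ ≤ 1 / 2 := S.reg.d_le z
  have hLc := S.P.continuous_L
  have hL := S.P.one_le hδ1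
  obtain ⟨W, hW, hWD⟩ := (continuousOn_iff'.1 S.P.continuousOn_psi) U hU
  have memU : ∀ p : ℝ × ℝ, p ∈ W → 0 ≤ p.2 → p.2 ≤ 1 / 2 → 0 ≤ p.1 → p.1 ≤ 2 * S.P.L p.2 →
      S.P.psi p.1 p.2 ∈ U := by
    intro p h1 h2 h3 h4 h5
    have : p ∈ W ∩ {p : ℝ × ℝ | 0 ≤ p.2 ∧ p.2 ≤ 1 / 2 ∧ 0 ≤ p.1 ∧ p.1 ≤ 2 * S.P.L p.2} :=
      ⟨h1, h2, h3, h4, h5⟩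
    rw [← hWD] at this
    exact this.1
  have htW : (t, δ) ∈ W := by
    have : (t, δ) ∈ (fun p : ℝ × ℝ => S.P.psi p.1 p.2) ⁻¹' U ∩
        {p : ℝ × ℝ | 0 ≤ p.2 ∧ p.2 ≤ 1 / 2 ∧ 0 ≤ p.1 ∧ p.1 ≤ 2 * S.P.L p.2} :=
      ⟨by simpa [k1] using hz, hδ0, hδ1, k2, k3⟩
    rw [hWD] at this
    exact this.1
  obtain ⟨t1, ht1, ht1W, n1, n2⟩ : ∃ t1 ∈ Ioo 0 (2 * S.P.L δ), (t1, δ) ∈ W ∧ t1 ≠ 1 / 2 ∧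
      t1 ≠ 1 := by
    have hopen : IsOpen {x : ℝ | (x, δ) ∈ W} := hW.preimage (by fun_prop)
    have hcl : t ∈ closure (Ioo 0 (2 * S.P.L δ)) := by
      rw [closure_Ioo (by linarith)]
      exact ⟨k2, k3⟩
    obtain ⟨x, hx1, hx2⟩ := mem_closure_iff.1 hcl _ hopen htW
    have hne : ((({x : ℝ | (x, δ) ∈ W} ∩ Ioo 0 (2 * S.P.L δ)) \ {1 / 2}) \ {1}).Nonempty := by
      have h1 : ({1 / 2, 1} : Set ℝ).Finite := by simp
      have h3 : Dense ({1 / 2, 1} : Set ℝ)ᶜ := Set.Countable.dense_compl ℝ h1.countable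
      obtain ⟨y, hy⟩ := h3.inter_open_nonempty _ (hopen.inter isOpen_Ioo) ⟨x, hx1, hx2⟩
      refine ⟨y, ⟨hy.1, ?_⟩, ?_⟩ <;> simp only [mem_singleton_iff] <;> rintro rfl <;>
        exact hy.2 (by simp)
    obtain ⟨y, ⟨⟨y1, y2⟩, y3⟩, y4⟩ := hne
    exact ⟨y, y2, y1, y3, y4⟩
  obtain ⟨δ1, hδ1', hδW, hδL⟩ : ∃ δ1 ∈ Ioo (0 : ℝ) (1 / 2), (t1, δ1) ∈ W ∧ t1 < 2 * S.P.L δ1 := by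
    have hopen : IsOpen ({x : ℝ | (t1, x) ∈ W} ∩ {x | t1 < 2 * S.P.L x}) :=
      (hW.preimage (by fun_prop)).inter (isOpen_lt (by fun_prop) (by fun_prop))
    have hcl : δ ∈ closure (Ioo (0 : ℝ) (1 / 2)) := by
      rw [closure_Ioo (by norm_num)]
      exact ⟨hδ0, hδ1⟩
    obtain ⟨x, hx1, hx2⟩ := mem_closure_iff.1 hcl _ hopen ⟨ht1W, ht1.2⟩
    exact ⟨x, hx2, hx1.1, hx1.2⟩
  set O : Set (ℝ × ℝ) := W ∩ {p | 0 < p.2 ∧ p.2 < 1 / 2 ∧ 0 < p.1 ∧ p.1 < 2 * S.P.L p.2} with hOdef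
  have hO : IsOpen O := by
    simp only [hOdef, ofPred_and]
    refine hW.inter ((isOpen_lt ?_ ?_).inter ((isOpen_lt ?_ ?_).inter
      ((isOpen_lt ?_ ?_).inter (isOpen_lt ?_ ?_)))) <;> fun_prop
  have hp : (t1, δ1) ∈ O := ⟨hδW, hδ1'.1, hδ1'.2, ht1.1, hδL⟩
  have hpsi : ContinuousOn (fun p : ℝ × ℝ => S.P.psi p.1 p.2) O :=
    S.P.continuousOn_psi.mono fun p h => ⟨h.2.1.le, h.2.2.1.le, h.2.2.2.1.le, h.2.2.2.2.le⟩
  have hOU : ∀ p ∈ O, S.P.psi p.1 p.2 ∈ U := fun p h =>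
    memU p h.1 h.2.1.le h.2.2.1.le h.2.2.2.1.le h.2.2.2.2.le
  rcases lt_or_gt_of_ne n1 with q | q
  · have key : ∀ p ∈ O ∩ {p | p.1 < 1 / 2}, _ := fun p h =>
      S.P.psi_Ap p.1 p.2 h.1.2.1.le h.1.2.2.1.le h.1.2.2.2.1.le (le_of_lt h.2)
    refine exists_path_psi (K := S.Ap) (g := S.e) (O := O ∩ {p | p.1 < 1 / 2})
      (hO.inter (isOpen_lt (by fun_prop) (by fun_prop))) ⟨hp, q⟩ (hpsi.mono inter_subset_left)
      (fun p h => ⟨(key p h).1, (key p h).2.1, (key p h).2.2, h.1.2.1, h.1.2.2.1, hOU p h.1⟩)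
      (fun _ _ _ _ h => ⟨1, Or.inl rfl, Or.inl h⟩) (fun _ _ _ _ h => ⟨-1, Or.inr rfl, Or.inl h⟩)
      (Or.inl fun p h => (key p h).2.2)
  rcases lt_or_gt_of_ne n2 with q' | q'
  · have key : ∀ p ∈ O ∩ ({p | 1 / 2 < p.1} ∩ {p | p.1 < 1}), _ := fun p h =>
      S.P.psi_Am p.1 p.2 h.1.2.1.le h.1.2.2.1.le (le_of_lt h.2.1) (le_of_lt h.2.2)
    refine exists_path_psi (K := S.Am) (g := fun z => 1 - S.e z)
      (O := O ∩ ({p | 1 / 2 < p.1} ∩ {p | p.1 < 1}))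
      (hO.inter ((isOpen_lt (by fun_prop) (by fun_prop)).inter
        (isOpen_lt (by fun_prop) (by fun_prop)))) ⟨hp, q, q'⟩ (hpsi.mono inter_subset_left)
      (fun p h => ⟨(key p h).1, (key p h).2.1, by rw [(key p h).2.2]; ring, h.1.2.1, h.1.2.2.1,
        hOU p h.1⟩)
      (fun _ _ _ _ h => ⟨1, Or.inl rfl, Or.inr (Or.inl h)⟩)
      (fun _ _ _ _ h => ⟨-1, Or.inr rfl, Or.inr (Or.inl h)⟩)
      (Or.inr (Or.inl fun p h => (key p h).2.2))
  · have key : ∀ p ∈ O ∩ {p | 1 < p.1}, _ := fun p h =>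
      S.P.psi_T p.1 p.2 h.1.2.1.le h.1.2.2.1.le (le_of_lt h.2) h.1.2.2.2.2.le
    refine exists_path_psi (K := S.T) (g := S.P.th) (O := O ∩ {p | 1 < p.1})
      (hO.inter (isOpen_lt (by fun_prop) (by fun_prop))) ⟨hp, q'⟩ (hpsi.mono inter_subset_left)
      (fun p h => ⟨(key p h).1, (key p h).2.1, (key p h).2.2, h.1.2.1, h.1.2.2.1, hOU p h.1⟩)
      (fun _ _ _ _ h => ⟨1, Or.inl rfl, Or.inr (Or.inr (Or.inl h))⟩)
      (fun _ _ _ _ h => ⟨-1, Or.inr rfl, Or.inr (Or.inr (Or.inl h))⟩)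
      (Or.inr (Or.inr fun p h => S.reg.e_of_T _ (key p h).1))

/-- Every nonempty open set contains a nice path. -/
theorem exists_path (S : Sys X) {U : Set X} (hU : IsOpen U) (hne : U.Nonempty) :
    ∃ ε β, 0 < ε ∧ S.Nice ε 0 0 0 0 β ∧ ∀ t, β t ∈ U := by
  obtain ⟨z, hz⟩ := hne
  rcases S.reg.cover z with h | h | h | h
  · exact S.exists_path_of_P hU hz (Or.inl h)
  · exact S.exists_path_of_P hU hz (Or.inr (Or.inl h))
  · exact S.exists_path_of_P hU hz (Or.inr (Or.inr h))
  · obtain ⟨ε, β, h1, h2, h3⟩ := S.swap.exists_path_of_P hU hz (Or.inr (Or.inr h))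
    exact ⟨ε, β, h1, h2.swap h1.le, h3⟩

/-- The map `F` is topologically mixing. -/
theorem F_mixing (S : Sys X) {U V : Set X} (hU : IsOpen U) (hV : IsOpen V) (hU' : U.Nonempty)
    (hV' : V.Nonempty) : ∃ N, ∀ k ≥ N, ∃ z ∈ U, S.F^[k] z ∈ V := by
  obtain ⟨ε, β, h1, h2, h3⟩ := S.exists_path hU hU'
  obtain ⟨ε', β', h1', h2', h3'⟩ := S.rev.swap.exists_path hV hV'
  obtain ⟨N, hN⟩ := h2.exists_cross h1
  obtain ⟨N', hN'⟩ := h2'.exists_cross h1'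
  refine ⟨N + N', fun k hk => ?_⟩
  obtain ⟨γ, hγ, hγ1, hγ2, -⟩ := hN (k - N') (by omega)
  obtain ⟨γ', hγ', hγ1', -, hγ2'⟩ := hN' N' le_rfl
  obtain ⟨t, s, hts⟩ := hγ2.inter hγ hγ' hγ2'
  obtain ⟨x, hx⟩ := hγ1 t
  obtain ⟨y, hy⟩ := hγ1' s
  refine ⟨β x, h3 x, ?_⟩
  have : S.F^[k] (β x) = β' y := by
    obtain ⟨j, rfl⟩ : ∃ j, k = N' + j := ⟨k - N', by omega⟩
    rw [Function.iterate_add_apply]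
    rw [show N' + j - N' = j by omega] at hx
    rw [← hx, hts, hy]
    exact (Function.LeftInverse.iterate S.F_F_rev N') _
  rw [this]
  exact h3' y

end Sys

end SheetModel

namespace SheetModel

open Set

namespace Square

/-- The leaf function of the first foliation of the unit square. -/
noncomputable def dP (x y : ℝ) : ℝ :=
  max 0 (min y (min (1 - y) (min (3 - 2 * x - 3 * y)
    (min (1 - 2 * x + y) (max x (4 * x + y - 1))))))

/-- The leaf function of the second foliation of the unit square. -/
noncomputable def dQ (x y : ℝ) : ℝ :=
  max 0 (min (2 * x + y - 1) (min (1 - y) (min y (max (4 - 4 * x - y) (1 - x)))))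

/-- The position along a leaf in the first handle. -/
noncomputable def thP (x y : ℝ) : ℝ :=
  max (2 - 2 * x - y) (min (2 - 5 * x + 2 * y) (max (3 - 6 * x - y) (13 - 38 * x - 9 * y)))

/-- The position along a leaf in the second handle. -/
noncomputable def thQ (x y : ℝ) : ℝ :=
  max (2 * x - y) (max (min (10 * x + 3 * y - 8) (7 * x + 2 * y - 5))
    (max (1 - 2 * x + 3 * y) (11 * y - 2 * x - 5)))

/-- The abscissa of the point at position `2 * u - d` of the leaf `d` of the first foliation. -/
noncomputable def xP (u d : ℝ) : ℝ :=
  min (max (1 - u) (min d (2 - u - 4 * d))) (max u (3 * u - 2 * d))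

/-- The ordinate of the point at position `2 * u - d` of the leaf `d` of the first foliation. -/
noncomputable def yP (u d : ℝ) : ℝ :=
  max d (max (min (d - 3 + 4 * u) (max (2 * d - 1 + u) (17 * d - 7 + 4 * u)))
    (min (1 - d) (1 - 2 * u + d)))

/-- The abscissa of the point at position `2 * u - e` of the leaf `e` of the second foliation. -/
noncomputable def xQ (u e : ℝ) : ℝ :=
  max (2 * e - u) (min u (max (2 - u - e) (min (1 - e) (3 - 5 * e - u))))

/-- The ordinate of the point at position `2 * u - e` of the leaf `e` of the second foliation. -/
noncomputable def yQ (u e : ℝ) : ℝ :=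
  min (1 - e) (max (1 + e - 2 * u) (max e (min (4 * u + 3 * e - 4) (u - 1 + 3 * e))))

/-- Half the length of a leaf of the first foliation. -/
noncomputable def LP (d : ℝ) : ℝ := max (1 - d) (2 - 5 * d)

/-- Half the length of a leaf of the second foliation. -/
noncomputable def LQ (e : ℝ) : ℝ := max (2 - 3 * e) (3 - 7 * e)

/-- The upper sheet. -/
def InAp (x y : ℝ) : Prop := 1 / 2 ≤ y ∧ 1 ≤ 2 * x + y ∧ 2 * x + 3 * y ≤ 3

/-- The lower sheet. -/
def InAm (x y : ℝ) : Prop := y ≤ 1 / 2 ∧ 1 ≤ 2 * x + y ∧ 2 * x - y ≤ 1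

/-- The first handle. -/
def InT (x y : ℝ) : Prop := 2 * x + y ≤ 1

/-- The second handle. -/
def InT' (x y : ℝ) : Prop := 3 ≤ 2 * x + 3 * y ∨ 1 ≤ 2 * x - y

variable {x y t d e : ℝ}

theorem P_Ap (h0 : 0 ≤ d) (h1 : d ≤ 1 / 2) (h2 : 0 ≤ t) (h3 : t ≤ 1 / 2)
    (hx : x = xP ((t + d) / 2) d) (hy : y = yP ((t + d) / 2) d) :
    (0 ≤ x ∧ x ≤ 1 ∧ 0 ≤ y ∧ y ≤ 1) ∧ InAp x y ∧ dP x y = d ∧ dQ x y = t := by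
  rcases le_total t d with h | h
  · have hx' : x = (t + d) / 2 := by unfold xP at hx; grind
    have hy' : y = 1 - d := by unfold yP at hy; grind
    clear hx hy
    unfold InAp dP dQ
    grind (splits := 40)
  · have hx' : x = 3 * ((t + d) / 2) - 2 * d := by unfold xP at hx; grind
    have hy' : y = 1 - t := by unfold yP at hy; grind
    clear hx hy
    unfold InAp dP dQ
    grind (splits := 40)

theorem P_Am (h0 : 0 ≤ d) (h1 : d ≤ 1 / 2) (h2 : 1 / 2 ≤ t) (h3 : t ≤ 1)
    (hx : x = xP ((t + d) / 2) d) (hy : y = yP ((t + d) / 2) d) :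
    (0 ≤ x ∧ x ≤ 1 ∧ 0 ≤ y ∧ y ≤ 1) ∧ InAm x y ∧ dP x y = d ∧ dQ x y = 1 - t := by
  have hx' : x = 1 - (t + d) / 2 := by unfold xP at hx; grind
  rcases le_total t (1 - d) with h | h
  · have hy' : y = 1 - t := by unfold yP at hy; grind
    clear hx hy
    unfold InAm dP dQ
    grind (splits := 40)
  · have hy' : y = d := by unfold yP at hy; grind
    clear hx hy
    unfold InAm dP dQ
    grind (splits := 40)

theorem P_T (h0 : 0 ≤ d) (h1 : d ≤ 1 / 2) (h2 : 1 ≤ t) (h3 : t ≤ 2 * LP d)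
    (hx : x = xP ((t + d) / 2) d) (hy : y = yP ((t + d) / 2) d) :
    (0 ≤ x ∧ x ≤ 1 ∧ 0 ≤ y ∧ y ≤ 1) ∧ InT x y ∧ dP x y = d ∧ thP x y = t := by
  rcases le_total (1 / 4) d with h | h
  · have hL : LP d = 1 - d := by unfold LP; grind (splits := 40)
    rw [hL] at h3
    have hx' : x = 1 - (t + d) / 2 := by unfold xP at hx; grind
    rcases le_total t (3 / 2 - d) with h | h
    · have hy' : y = d := by unfold yP at hy; grind
      clear hx hy
      unfold InT dP thP
      grind (splits := 40)
    · have hy' : y = d - 3 + 2 * (t + d) := by unfold yP at hy; grind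
      clear hx hy
      unfold InT dP thP
      grind (splits := 40)
  · have hL : LP d = 2 - 5 * d := by unfold LP; grind (splits := 40)
    rw [hL] at h3
    rcases le_total t (2 - 3 * d) with h | h
    · have hx' : x = 1 - (t + d) / 2 := by unfold xP at hx; grind
      have hy' : y = d := by unfold yP at hy; grind
      clear hx hy
      unfold InT dP thP
      grind (splits := 40)
    rcases le_total t (4 - 11 * d) with h | h
    · have hx' : x = d := by unfold xP at hx; grind
      have hy' : y = 2 * d - 1 + (t + d) / 2 := by unfold yP at hy; grind
      clear hx hy
      unfold InT dP thP
      grind (splits := 40)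
    · have hx' : x = 2 - (t + d) / 2 - 4 * d := by unfold xP at hx; grind
      have hy' : y = 17 * d - 7 + 2 * (t + d) := by unfold yP at hy; grind
      clear hx hy
      unfold InT dP thP
      grind (splits := 40)

theorem P_wrap (h0 : 0 ≤ d) (h1 : d ≤ 1 / 2) :
    xP ((2 * LP d + d) / 2) d = xP ((0 + d) / 2) d ∧
      yP ((2 * LP d + d) / 2) d = yP ((0 + d) / 2) d := by
  have e1 : xP ((0 + d) / 2) d = d / 2 := by unfold xP; grind (splits := 40)
  have e2 : yP ((0 + d) / 2) d = 1 - d := by unfold yP; grind (splits := 40)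
  rw [e1, e2]
  rcases le_total (1 / 4) d with h | h
  · have hL : LP d = 1 - d := by unfold LP; grind (splits := 40)
    rw [hL]
    unfold xP yP
    grind (splits := 40)
  · have hL : LP d = 2 - 5 * d := by unfold LP; grind (splits := 40)
    rw [hL]
    unfold xP yP
    grind (splits := 40)

theorem Ap_left (h : InAp x y) (h' : x ≤ 1 - y) : dP x y = 1 - y ∧ dQ x y = 2 * x + y - 1 := by
  unfold InAp at h
  unfold dP dQ
  grind (splits := 40)

theorem Ap_right (h : InAp x y) (h' : 1 - y ≤ x) :
    dP x y = 3 - 2 * x - 3 * y ∧ dQ x y = 1 - y := by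
  unfold InAp at h
  unfold dP dQ
  grind (splits := 40)

theorem Am_left (h : InAm x y) (h' : x ≤ 1 / 2) : dP x y = y ∧ dQ x y = 2 * x + y - 1 := by
  unfold InAm at h
  unfold dP dQ
  grind (splits := 40)

theorem Am_right (h : InAm x y) (h' : 1 / 2 ≤ x) : dP x y = 1 - 2 * x + y ∧ dQ x y = y := by
  unfold InAm at h
  unfold dP dQ
  grind (splits := 40)

theorem P_of_Ap (h : InAp x y) : xP ((dQ x y + dP x y) / 2) (dP x y) = x ∧
    yP ((dQ x y + dP x y) / 2) (dP x y) = y := by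
  rcases le_total x (1 - y) with h' | h'
  · obtain ⟨e1, e2⟩ := Ap_left h h'
    unfold InAp at h
    rw [e1, e2]
    unfold xP yP
    grind (splits := 40)
  · obtain ⟨e1, e2⟩ := Ap_right h h'
    unfold InAp at h
    rw [e1, e2]
    unfold xP yP
    grind (splits := 40)

theorem P_of_Am (h : InAm x y) : xP ((1 - dQ x y + dP x y) / 2) (dP x y) = x ∧
    yP ((1 - dQ x y + dP x y) / 2) (dP x y) = y := by
  rcases le_total x (1 / 2) with h' | h'
  · obtain ⟨e1, e2⟩ := Am_left h h'
    unfold InAm at h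
    rw [e1, e2]
    unfold xP yP
    grind (splits := 40)
  · obtain ⟨e1, e2⟩ := Am_right h h'
    unfold InAm at h
    rw [e1, e2]
    unfold xP yP
    grind (splits := 40)

theorem T_cases (h : InT x y) (hx : 0 ≤ x) (hy : 0 ≤ y) :
    (dP x y = y ∧ thP x y = 2 - 2 * x - y ∧ (y ≤ x ∨ 1 / 4 ≤ x)) ∨
    (dP x y = x ∧ thP x y = 2 - 5 * x + 2 * y ∧ x ≤ y ∧ 3 * x + y ≤ 1) ∨
    (dP x y = 4 * x + y - 1 ∧ thP x y = 3 - 6 * x - y ∧ 1 ≤ 3 * x + y ∧ x ≤ 1 / 4 ∧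
      5 ≤ 16 * x + 4 * y) ∨
    (dP x y = 4 * x + y - 1 ∧ thP x y = 13 - 38 * x - 9 * y ∧ 1 ≤ 3 * x + y ∧ x ≤ 1 / 4 ∧
      16 * x + 4 * y ≤ 5) := by
  unfold InT at h
  by_cases c1 : y ≤ x ∨ 1 / 4 ≤ x
  · left
    unfold dP thP
    grind (splits := 40)
  push Not at c1
  rcases le_total (3 * x + y) 1 with c2 | c2
  · right; left
    unfold dP thP
    grind (splits := 40)
  rcases le_total 5 (16 * x + 4 * y) with c3 | c3
  · right; right; left
    unfold dP thP
    grind (splits := 40)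
  · right; right; right
    unfold dP thP
    grind (splits := 40)

theorem P_of_T (h : InT x y) (hx : 0 ≤ x) (hy : 0 ≤ y) :
    (xP ((thP x y + dP x y) / 2) (dP x y) = x ∧ yP ((thP x y + dP x y) / 2) (dP x y) = y) ∧
      1 ≤ thP x y ∧ thP x y ≤ 2 * LP (dP x y) := by
  have h' := h
  unfold InT at h'
  rcases T_cases h hx hy with ⟨e1, e2, c⟩ | ⟨e1, e2, c⟩ | ⟨e1, e2, c⟩ | ⟨e1, e2, c⟩ <;>
  · rw [e1, e2]
    unfold xP yP LP
    grind (splits := 40)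

end Square

end SheetModel

namespace SheetModel

open Set

namespace Square

variable {x y t d e : ℝ}

theorem Q_Ap (h0 : 0 ≤ e) (h1 : e ≤ 1 / 2) (h2 : 0 ≤ t) (h3 : t ≤ 1 / 2)
    (hx : x = xQ ((t + e) / 2) e) (hy : y = yQ ((t + e) / 2) e) :
    (0 ≤ x ∧ x ≤ 1 ∧ 0 ≤ y ∧ y ≤ 1) ∧ InAp x y ∧ dQ x y = e ∧ dP x y = t := by
  rcases le_total t e with h | h
  · have hx' : x = 2 * e - (t + e) / 2 := by unfold xQ at hx; grind
    have hy' : y = 1 - e := by unfold yQ at hy; grind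
    clear hx hy
    unfold InAp dP dQ
    grind (splits := 40)
  · have hx' : x = (t + e) / 2 := by unfold xQ at hx; grind
    have hy' : y = 1 - t := by unfold yQ at hy; grind
    clear hx hy
    unfold InAp dP dQ
    grind (splits := 40)

theorem Q_Am (h0 : 0 ≤ e) (h1 : e ≤ 1 / 2) (h2 : 1 / 2 ≤ t) (h3 : t ≤ 1)
    (hx : x = xQ ((t + e) / 2) e) (hy : y = yQ ((t + e) / 2) e) :
    (0 ≤ x ∧ x ≤ 1 ∧ 0 ≤ y ∧ y ≤ 1) ∧ InAm x y ∧ dQ x y = e ∧ dP x y = 1 - t := by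
  have hx' : x = (t + e) / 2 := by unfold xQ at hx; grind
  rcases le_total t (1 - e) with h | h
  · have hy' : y = 1 - t := by unfold yQ at hy; grind
    clear hx hy
    unfold InAm dP dQ
    grind (splits := 40)
  · have hy' : y = e := by unfold yQ at hy; grind
    clear hx hy
    unfold InAm dP dQ
    grind (splits := 40)

theorem Q_T' (h0 : 0 ≤ e) (h1 : e ≤ 1 / 2) (h2 : 1 ≤ t) (h3 : t ≤ 2 * LQ e)
    (hx : x = xQ ((t + e) / 2) e) (hy : y = yQ ((t + e) / 2) e) :
    (0 ≤ x ∧ x ≤ 1 ∧ 0 ≤ y ∧ y ≤ 1) ∧ InT' x y ∧ dQ x y = e ∧ thQ x y = t := by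
  rcases le_total t (2 - 2 * e) with h | h
  · have hx' : x = (t + e) / 2 := by unfold xQ at hx; grind
    have hy' : y = e := by unfold yQ at hy; grind
    clear hx hy h3
    unfold InT' dQ thQ
    grind (splits := 40)
  rcases le_total (1 / 4) e with h' | h'
  · have hL : LQ e = 2 - 3 * e := by unfold LQ; grind
    rw [hL] at h3
    have hx' : x = 2 - (t + e) / 2 - e := by unfold xQ at hx; grind
    rcases le_total t (5 / 2 - 3 * e) with h | h
    · have hy' : y = 2 * (t + e) + 3 * e - 4 := by unfold yQ at hy; grind
      clear hx hy
      unfold InT' dQ thQ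
      grind (splits := 40)
    · have hy' : y = 1 - e := by unfold yQ at hy; grind
      clear hx hy
      unfold InT' dQ thQ
      grind (splits := 40)
  · have hL : LQ e = 3 - 7 * e := by unfold LQ; grind
    rw [hL] at h3
    rcases le_total t (2 - e) with h | h
    · have hx' : x = 2 - (t + e) / 2 - e := by unfold xQ at hx; grind
      have hy' : y = 2 * (t + e) + 3 * e - 4 := by unfold yQ at hy; grind
      clear hx hy
      unfold InT' dQ thQ
      grind (splits := 40)
    rcases le_total t (4 - 9 * e) with h | h
    · have hx' : x = 1 - e := by unfold xQ at hx; grind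
      have hy' : y = (t + e) / 2 - 1 + 3 * e := by unfold yQ at hy; grind
      clear hx hy
      unfold InT' dQ thQ
      grind (splits := 40)
    · have hx' : x = 3 - 5 * e - (t + e) / 2 := by unfold xQ at hx; grind
      have hy' : y = 1 - e := by unfold yQ at hy; grind
      clear hx hy
      unfold InT' dQ thQ
      grind (splits := 40)

theorem Q_wrap (h0 : 0 ≤ e) (h1 : e ≤ 1 / 2) :
    xQ ((2 * LQ e + e) / 2) e = xQ ((0 + e) / 2) e ∧
      yQ ((2 * LQ e + e) / 2) e = yQ ((0 + e) / 2) e := by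
  have e1 : xQ ((0 + e) / 2) e = 3 * e / 2 := by unfold xQ; grind
  have e2 : yQ ((0 + e) / 2) e = 1 - e := by unfold yQ; grind
  rw [e1, e2]
  rcases le_total (1 / 4) e with h | h
  · have hL : LQ e = 2 - 3 * e := by unfold LQ; grind
    rw [hL]
    unfold xQ yQ
    grind (splits := 40)
  · have hL : LQ e = 3 - 7 * e := by unfold LQ; grind
    rw [hL]
    unfold xQ yQ
    grind (splits := 40)

theorem Q_of_Ap (h : InAp x y) : xQ ((dP x y + dQ x y) / 2) (dQ x y) = x ∧
    yQ ((dP x y + dQ x y) / 2) (dQ x y) = y := by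
  rcases le_total x (1 - y) with h' | h'
  · obtain ⟨e1, e2⟩ := Ap_left h h'
    unfold InAp at h
    rw [e1, e2]
    unfold xQ yQ
    grind (splits := 40)
  · obtain ⟨e1, e2⟩ := Ap_right h h'
    unfold InAp at h
    rw [e1, e2]
    unfold xQ yQ
    grind (splits := 40)

theorem Q_of_Am (h : InAm x y) : xQ ((1 - dP x y + dQ x y) / 2) (dQ x y) = x ∧
    yQ ((1 - dP x y + dQ x y) / 2) (dQ x y) = y := by
  rcases le_total x (1 / 2) with h' | h'
  · obtain ⟨e1, e2⟩ := Am_left h h'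
    unfold InAm at h
    rw [e1, e2]
    unfold xQ yQ
    grind (splits := 40)
  · obtain ⟨e1, e2⟩ := Am_right h h'
    unfold InAm at h
    rw [e1, e2]
    unfold xQ yQ
    grind (splits := 40)

theorem T'_cases (h : InT' x y) (hx0 : 0 ≤ x) (hx : x ≤ 1) (hy0 : 0 ≤ y) (hy : y ≤ 1) :
    (dQ x y = y ∧ thQ x y = 2 * x - y ∧ 1 ≤ 2 * x - y ∧ 2 * x + y ≤ 2) ∨
    (dQ x y = 4 - 4 * x - y ∧ thQ x y = 10 * x + 3 * y - 8 ∧ 2 ≤ 2 * x + y ∧ 3 * x + y ≤ 3 ∧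
      3 / 4 ≤ x) ∨
    (dQ x y = 1 - x ∧ thQ x y = 7 * x + 2 * y - 5 ∧ 3 ≤ 3 * x + y ∧ y ≤ x) ∨
    (dQ x y = 1 - y ∧ thQ x y = 1 - 2 * x + 3 * y ∧ 3 ≤ 2 * x + 3 * y ∧ x ≤ 3 / 4 ∧ y ≤ 3 / 4) ∨
    (dQ x y = 1 - y ∧ thQ x y = 11 * y - 2 * x - 5 ∧ 3 ≤ 2 * x + 3 * y ∧ x ≤ y ∧ 3 / 4 ≤ y) := by
  unfold InT' at h
  by_cases c1 : 1 ≤ 2 * x - y ∧ 2 * x + y ≤ 2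
  · left
    unfold dQ thQ
    grind (splits := 40)
  by_cases c2 : 3 / 4 ≤ x ∧ 3 * x + y ≤ 3 ∧ 2 ≤ 2 * x + y
  · right; left
    unfold dQ thQ
    grind (splits := 40)
  by_cases c3 : 3 ≤ 3 * x + y ∧ y ≤ x
  · right; right; left
    unfold dQ thQ
    grind (splits := 40)
  rcases le_total y (3 / 4) with c4 | c4
  · right; right; right; left
    have : x ≤ 3 / 4 ∧ 3 ≤ 2 * x + 3 * y := by grind
    unfold dQ thQ
    grind (splits := 40)
  · right; right; right; right
    have : x ≤ y ∧ 3 ≤ 2 * x + 3 * y := by grind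
    unfold dQ thQ
    grind (splits := 40)

theorem Q_of_T' (h : InT' x y) (hx0 : 0 ≤ x) (hx : x ≤ 1) (hy0 : 0 ≤ y) (hy : y ≤ 1) :
    (xQ ((thQ x y + dQ x y) / 2) (dQ x y) = x ∧ yQ ((thQ x y + dQ x y) / 2) (dQ x y) = y) ∧
      1 ≤ thQ x y ∧ thQ x y ≤ 2 * LQ (dQ x y) := by
  rcases T'_cases h hx0 hx hy0 hy with ⟨e1, e2, c⟩ | ⟨e1, e2, c⟩ | ⟨e1, e2, c⟩ | ⟨e1, e2, c⟩ |
    ⟨e1, e2, c⟩ <;>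
  · rw [e1, e2]
    unfold xQ yQ LQ
    grind (splits := 40)

end Square

end SheetModel

namespace SheetModel

open Set

namespace Square

theorem dQ_eq_zero {x y : ℝ} (h : InT x y) : dQ x y = 0 := by
  unfold InT at h
  unfold dQ
  grind

theorem dP_eq_zero {x y : ℝ} (h : InT' x y) : dP x y = 0 := by
  unfold InT' at h
  unfold dP
  grind

theorem eq_half {x y : ℝ} (h : InAp x y) (h' : InAm x y) : dP x y = 1 / 2 ∨ dQ x y = 1 / 2 := by
  have hy : y = 1 / 2 := le_antisymm h'.1 h.1
  rcases le_total x (1 / 2) with c | c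
  · left
    rw [(Am_left h' c).1, hy]
  · right
    rw [(Am_right h' c).2, hy]

/-- The unit square. -/
abbrev Sq : Type := Icc (0 : ℝ) 1 × Icc (0 : ℝ) 1

/-- The nearest point of the unit square. -/
noncomputable def toSq (x y : ℝ) : Sq :=
  (projIcc 0 1 zero_le_one x, projIcc 0 1 zero_le_one y)

theorem toSq_fst {x y : ℝ} (h : 0 ≤ x) (h' : x ≤ 1) : ((toSq x y).1 : ℝ) = x := by
  simp [toSq, coe_projIcc, h, h']

theorem toSq_snd {x y : ℝ} (h : 0 ≤ y) (h' : y ≤ 1) : ((toSq x y).2 : ℝ) = y := by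
  simp [toSq, coe_projIcc, h, h']

theorem toSq_coe (z : Sq) : toSq z.1 z.2 = z := by
  simp [toSq, projIcc_val]

def sAp : Set Sq := {z | InAp z.1 z.2}

def sAm : Set Sq := {z | InAm z.1 z.2}

def sT : Set Sq := {z | InT z.1 z.2}

def sT' : Set Sq := {z | InT' z.1 z.2}

noncomputable def sd (z : Sq) : ℝ := dP z.1 z.2

noncomputable def se (z : Sq) : ℝ := dQ z.1 z.2

theorem regions : Regions sAp sAm sT sT' sd se where
  isClosed_Ap := by
    simp only [sAp, InAp, ofPred_and]
    refine (isClosed_le ?_ ?_).inter ((isClosed_le ?_ ?_).inter (isClosed_le ?_ ?_)) <;> fun_prop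
  isClosed_Am := by
    simp only [sAm, InAm, ofPred_and]
    refine (isClosed_le ?_ ?_).inter ((isClosed_le ?_ ?_).inter (isClosed_le ?_ ?_)) <;> fun_prop
  isClosed_T := by
    refine isClosed_le ?_ ?_ <;> fun_prop
  isClosed_T' := by
    simp only [sT', InT', ofPred_or]
    refine (isClosed_le ?_ ?_).union (isClosed_le ?_ ?_) <;> fun_prop
  cover z := by
    obtain ⟨⟨x, hx⟩, ⟨y, hy⟩⟩ := z
    simp only [sAp, sAm, sT, sT', mem_ofPred_eq, InAp, InAm, InT, InT']
    grind
  continuous_d := by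
    unfold sd dP
    fun_prop
  continuous_e := by
    unfold se dQ
    fun_prop
  d_nonneg z := le_max_left _ _
  d_le z := by
    unfold sd dP
    grind
  e_nonneg z := le_max_left _ _
  e_le z := by
    unfold se dQ
    grind
  e_of_T z hz := dQ_eq_zero hz
  d_of_T' z hz := dP_eq_zero hz
  slit z h h' := eq_half h h'

theorem of_toSq {p : ℝ → ℝ → Prop} {x y : ℝ} (h : 0 ≤ x ∧ x ≤ 1 ∧ 0 ≤ y ∧ y ≤ 1)
    (hp : p x y) : p (toSq x y).1 (toSq x y).2 := by
  rwa [toSq_fst h.1 h.2.1, toSq_snd h.2.2.1 h.2.2.2]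

/-- The chart of the first foliation. -/
noncomputable def chartP : Chart sAp sAm sT sd se where
  L := LP
  psi t d := toSq (xP ((t + d) / 2) d) (yP ((t + d) / 2) d)
  th z := thP z.1 z.2
  continuous_L := by unfold LP; fun_prop
  antitone_L a b h := by
    simp only [LP]
    exact max_le_max (by linarith) (by linarith)
  L_half := by norm_num [LP]
  continuousOn_psi := by
    apply Continuous.continuousOn
    unfold toSq xP yP
    exact (continuous_projIcc.comp (by fun_prop)).prodMk (continuous_projIcc.comp (by fun_prop))
  continuous_th := by unfold thP; fun_prop
  psi_Ap t δ h0 h1 h2 h3 := by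
    obtain ⟨h, h'⟩ := P_Ap h0 h1 h2 h3 rfl rfl
    exact of_toSq (p := fun x y => InAp x y ∧ dP x y = δ ∧ dQ x y = t) h h'
  psi_Am t δ h0 h1 h2 h3 := by
    obtain ⟨h, h'⟩ := P_Am h0 h1 h2 h3 rfl rfl
    exact of_toSq (p := fun x y => InAm x y ∧ dP x y = δ ∧ dQ x y = 1 - t) h h'
  psi_T t δ h0 h1 h2 h3 := by
    obtain ⟨h, h'⟩ := P_T h0 h1 h2 h3 rfl rfl
    exact of_toSq (p := fun x y => InT x y ∧ dP x y = δ ∧ thP x y = t) h h'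
  psi_wrap δ h0 h1 := by rw [(P_wrap h0 h1).1, (P_wrap h0 h1).2]
  of_Ap z hz := by
    simp only [sd, se]
    rw [(P_of_Ap hz).1, (P_of_Ap hz).2, toSq_coe]
  of_Am z hz := by
    simp only [sd, se]
    rw [(P_of_Am hz).1, (P_of_Am hz).2, toSq_coe]
  of_T z hz := by
    obtain ⟨⟨h1, h2⟩, h3⟩ := P_of_T hz z.1.2.1 z.2.2.1
    simp only [sd]
    rw [h1, h2, toSq_coe]
    exact ⟨rfl, h3⟩

/-- The chart of the second foliation. -/
noncomputable def chartQ : Chart sAp sAm sT' se sd where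
  L := LQ
  psi t e := toSq (xQ ((t + e) / 2) e) (yQ ((t + e) / 2) e)
  th z := thQ z.1 z.2
  continuous_L := by unfold LQ; fun_prop
  antitone_L a b h := by
    simp only [LQ]
    exact max_le_max (by linarith) (by linarith)
  L_half := by norm_num [LQ]
  continuousOn_psi := by
    apply Continuous.continuousOn
    unfold toSq xQ yQ
    exact (continuous_projIcc.comp (by fun_prop)).prodMk (continuous_projIcc.comp (by fun_prop))
  continuous_th := by unfold thQ; fun_prop
  psi_Ap t δ h0 h1 h2 h3 := by
    obtain ⟨h, h'⟩ := Q_Ap h0 h1 h2 h3 rfl rfl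
    exact of_toSq (p := fun x y => InAp x y ∧ dQ x y = δ ∧ dP x y = t) h h'
  psi_Am t δ h0 h1 h2 h3 := by
    obtain ⟨h, h'⟩ := Q_Am h0 h1 h2 h3 rfl rfl
    exact of_toSq (p := fun x y => InAm x y ∧ dQ x y = δ ∧ dP x y = 1 - t) h h'
  psi_T t δ h0 h1 h2 h3 := by
    obtain ⟨h, h'⟩ := Q_T' h0 h1 h2 h3 rfl rfl
    exact of_toSq (p := fun x y => InT' x y ∧ dQ x y = δ ∧ thQ x y = t) h h'
  psi_wrap δ h0 h1 := by rw [(Q_wrap h0 h1).1, (Q_wrap h0 h1).2]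
  of_Ap z hz := by
    simp only [sd, se]
    rw [(Q_of_Ap hz).1, (Q_of_Ap hz).2, toSq_coe]
  of_Am z hz := by
    simp only [sd, se]
    rw [(Q_of_Am hz).1, (Q_of_Am hz).2, toSq_coe]
  of_T z hz := by
    obtain ⟨⟨h1, h2⟩, h3⟩ := Q_of_T' hz z.1.2.1 z.1.2.2 z.2.2.1 z.2.2.2
    simp only [se]
    rw [h1, h2, toSq_coe]
    exact ⟨rfl, h3⟩

/-- The concrete system on the unit square. -/
noncomputable def sys : Sys Sq where
  Ap := sAp
  Am := sAm
  T := sT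
  T' := sT'
  d := sd
  e := se
  reg := regions
  P := chartP
  Q := chartQ

end Square

end SheetModel

namespace SheetModel

open Set

namespace Square

/-- On the set `A`, the function `f` is given by finitely many affine polynomials with
integer coefficients. -/
def IsPWOn (A : Set Sq) (f : Sq → ℝ) : Prop :=
  ∃ s : Finset (ℤ × ℤ × ℤ), ∀ z ∈ A, ∃ p ∈ s, f z = p.1 * z.1 + p.2.1 * z.2 + p.2.2

namespace IsPWOn

variable {A B C : Set Sq} {f g h : Sq → ℝ}

theorem of_eq_or (hf : ∀ z ∈ A, (z ∈ B ∧ f z = g z) ∨ (z ∈ C ∧ f z = h z)) (hg : IsPWOn B g)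
    (hh : IsPWOn C h) : IsPWOn A f := by
  classical
  obtain ⟨s, hs⟩ := hg
  obtain ⟨s', hs'⟩ := hh
  refine ⟨s ∪ s', fun z hz => ?_⟩
  rcases hf z hz with ⟨h1, h2⟩ | ⟨h1, h2⟩
  · obtain ⟨p, hp, h3⟩ := hs z h1
    exact ⟨p, Finset.mem_union_left _ hp, h2.trans h3⟩
  · obtain ⟨p, hp, h3⟩ := hs' z h1
    exact ⟨p, Finset.mem_union_right _ hp, h2.trans h3⟩

theorem congr (hg : IsPWOn A g) (hf : ∀ z ∈ A, f z = g z) : IsPWOn A f :=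
  of_eq_or (fun z hz => Or.inl ⟨hz, hf z hz⟩) hg hg

theorem fst : IsPWOn A (fun z => (z.1 : ℝ)) := ⟨{(1, 0, 0)}, fun z _ => by simp⟩

theorem snd : IsPWOn A (fun z => (z.2 : ℝ)) := ⟨{(0, 1, 0)}, fun z _ => by simp⟩

theorem int (n : ℤ) : IsPWOn A (fun _ => (n : ℝ)) := ⟨{(0, 0, n)}, fun z _ => by simp⟩

theorem zero : IsPWOn A (fun _ => (0 : ℝ)) := by simpa using int (A := A) 0

theorem one : IsPWOn A (fun _ => (1 : ℝ)) := by simpa using int (A := A) 1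

theorem ofNat (n : ℕ) [n.AtLeastTwo] : IsPWOn A (fun _ => (OfNat.ofNat n : ℝ)) := by
  simpa using int (A := A) (OfNat.ofNat n)

theorem comp {a b : Sq → ℝ} {F : Sq → Sq} (hf : IsPWOn B f) (hF : ∀ z ∈ A, F z ∈ B)
    (ha : IsPWOn A a) (hb : IsPWOn A b)
    (h1 : ∀ z ∈ A, ((F z).1 : ℝ) = a z) (h2 : ∀ z ∈ A, ((F z).2 : ℝ) = b z) :
    IsPWOn A (fun z => f (F z)) := by
  classical
  obtain ⟨s, hs⟩ := hf
  obtain ⟨sa, ha⟩ := ha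
  obtain ⟨sb, hb⟩ := hb
  refine ⟨(s ×ˢ sa ×ˢ sb).image fun q => (q.1.1 * q.2.1.1 + q.1.2.1 * q.2.2.1,
    q.1.1 * q.2.1.2.1 + q.1.2.1 * q.2.2.2.1,
    q.1.1 * q.2.1.2.2 + q.1.2.1 * q.2.2.2.2 + q.1.2.2), fun z hz => ?_⟩
  obtain ⟨p, hp, h3⟩ := hs _ (hF z hz)
  obtain ⟨p1, hp1, h4⟩ := ha z hz
  obtain ⟨p2, hp2, h5⟩ := hb z hz
  refine ⟨_, Finset.mem_image_of_mem _ (Finset.mk_mem_product hp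
    (Finset.mk_mem_product hp1 hp2)), ?_⟩
  simp only
  rw [h3, h1 z hz, h2 z hz, h4, h5]
  push_cast
  ring

theorem combine (m n : ℤ) (hf : IsPWOn A f) (hg : IsPWOn A g) :
    IsPWOn A (fun z => m * f z + n * g z) := by
  classical
  obtain ⟨s, hs⟩ := hf
  obtain ⟨s', hs'⟩ := hg
  refine ⟨(s ×ˢ s').image fun q => (m * q.1.1 + n * q.2.1, m * q.1.2.1 + n * q.2.2.1,
    m * q.1.2.2 + n * q.2.2.2), fun z hz => ?_⟩
  obtain ⟨p, hp, h3⟩ := hs z hz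
  obtain ⟨p', hp', h4⟩ := hs' z hz
  refine ⟨_, Finset.mem_image_of_mem _ (Finset.mk_mem_product hp hp'), ?_⟩
  simp only
  rw [h3, h4]
  push_cast
  ring

theorem add (hf : IsPWOn A f) (hg : IsPWOn A g) : IsPWOn A (fun z => f z + g z) := by
  simpa using combine 1 1 hf hg

theorem sub (hf : IsPWOn A f) (hg : IsPWOn A g) : IsPWOn A (fun z => f z - g z) := by
  simpa [sub_eq_add_neg] using combine 1 (-1) hf hg

theorem ofNat_mul (n : ℕ) [n.AtLeastTwo] (hf : IsPWOn A f) :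
    IsPWOn A (fun z => (OfNat.ofNat n : ℝ) * f z) := by
  simpa using combine (OfNat.ofNat n) 0 hf hf

theorem max (hf : IsPWOn A f) (hg : IsPWOn A g) : IsPWOn A (fun z => max (f z) (g z)) :=
  of_eq_or (fun z hz => (max_choice (f z) (g z)).imp (fun h => ⟨hz, h⟩) fun h => ⟨hz, h⟩) hf hg

theorem min (hf : IsPWOn A f) (hg : IsPWOn A g) : IsPWOn A (fun z => min (f z) (g z)) :=
  of_eq_or (fun z hz => (min_choice (f z) (g z)).imp (fun h => ⟨hz, h⟩) fun h => ⟨hz, h⟩) hf hg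

theorem sd : IsPWOn A sd := by
  unfold Square.sd dP
  repeat' first
    | apply fst | apply snd | apply max | apply min | apply ofNat_mul
    | apply sub | apply add | apply zero | apply one | apply ofNat

theorem se : IsPWOn A se := by
  unfold Square.se dQ
  repeat' first
    | apply fst | apply snd | apply max | apply min | apply ofNat_mul
    | apply sub | apply add | apply zero | apply one | apply ofNat

theorem xP (hf : IsPWOn A f) (hg : IsPWOn A g) : IsPWOn A (fun z => xP (f z) (g z)) := by
  unfold Square.xP
  repeat' first
    | exact hf | exact hg | apply max | apply min | apply ofNat_mul
    | apply sub | apply add | apply zero | apply one | apply ofNat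

theorem yP (hf : IsPWOn A f) (hg : IsPWOn A g) : IsPWOn A (fun z => yP (f z) (g z)) := by
  unfold Square.yP
  repeat' first
    | exact hf | exact hg | apply max | apply min | apply ofNat_mul
    | apply sub | apply add | apply zero | apply one | apply ofNat

theorem xQ (hf : IsPWOn A f) (hg : IsPWOn A g) : IsPWOn A (fun z => xQ (f z) (g z)) := by
  unfold Square.xQ
  repeat' first
    | exact hf | exact hg | apply max | apply min | apply ofNat_mul
    | apply sub | apply add | apply zero | apply one | apply ofNat

theorem yQ (hf : IsPWOn A f) (hg : IsPWOn A g) : IsPWOn A (fun z => yQ (f z) (g z)) := by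
  unfold Square.yQ
  repeat' first
    | exact hf | exact hg | apply max | apply min | apply ofNat_mul
    | apply sub | apply add | apply zero | apply one | apply ofNat

theorem LP (hf : IsPWOn A f) : IsPWOn A (fun z => LP (f z)) := by
  unfold Square.LP
  repeat' first
    | exact hf | apply max | apply min | apply ofNat_mul
    | apply sub | apply add | apply zero | apply one | apply ofNat

theorem LQ (hf : IsPWOn A f) : IsPWOn A (fun z => LQ (f z)) := by
  unfold Square.LQ
  repeat' first
    | exact hf | apply max | apply min | apply ofNat_mul
    | apply sub | apply add | apply zero | apply one | apply ofNat

end IsPWOn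

/-- Both coordinates of `F` are given on `A` by finitely many affine polynomials with integer
coefficients. -/
def IsPWMapOn (A : Set Sq) (F : Sq → Sq) : Prop :=
  IsPWOn A (fun z => ((F z).1 : ℝ)) ∧ IsPWOn A (fun z => ((F z).2 : ℝ))

theorem IsPWMapOn.id {A : Set Sq} : IsPWMapOn A fun z => z := ⟨IsPWOn.fst, IsPWOn.snd⟩

theorem IsPWMapOn.comp {F G : Sq → Sq} (hF : IsPWMapOn univ F) (hG : IsPWMapOn univ G) :
    IsPWMapOn univ fun z => F (G z) :=
  ⟨hF.1.comp (fun _ _ => mem_univ _) hG.1 hG.2 (fun _ _ => rfl) fun _ _ => rfl,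
    hF.2.comp (fun _ _ => mem_univ _) hG.1 hG.2 (fun _ _ => rfl) fun _ _ => rfl⟩

theorem IsPWMapOn.of_eq_or {A B C : Set Sq} {F G H : Sq → Sq}
    (hF : ∀ z ∈ A, (z ∈ B ∧ F z = G z) ∨ (z ∈ C ∧ F z = H z)) (hG : IsPWMapOn B G)
    (hH : IsPWMapOn C H) : IsPWMapOn A F :=
  ⟨IsPWOn.of_eq_or (fun z hz => (hF z hz).imp (fun h => ⟨h.1, by rw [h.2]⟩)
      fun h => ⟨h.1, by rw [h.2]⟩) hG.1 hH.1,
    IsPWOn.of_eq_or (fun z hz => (hF z hz).imp (fun h => ⟨h.1, by rw [h.2]⟩)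
      fun h => ⟨h.1, by rw [h.2]⟩) hG.2 hH.2⟩

theorem IsPWMapOn.toSq {A : Set Sq} {f g : Sq → ℝ} (hf : IsPWOn A f) (hg : IsPWOn A g) :
    IsPWMapOn A fun z => toSq (f z) (g z) := by
  simp only [IsPWMapOn, Square.toSq, coe_projIcc]
  exact ⟨.max .zero (.min .one hf), .max .zero (.min .one hg)⟩

variable {Ap Am T T' : Set Sq} {d e : Sq → ℝ}

/-- The integrality properties of a chart which make its twist piecewise affine with integer
coefficients. -/
structure IsIntegralChart (P : Chart Ap Am T d e) : Prop where
  d_pw : ∀ A : Set Sq, IsPWOn A d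
  L_pw : ∀ (A : Set Sq) (f : Sq → ℝ), IsPWOn A f → IsPWOn A fun z => P.L (f z)
  psi_pw : ∀ (A : Set Sq) (t f : Sq → ℝ), IsPWOn A (fun z => (t z + f z) / 2) → IsPWOn A f →
    IsPWMapOn A fun z => P.psi (t z) (f z)
  half_Ap : IsPWOn Ap fun z => (e z + d z) / 2
  half_Am : IsPWOn Am fun z => (1 - e z + d z) / 2
  half_T : IsPWOn T fun z => (P.th z + d z) / 2

theorem IsIntegralChart.psi_shift {P : Chart Ap Am T d e} (hP : IsIntegralChart P) {A : Set Sq}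
    {t : Sq → ℝ} (ht : IsPWOn A fun z => (t z + d z) / 2) (m n : ℤ) :
    IsPWMapOn A fun z => P.psi (t z + m * (2 * d z) + n * (2 * P.L (d z))) (d z) := by
  refine hP.psi_pw A _ d ?_ (hP.d_pw A)
  refine (IsPWOn.combine 1 1 ht (IsPWOn.combine m n (hP.d_pw A)
    (hP.L_pw A d (hP.d_pw A)))).congr fun z _ => ?_
  push_cast
  ring

theorem IsIntegralChart.twist {P : Chart Ap Am T d e} (hP : IsIntegralChart P)
    (r : Regions Ap Am T T' d e) : IsPWMapOn univ (P.twist r) := by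
  have key : ∀ {A : Set Sq} {t : Sq → ℝ}, IsPWOn A (fun z => (t z + d z) / 2) →
      IsPWMapOn A fun z => P.psi (P.step (t z) (d z)) (d z) := by
    intro A t ht
    refine IsPWMapOn.of_eq_or (fun z hz => ?_) (hP.psi_shift ht 1 0) (hP.psi_shift ht 1 (-1))
    unfold Chart.step
    split_ifs
    · left
      simpa using hz
    · right
      simpa [sub_eq_add_neg] using hz
  have main : IsPWMapOn T'ᶜ fun z => P.psi (P.step (P.lift z) (d z)) (d z) := by
    refine key (IsPWOn.of_eq_or (fun z hz => ?_) hP.half_Ap (IsPWOn.of_eq_or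
      (A := (Ap ∪ T')ᶜ) (f := fun z => (P.lift z + d z) / 2) (fun z hz => ?_) hP.half_Am hP.half_T))
    · by_cases h : z ∈ Ap
      · left
        simp [Chart.lift, h]
      · right
        simp only [mem_compl_iff, mem_union, not_or]
        exact ⟨⟨h, hz⟩, trivial⟩
    · simp only [mem_compl_iff, mem_union, not_or] at hz
      by_cases h : z ∈ Am
      · left
        simp [Chart.lift, h, hz.1]
      · right
        rcases r.cover z with h' | h' | h' | h'
        · exact absurd h' hz.1
        · exact absurd h' h
        · simp [Chart.lift, h, hz.1, h']
        · exact absurd h' hz.2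
  refine IsPWMapOn.of_eq_or (fun z _ => ?_) (IsPWMapOn.id (A := T')) main
  by_cases h : z ∈ T'
  · simp [Chart.twist, h]
  · simp [Chart.twist, h]

theorem IsPWMapOn.of_eq_or_or {A : Set Sq} {F G H K : Sq → Sq}
    (hF : ∀ z ∈ A, F z = G z ∨ F z = H z ∨ F z = K z) (hG : IsPWMapOn A G)
    (hH : IsPWMapOn A H) (hK : IsPWMapOn A K) : IsPWMapOn A F := by
  refine of_eq_or (C := {z ∈ A | F z ≠ G z}) (H := F) (fun z hz => ?_) hG
    (of_eq_or (H := K) (fun z hz => ?_) hH hK)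
  · by_cases h : F z = G z
    · exact Or.inl ⟨hz, h⟩
    · exact Or.inr ⟨⟨hz, h⟩, rfl⟩
  · exact ((hF z hz.1).resolve_left hz.2).imp (fun h => ⟨hz.1, h⟩) fun h => ⟨hz.1, h⟩

theorem IsIntegralChart.twist_rev {P : Chart Ap Am T d e} (hP : IsIntegralChart P)
    (r : Regions Ap Am T T' d e) : IsPWMapOn univ ((P.rev r).twist r.rev) := by
  have key : ∀ {A : Set Sq} {t : Sq → ℝ}, IsPWOn A (fun z => (1 - t z + d z) / 2) →
      IsPWMapOn A fun z => (P.rev r).psi ((P.rev r).step (t z) (d z)) (d z) := by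
    intro A t ht
    have h1 : ∀ n : ℤ, IsPWMapOn A
        fun z => P.psi (1 - t z + (-1 : ℤ) * (2 * d z) + n * (2 * P.L (d z))) (d z) :=
      hP.psi_shift ht (-1)
    refine IsPWMapOn.of_eq_or_or (fun z hz => ?_) (h1 0) (h1 1) (h1 2)
    push_cast
    have hs : (P.rev r).step (t z) (d z) = t z + 2 * d z ∨
        (P.rev r).step (t z) (d z) = t z + 2 * d z - 2 * P.L (d z) := by
      unfold Chart.step
      split_ifs
      · exact Or.inl rfl
      · exact Or.inr rfl
    have hpsi : ∀ s, (P.rev r).psi s (d z) = P.psi (1 - s) (d z) ∨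
        (P.rev r).psi s (d z) = P.psi (1 - s + 2 * P.L (d z)) (d z) := by
      intro s
      simp only [Chart.rev]
      split_ifs
      · exact Or.inl rfl
      · exact Or.inr rfl
    rcases hs with hs | hs <;> rw [hs]
    · rcases hpsi (t z + 2 * d z) with h | h <;> rw [h]
      · left
        congr 1
        ring
      · right; left
        congr 1
        ring
    · rcases hpsi (t z + 2 * d z - 2 * P.L (d z)) with h | h <;> rw [h]
      · right; left
        congr 1
        ring
      · right; right
        congr 1
        ring
  have half_T : IsPWOn T fun z => (1 - (P.rev r).th z + d z) / 2 := by
    refine (hP.half_T.combine 1 (-1) (hP.L_pw T d (hP.d_pw T))).congr fun z _ => ?_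
    simp only [Chart.rev]
    push_cast
    ring
  have half_Ap : IsPWOn Ap fun z => (1 - (1 - e z) + d z) / 2 := by simpa using hP.half_Ap
  have main : IsPWMapOn T'ᶜ
      fun z => (P.rev r).psi ((P.rev r).step ((P.rev r).lift z) (d z)) (d z) := by
    refine key (IsPWOn.of_eq_or (fun z hz => ?_) hP.half_Am (IsPWOn.of_eq_or
      (A := (Am ∪ T')ᶜ) (f := fun z => (1 - (P.rev r).lift z + d z) / 2) (fun z hz => ?_) half_Ap half_T))
    · by_cases h : z ∈ Am
      · left
        simp [Chart.lift, h]
      · right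
        simp only [mem_compl_iff, mem_union, not_or]
        exact ⟨⟨h, hz⟩, trivial⟩
    · simp only [mem_compl_iff, mem_union, not_or] at hz
      by_cases h : z ∈ Ap
      · left
        simp [Chart.lift, h, hz.1]
      · right
        rcases r.cover z with h' | h' | h' | h'
        · exact absurd h' h
        · exact absurd h' hz.1
        · simp [Chart.lift, h, hz.1, h']
        · exact absurd h' hz.2
  refine IsPWMapOn.of_eq_or (fun z _ => ?_) (IsPWMapOn.id (A := T')) main
  by_cases h : z ∈ T'
  · simp [Chart.twist, h]
  · simp [Chart.twist, h]

theorem isIntegralChart_P : IsIntegralChart chartP where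
  d_pw _ := .sd
  L_pw _ _ h := .LP h
  psi_pw _ _ _ h h' := .toSq (.xP h h') (.yP h h')
  half_Ap := by
    refine ⟨{(1, 0, 0), (-1, -2, 2)}, fun z hz => ?_⟩
    simp only [Square.sd, Square.se, Finset.mem_insert, Finset.mem_singleton, exists_eq_or_imp,
      exists_eq_left]
    push_cast
    rcases le_total (z.1 : ℝ) (1 - z.2) with h | h
    · left
      rw [(Ap_left hz h).1, (Ap_left hz h).2]
      ring
    · right
      rw [(Ap_right hz h).1, (Ap_right hz h).2]
      ring
  half_Am := by
    refine ⟨{(-1, 0, 1)}, fun z hz => ?_⟩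
    simp only [Square.sd, Square.se, Finset.mem_singleton, exists_eq_left]
    push_cast
    rcases le_total (z.1 : ℝ) (1 / 2) with h | h
    · rw [(Am_left hz h).1, (Am_left hz h).2]
      ring
    · rw [(Am_right hz h).1, (Am_right hz h).2]
      ring
  half_T := by
    refine ⟨{(-1, 0, 1), (-2, 1, 1), (-17, -4, 6)}, fun z hz => ?_⟩
    simp only [Square.sd, chartP, Finset.mem_insert, Finset.mem_singleton, exists_eq_or_imp,
      exists_eq_left]
    push_cast
    rcases T_cases hz z.1.2.1 z.2.2.1 with ⟨e1, e2, -⟩ | ⟨e1, e2, -⟩ | ⟨e1, e2, -⟩ | ⟨e1, e2, -⟩ <;>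
      rw [e1, e2]
    · left
      ring
    · right; left
      ring
    · left
      ring
    · right; right
      ring

theorem isIntegralChart_Q : IsIntegralChart chartQ where
  d_pw _ := .se
  L_pw _ _ h := .LQ h
  psi_pw _ _ _ h h' := .toSq (.xQ h h') (.yQ h h')
  half_Ap := by
    refine ⟨{(1, 0, 0), (-1, -2, 2)}, fun z hz => ?_⟩
    simp only [Square.sd, Square.se, Finset.mem_insert, Finset.mem_singleton, exists_eq_or_imp,
      exists_eq_left]
    push_cast
    rcases le_total (z.1 : ℝ) (1 - z.2) with h | h
    · left
      rw [(Ap_left hz h).1, (Ap_left hz h).2]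
      ring
    · right
      rw [(Ap_right hz h).1, (Ap_right hz h).2]
      ring
  half_Am := by
    refine ⟨{(1, 0, 0)}, fun z hz => ?_⟩
    simp only [Square.sd, Square.se, Finset.mem_singleton, exists_eq_left]
    push_cast
    rcases le_total (z.1 : ℝ) (1 / 2) with h | h
    · rw [(Am_left hz h).1, (Am_left hz h).2]
      ring
    · rw [(Am_right hz h).1, (Am_right hz h).2]
      ring
  half_T := by
    refine ⟨{(1, 0, 0), (3, 1, -2), (-1, 1, 1), (-1, 5, -2)}, fun z hz => ?_⟩
    simp only [Square.se, chartQ, Finset.mem_insert, Finset.mem_singleton, exists_eq_or_imp,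
      exists_eq_left]
    push_cast
    rcases T'_cases hz z.1.2.1 z.1.2.2 z.2.2.1 z.2.2.2 with ⟨e1, e2, -⟩ | ⟨e1, e2, -⟩ |
      ⟨e1, e2, -⟩ | ⟨e1, e2, -⟩ | ⟨e1, e2, -⟩ <;> rw [e1, e2]
    · left
      ring
    · right; left
      ring
    · right; left
      ring
    · right; right; left
      ring
    · right; right; right
      ring

theorem isPWMapOn_F : IsPWMapOn univ sys.F := by
  have h1 : IsPWMapOn univ sys.h := isIntegralChart_P.twist regions
  have h2 : IsPWMapOn univ sys.swap.h := isIntegralChart_Q.twist regions.swap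
  exact h2.comp (h2.comp (h1.comp h1))

theorem isPWMapOn_F_rev : IsPWMapOn univ sys.rev.swap.F := by
  have h1 : IsPWMapOn univ sys.rev.h := isIntegralChart_P.twist_rev regions
  have h2 : IsPWMapOn univ sys.rev.swap.h := isIntegralChart_Q.twist_rev regions.swap
  exact h1.comp (h1.comp (h2.comp h2))

end Square

end SheetModel

namespace SheetModel

open Set

namespace Square

variable {m : ℕ}

/-- The `j`-th pair of coordinates of a point of `[0,1]^(m+m)`. -/
noncomputable def pairAt (x : Fin (m + m) → ℝ) (j : Fin m) : Sq :=
  toSq (x (Fin.castAdd m j)) (x (Fin.natAdd m j))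

/-- The point of `[0,1]^(m+m)` with given pairs of coordinates. -/
def ofPairs (z : Fin m → Sq) : Fin (m + m) → ℝ :=
  Fin.append (fun j => ((z j).1 : ℝ)) fun j => ((z j).2 : ℝ)

/-- The map acting by `G` on each pair of coordinates. -/
noncomputable def onPairs (G : Sq → Sq) (x : Fin (m + m) → ℝ) : Fin (m + m) → ℝ :=
  ofPairs fun j => G (pairAt x j)

theorem ofPairs_mem (z : Fin m → Sq) : ofPairs z ∈ unitCube (m + m) := by
  intro i _
  refine Fin.addCases (fun j => ?_) (fun j => ?_) i
  · simp only [ofPairs, Fin.append_left]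
    exact (z j).1.2
  · simp only [ofPairs, Fin.append_right]
    exact (z j).2.2

theorem pairAt_ofPairs (z : Fin m → Sq) (j : Fin m) : pairAt (ofPairs z) j = z j := by
  simp only [pairAt, ofPairs, Fin.append_left, Fin.append_right, toSq_coe]

theorem coe_pairAt_fst {x : Fin (m + m) → ℝ} (hx : x ∈ unitCube (m + m)) (j : Fin m) :
    ((pairAt x j).1 : ℝ) = x (Fin.castAdd m j) :=
  toSq_fst (hx _ (mem_univ _)).1 (hx _ (mem_univ _)).2

theorem coe_pairAt_snd {x : Fin (m + m) → ℝ} (hx : x ∈ unitCube (m + m)) (j : Fin m) :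
    ((pairAt x j).2 : ℝ) = x (Fin.natAdd m j) :=
  toSq_snd (hx _ (mem_univ _)).1 (hx _ (mem_univ _)).2

theorem ofPairs_pairAt {x : Fin (m + m) → ℝ} (hx : x ∈ unitCube (m + m)) :
    ofPairs (pairAt x) = x := by
  ext i
  refine Fin.addCases (fun j => ?_) (fun j => ?_) i
  · simp only [ofPairs, Fin.append_left]
    exact coe_pairAt_fst hx j
  · simp only [ofPairs, Fin.append_right]
    exact coe_pairAt_snd hx j

theorem onPairs_onPairs {G H : Sq → Sq} (h : ∀ z, G (H z) = z) {x : Fin (m + m) → ℝ}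
    (hx : x ∈ unitCube (m + m)) : onPairs G (onPairs H x) = x := by
  simp only [onPairs, pairAt_ofPairs, h]
  exact ofPairs_pairAt hx

theorem pairAt_iterate (G : Sq → Sq) (k : ℕ) (x : Fin (m + m) → ℝ) (j : Fin m) :
    pairAt ((onPairs G)^[k] x) j = G^[k] (pairAt x j) := by
  induction k with
  | zero => rfl
  | succ k ih =>
    rw [Function.iterate_succ_apply', Function.iterate_succ_apply', ← ih]
    exact pairAt_ofPairs _ j

theorem iterate_mem (G : Sq → Sq) (k : ℕ) {x : Fin (m + m) → ℝ} (hx : x ∈ unitCube (m + m)) :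
    (onPairs G)^[k] x ∈ unitCube (m + m) := by
  cases k with
  | zero => exact hx
  | succ k =>
    rw [Function.iterate_succ_apply']
    exact ofPairs_mem _

theorem continuous_pairAt (j : Fin m) : Continuous fun x : Fin (m + m) → ℝ => pairAt x j :=
  (continuous_projIcc.comp (continuous_apply _)).prodMk
    (continuous_projIcc.comp (continuous_apply _))

theorem IsPWOn.exists_affine {f : Sq → ℝ} (hf : IsPWOn univ f) (j : Fin m) :
    ∃ (N : ℕ) (a : Fin N → Fin (m + m) → ℤ) (b : Fin N → ℤ),
      ∀ x ∈ unitCube (m + m), ∃ l : Fin N,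
        f (pairAt x j) = (∑ i, (a l i : ℝ) * x i) + (b l : ℝ) := by
  obtain ⟨s, hs⟩ := hf
  refine ⟨s.card, fun l => Fin.append (Pi.single j (s.equivFin.symm l).1.1)
    (Pi.single j (s.equivFin.symm l).1.2.1), fun l => (s.equivFin.symm l).1.2.2, fun x hx => ?_⟩
  obtain ⟨p, hp, h⟩ := hs (pairAt x j) (mem_univ _)
  refine ⟨s.equivFin ⟨p, hp⟩, ?_⟩
  rw [h, coe_pairAt_fst hx, coe_pairAt_snd hx]
  simp [Fin.sum_univ_add, Pi.single_apply, -Fin.natAdd_eq_addNat]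

theorem isMcNaughtonMap_onPairs {G : Sq → Sq} (hc : Continuous G) (hG : IsPWMapOn univ G) :
    IsMcNaughtonMap (onPairs (m := m) G) := by
  intro i
  have hmaps : MapsTo (fun x => onPairs (m := m) G x i) (unitCube (m + m)) (Icc 0 1) :=
    fun x _ => ofPairs_mem _ i (mem_univ i)
  revert hmaps
  refine Fin.addCases (fun j => ?_) (fun j => ?_) i <;> intro hmaps
  · have e : (fun x => onPairs (m := m) G x (Fin.castAdd m j)) =
        fun x => ((G (pairAt x j)).1 : ℝ) := by
      funext x
      simp only [onPairs, ofPairs, Fin.append_left]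
    rw [e] at hmaps ⊢
    exact ⟨(continuous_subtype_val.comp (continuous_fst.comp
      (hc.comp (continuous_pairAt j)))).continuousOn, hmaps, hG.1.exists_affine j⟩
  · have e : (fun x => onPairs (m := m) G x (Fin.natAdd m j)) =
        fun x => ((G (pairAt x j)).2 : ℝ) := by
      funext x
      simp only [onPairs, ofPairs, Fin.append_right]
    rw [e] at hmaps ⊢
    exact ⟨(continuous_subtype_val.comp (continuous_snd.comp
      (hc.comp (continuous_pairAt j)))).continuousOn, hmaps, hG.2.exists_affine j⟩

/-- Near a point of the cube, an open set contains a product of open sets of the square. -/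
theorem exists_box {U : Set (Fin (m + m) → ℝ)} (hU : IsOpen U)
    (hne : (U ∩ unitCube (m + m)).Nonempty) :
    ∃ W : Fin m → Set Sq, (∀ j, IsOpen (W j) ∧ (W j).Nonempty) ∧
      ∀ y ∈ unitCube (m + m), (∀ j, pairAt y j ∈ W j) → y ∈ U := by
  obtain ⟨x, hxU, hx⟩ := hne
  obtain ⟨ε, hε, hball⟩ := Metric.isOpen_iff.1 hU x hxU
  refine ⟨fun j => Metric.ball (pairAt x j) ε,
    fun j => ⟨Metric.isOpen_ball, _, Metric.mem_ball_self hε⟩, fun y hy hyW => hball ?_⟩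
  rw [Metric.mem_ball, dist_pi_lt_iff hε]
  have key : ∀ j, dist (y (Fin.castAdd m j)) (x (Fin.castAdd m j)) < ε ∧
      dist (y (Fin.natAdd m j)) (x (Fin.natAdd m j)) < ε := by
    intro j
    have := hyW j
    rw [Metric.mem_ball, Prod.dist_eq, max_lt_iff, Subtype.dist_eq, Subtype.dist_eq,
      coe_pairAt_fst hx, coe_pairAt_snd hx, coe_pairAt_fst hy, coe_pairAt_snd hy] at this
    exact this
  exact fun i => Fin.addCases (fun j => (key j).1) (fun j => (key j).2) i

theorem onPairs_transitive {G : Sq → Sq}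
    (hG : ∀ U V : Set Sq, IsOpen U → IsOpen V → U.Nonempty → V.Nonempty →
      ∃ N, ∀ k ≥ N, ∃ z ∈ U, G^[k] z ∈ V)
    {U V : Set (Fin (m + m) → ℝ)} (hU : IsOpen U) (hV : IsOpen V)
    (hU' : (U ∩ unitCube (m + m)).Nonempty) (hV' : (V ∩ unitCube (m + m)).Nonempty) :
    ∃ k : ℕ, ((onPairs G)^[k] '' (U ∩ unitCube (m + m)) ∩ V).Nonempty := by
  obtain ⟨A, hA, hAU⟩ := exists_box hU hU'
  obtain ⟨B, hB, hBV⟩ := exists_box hV hV'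
  choose N hN using fun j => hG (A j) (B j) (hA j).1 (hB j).1 (hA j).2 (hB j).2
  choose z hzA hzB using fun j => hN j (Finset.univ.sup N) (Finset.le_sup (Finset.mem_univ j))
  refine ⟨Finset.univ.sup N, _, ⟨ofPairs z, ⟨hAU _ (ofPairs_mem z) fun j => ?_, ofPairs_mem z⟩,
    rfl⟩, hBV _ (iterate_mem G _ (ofPairs_mem z)) fun j => ?_⟩
  · rw [pairAt_ofPairs]
    exact hzA j
  · rw [pairAt_iterate, pairAt_ofPairs]
    exact hzB j

end Square

end SheetModel

/-- For every even `n ≥ 2` there is a topologically transitive McNaughton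
homeomorphism of `[0,1]^n`: some iterate carries (the trace on the cube of) any
nonempty open set to meet any other. -/
theorem exists_transitive_mcnaughton_homeo_even (n : ℕ) (hn : 2 ≤ n)
    (heven : Even n) :
    ∃ S : (Fin n → ℝ) → (Fin n → ℝ), IsMcNaughtonHomeo S ∧
      ∀ U V : Set (Fin n → ℝ), IsOpen U → IsOpen V →
        (U ∩ unitCube n).Nonempty → (V ∩ unitCube n).Nonempty →
        ∃ k : ℕ, (S^[k] '' (U ∩ unitCube n) ∩ V).Nonempty := by
  open SheetModel Square in
  obtain ⟨m, rfl⟩ := heven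
  exact ⟨onPairs sys.F, ⟨isMcNaughtonMap_onPairs sys.continuous_F isPWMapOn_F,
    onPairs sys.rev.swap.F, isMcNaughtonMap_onPairs sys.rev.swap.continuous_F isPWMapOn_F_rev,
    fun _ hx => onPairs_onPairs sys.F_rev_F hx, fun _ hx => onPairs_onPairs sys.F_F_rev hx⟩,
    fun U V hU hV hU' hV' => onPairs_transitive
      (fun _ _ => sys.F_mixing) hU hV hU' hV'⟩
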